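/- Let k and ℓ be number fields, let a, b ∈ k and c, d ∈ ℓ be nonzero, set K = k_{a,b} and L = ℓ_{c,d}, and suppose K is k-algebra isomorphic to k(t) and L is ℓ-algebra isomorphic to ℓ(t) (i.e., both are purely transcendental). If α is a Witt equivalence from K to L, then α induces a Witt equivalence from k to ℓ (namely, the group isomorphism kˣ/kˣ² → ℓˣ/ℓˣ² obtained by restricting α to the images of kˣ/kˣ² and ℓˣ/ℓˣ²), and moreover the 2-ranks of the ideal class groups of k and ℓ are equal, i.e., |Cl(k)/Cl(k)²| = |Cl(ℓ)/Cl(ℓ)²|. -/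

import Mathlib

open MvPolynomial

noncomputable section

/-- The defining polynomial `a·x² + b·y² − 1` of the affine conic. -/
def conicPoly (k : Type*) [Field k] (a b : k) : MvPolynomial (Fin 2) k :=
  C a * X 0 ^ 2 + C b * X 1 ^ 2 - 1

/-- The coordinate ring `k[x,y]/(a·x² + b·y² − 1)` of the affine conic. -/
abbrev ConicRing (k : Type*) [Field k] (a b : k) : Type _ :=
  MvPolynomial (Fin 2) k ⧸ Ideal.span {conicPoly k a b}

/-- `K` (together with the embedding `ι : k →+* K`) is a model of the function field
`k_{a,b}`, i.e. the quotient field of `k[x,y]/(a·x² + b·y² − 1)`. -/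
def IsConicFunctionField (k : Type*) [Field k] (a b : k)
    (K : Type*) [Field K] (ι : k →+* K) : Prop :=
  ∃ f : ConicRing k a b →+* K,
    Function.Injective f ∧
    f.comp (algebraMap k (ConicRing k a b)) = ι ∧
    ∀ z : K, ∃ p q : ConicRing k a b, f q ≠ 0 ∧ z = f p / f q

/-- The subgroup of squares in `Kˣ`. -/
def sqSubgroup (K : Type*) [Field K] : Subgroup Kˣ :=
  MonoidHom.range (powMonoidHom 2 : Kˣ →* Kˣ)

/-- The square class group `Kˣ/Kˣ²`. -/
abbrev SqClass (K : Type*) [Field K] := Kˣ ⧸ sqSubgroup K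

/-- The square class of a unit. -/
def sqCl {K : Type*} [Field K] (u : Kˣ) : SqClass K := QuotientGroup.mk u

/-- `α : Kˣ/Kˣ² → Lˣ/Lˣ²` is a Witt equivalence: it sends `-1` to `-1` and preserves
binary value sets. -/
structure IsWittEquiv {K L : Type*} [Field K] [Field L]
    (α : SqClass K ≃* SqClass L) : Prop where
  map_neg_one : α (sqCl (-1)) = sqCl (-1)
  represents : ∀ (a b c : Kˣ) (a' b' c' : Lˣ),
    α (sqCl a) = sqCl a' → α (sqCl b) = sqCl b' → α (sqCl c) = sqCl c' →
    ((∃ x y : K, (c : K) = (a : K) * x ^ 2 + (b : K) * y ^ 2) ↔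
      (∃ x y : L, (c' : L) = (a' : L) * x ^ 2 + (b' : L) * y ^ 2))

/-- Two fields are Witt equivalent if there is a Witt equivalence between them. -/
def WittEquivalent (K L : Type*) [Field K] [Field L] : Prop :=
  ∃ α : SqClass K ≃* SqClass L, IsWittEquiv α

/-- An ordering of a field `F`. -/
structure IsOrdering {F : Type*} [Field F] (P : Set F) : Prop where
  add_mem : ∀ x ∈ P, ∀ y ∈ P, x + y ∈ P
  mul_mem : ∀ x ∈ P, ∀ y ∈ P, x * y ∈ P
  total : ∀ x : F, x ∈ P ∨ -x ∈ P
  antisymm : ∀ x : F, x ∈ P → -x ∈ P → x = 0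


/-- A pair of multiplicative subgroups `N ⊆ U` of a field, with `U` of index at most two and
containing `-1`, and such that `1 - b ∈ U` implies `1 - b ∈ N` for `b ∉ U`. -/
structure IsRigidPair {K : Type*} [Field K] (U N : Set K) : Prop where
  le : N ⊆ U
  zero : (0 : K) ∉ U
  mulN : ∀ {x y}, x ∈ N → y ∈ N → x * y ∈ N
  invN : ∀ {x}, x ∈ N → x⁻¹ ∈ N
  mulU : ∀ {x y}, x ∈ U → y ∈ U → x * y ∈ U
  invU : ∀ {x}, x ∈ U → x⁻¹ ∈ U
  sq : ∀ {x}, x ≠ 0 → x * x ∈ N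
  neg : ∀ {x}, x ∈ U → -x ∈ U
  idx : ∀ {x y}, x ≠ 0 → y ≠ 0 → x ∉ U → y ∉ U → x * y ∈ U
  rigid : ∀ {b}, b ≠ 0 → b ∉ U → 1 - b ∈ U → 1 - b ∈ N

namespace IsRigidPair

variable {K : Type*} [Field K] {U N : Set K} (h : IsRigidPair U N)

include h

lemma one : (1 : K) ∈ N := by simpa using h.sq (one_ne_zero)

lemma ne_zero {x : K} (hx : x ∈ U) : x ≠ 0 := fun h0 => h.zero (h0 ▸ hx)

lemma ne_zeroN {x : K} (hx : x ∈ N) : x ≠ 0 := h.ne_zero (h.le hx)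

lemma neg_iff {x : K} : -x ∈ U ↔ x ∈ U := ⟨fun hx => by simpa using h.neg hx, h.neg⟩

lemma inv_iff {x : K} : x⁻¹ ∈ U ↔ x ∈ U := ⟨fun hx => by simpa using h.invU hx, h.invU⟩

lemma mulU_iff {x y : K} (hx : x ∈ U) : x * y ∈ U ↔ y ∈ U :=
  ⟨fun hy => by
    have := h.mulU (h.invU hx) hy
    rwa [inv_mul_cancel_left₀ (h.ne_zero hx)] at this, h.mulU hx⟩

lemma mulN_iff {x y : K} (hx : x ∈ N) : x * y ∈ N ↔ y ∈ N :=
  ⟨fun hy => by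
    have := h.mulN (h.invN hx) hy
    rwa [inv_mul_cancel_left₀ (h.ne_zeroN hx)] at this, h.mulN hx⟩

/-- Cancelling a nonzero square. -/
lemma sq_mulN {x y : K} (hx : x ≠ 0) : x * x * y ∈ N ↔ y ∈ N := h.mulN_iff (h.sq hx)

omit h in
/-- The elements outside `U` of positive value. -/
def pos (U N : Set K) : Set K := {x | x ≠ 0 ∧ x ∉ U ∧ 1 - x ∈ N}

lemma one_sub_ne {x : K} (hx : x ∉ U) : 1 - x ≠ 0 := fun h0 =>
  hx (by rw [← sub_eq_zero.1 h0]; exact h.le h.one)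

lemma pos_or {x : K} (hx : x ≠ 0) (hxU : x ∉ U) : x ∈ pos U N ∨ x⁻¹ ∈ pos U N := by
  have h1 := h.one_sub_ne hxU
  by_cases hU : 1 - x ∈ U
  · exact .inl ⟨hx, hxU, h.rigid hx hxU hU⟩
  · right
    have hi : x⁻¹ ∉ U := by rwa [h.inv_iff]
    refine ⟨inv_ne_zero hx, hi, h.rigid (inv_ne_zero hx) hi ?_⟩
    have : (1 - x⁻¹) = -(x⁻¹ * (1 - x)) := by field_simp; ring
    rw [this, h.neg_iff]
    exact h.idx (inv_ne_zero hx) h1 hi hU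

lemma pos_not {x : K} (hx : x ∈ pos U N) : x⁻¹ ∉ pos U N := by
  rintro ⟨-, -, h3⟩
  obtain ⟨h0, hU, h2⟩ := hx
  apply hU
  rw [← h.neg_iff]
  have := h.mulN h2 (h.invN h3)
  have e : (1 - x) * (1 - x⁻¹)⁻¹ = -x := by
    have hne := h.ne_zeroN h3
    rw [mul_inv_eq_iff_eq_mul₀ hne]
    field_simp
    ring
  rw [e] at this
  exact h.le this

lemma add_mem {z m n : K} (hz : z ≠ 0) (hzU : z ∉ U) (hm : m ∈ N) (hn : n ∈ N) :
    m + z * n ∈ N ∨ z * (m + z * n) ∈ N := by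
  have m0 := h.ne_zeroN hm
  have n0 := h.ne_zeroN hn
  set b := -(z * (n * m⁻¹)) with hb
  have hbU : b ∉ U := by
    rw [hb, h.neg_iff, mul_comm, h.mulU_iff (h.le (h.mulN hn (h.invN hm)))]
    exact hzU
  have hb0 : b ≠ 0 := by
    simp [hb, hz, m0, n0]
  rcases h.pos_or hb0 hbU with hp | hp
  · left
    have := h.mulN hm hp.2.2
    convert this using 1
    rw [hb]; field_simp; ring
  · right
    have := h.mulN (h.mulN hn hp.2.2) (h.sq hz)
    convert this using 1
    rw [hb]; field_simp; ring

lemma one_sub_mul_of_not_mem {x y : K} (hx : x ∈ pos U N) (hy : y ∈ pos U N)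
    (hxy : x * y ∉ N) : 1 - x * y ∈ N := by
  have e1 : 1 - x * y = (1 - x) + x * (1 - y) := by ring
  have e2 : 1 - x * y = (1 - y) + y * (1 - x) := by ring
  rcases h.add_mem hx.1 hx.2.1 hx.2.2 hy.2.2 with h1 | h1
  · rwa [e1]
  rcases h.add_mem hy.1 hy.2.1 hy.2.2 hx.2.2 with h2 | h2
  · rwa [e2]
  rw [← e1] at h1
  rw [← e2] at h2
  exfalso
  apply hxy
  have h3 := h.mulN h1 h2
  have h0 : 1 - x * y ≠ 0 := by rintro h0; rw [h0, mul_zero] at h1; exact h.zero (h.le h1)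
  rw [← h.sq_mulN h0]
  convert h3 using 1
  ring

/-- An element witnessing that the pair `N ⊆ U` is not exceptional. -/
structure _root_.IsRigidWitness {K : Type*} [Field K] (U N : Set K) (u : K) : Prop where
  mem : u ∈ U
  h1 : u ∉ N
  h2 : 1 - u ∉ N
  h3 : -(u * (1 - u)) ∉ N

variable {u : K} (hu : IsRigidWitness U N u)

include hu

lemma witness_inv : 1 - u⁻¹ ∉ N := by
  intro hc
  apply hu.h3
  have h0 := h.ne_zero hu.mem
  rw [← h.sq_mulN h0] at hc
  convert hc using 1
  field_simp
  ring

lemma witness_inv' : u⁻¹ ∉ N := fun hc => hu.h1 (by simpa using h.invN hc)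

lemma div_notMem {x : K} (hxU : x ∉ U) : x * u⁻¹ ∉ U := by
  rw [mul_comm, h.mulU_iff (h.invU hu.mem)]
  exact hxU

lemma one_sub_mul_mem {x y : K} (hx : x ∈ pos U N) (hy : y ∈ pos U N) : 1 - x * y ∈ N := by
  have u0 := h.ne_zero hu.mem
  have x0 := hx.1
  have y0 := hy.1
  by_cases hxy : x * y ∈ N
  swap
  · exact h.one_sub_mul_of_not_mem hx hy hxy
  have e1 : 1 - x * y = (1 - x) + x * (1 - y) := by ring
  rcases h.add_mem hx.1 hx.2.1 hx.2.2 hy.2.2 with h1 | h1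
  · rwa [e1]
  rw [← e1] at h1
  exfalso
  have hz : x * u⁻¹ ∉ U := h.div_notMem hu hx.2.1
  have hz0 : x * u⁻¹ ≠ 0 := mul_ne_zero hx.1 (inv_ne_zero u0)
  rcases h.pos_or hz0 hz with hp | hp
  · set z := x * u⁻¹ with hzdef
    have hzc : z * (x * y)⁻¹ ∉ U := by
      rw [mul_comm, h.mulU_iff (h.le (h.invN hxy))]; exact hz
    rcases h.pos_or (mul_ne_zero hz0 (inv_ne_zero (mul_ne_zero x0 y0))) hzc with hq | hq
    · have := h.one_sub_mul_of_not_mem hy hq (by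
        have : y * (z * (x * y)⁻¹) = u⁻¹ := by rw [hzdef]; field_simp
        rw [this]; exact h.witness_inv' hu)
      have e : y * (z * (x * y)⁻¹) = u⁻¹ := by rw [hzdef]; field_simp
      rw [e] at this
      exact h.witness_inv hu this
    · have e : 1 - x * y = (1 - z) + z * (1 - (z * (x * y)⁻¹)⁻¹) := by
        field_simp; ring
      have hw0 : 1 - x * y ≠ 0 := by rintro h0; rw [h0, mul_zero] at h1; exact h.zero (h.le h1)
      rcases h.add_mem hz0 hz hp.2.2 hq.2.2 with h2 | h2
      · rw [← e] at h2
        exact hx.2.1 (h.le (by rw [← h.mulN_iff h2]; rwa [mul_comm]))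
      · rw [← e] at h2
        apply h.witness_inv' hu
        have h3 := h.mulN h1 h2
        have e' : x * (1 - x * y) * (z * (1 - x * y)) =
          (1 - x * y) * (1 - x * y) * (x * x * u⁻¹) := by rw [hzdef]; ring
        rwa [e', h.sq_mulN hw0, h.sq_mulN x0] at h3
  · have := h.one_sub_mul_of_not_mem hx hp (by
      have : x * (x * u⁻¹)⁻¹ = u := by field_simp
      rw [this]; exact hu.h1)
    have e : x * (x * u⁻¹)⁻¹ = u := by field_simp
    rw [e] at this
    exact hu.h2 this

lemma pos_neg {x : K} (hx : x ∈ pos U N) : -x ∈ pos U N := by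
  refine ⟨neg_ne_zero.2 hx.1, by rw [h.neg_iff]; exact hx.2.1, ?_⟩
  have := h.one_sub_mul_mem hu hx hx
  rw [← h.mulN_iff hx.2.2]
  convert this using 1
  ring

lemma pos_mul_mul {x y z : K} (hx : x ∈ pos U N) (hy : y ∈ pos U N) (hz : z ∈ pos U N) :
    x * y * z ∈ pos U N := by
  have u0 := h.ne_zero hu.mem
  have x0 := hx.1
  have y0 := hy.1
  have z0 := hz.1
  have hxyz : x * y * z ∉ U := by
    rw [h.mulU_iff (h.idx x0 y0 hx.2.1 hy.2.1)]; exact hz.2.1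
  have hxyz0 : x * y * z ≠ 0 := by positivity
  rcases h.pos_or hxyz0 hxyz with hp | hp
  · exact hp
  exfalso
  set d := (x * y * z)⁻¹ with hd
  have h1xyz : 1 - x * y * z ∉ U := by
    have e : 1 - x * y * z = -((1 - d) * (x * y * z)) := by rw [hd]; field_simp; ring
    rw [e, h.neg_iff, h.mulU_iff (h.le hp.2.2)]
    exact hxyz
  have hw0 : 1 - x * y * z ≠ 0 := h.one_sub_ne hxyz
  have hx1 : x * (1 - x * y * z) ∈ N := by
    have e : 1 - x * y * z = (1 - x) + x * (1 - y * z) := by ring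
    rw [e]
    rcases h.add_mem x0 hx.2.1 hx.2.2 (h.one_sub_mul_mem hu hy hz) with h1 | h1
    · rw [← e] at h1; exact absurd (h.le h1) h1xyz
    · exact h1
  have hy1 : y * (1 - x * y * z) ∈ N := by
    have e : 1 - x * y * z = (1 - y) + y * (1 - x * z) := by ring
    rw [e]
    rcases h.add_mem y0 hy.2.1 hy.2.2 (h.one_sub_mul_mem hu hx hz) with h1 | h1
    · rw [← e] at h1; exact absurd (h.le h1) h1xyz
    · exact h1
  have hz1 : z * (1 - x * y * z) ∈ N := by
    have e : 1 - x * y * z = (1 - z) + z * (1 - x * y) := by ring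
    rw [e]
    rcases h.add_mem z0 hz.2.1 hz.2.2 (h.one_sub_mul_mem hu hx hy) with h1 | h1
    · rw [← e] at h1; exact absurd (h.le h1) h1xyz
    · exact h1
  have hyz : y * z ∈ N := by
    rw [← h.sq_mulN hw0]
    convert h.mulN hy1 hz1 using 1
    ring
  have key : ∀ e ∈ pos U N, x * y * z * e ∉ N → 1 - x * y * z * e ∈ N := by
    intro e he hne
    have hxe : x * e ∉ N := by
      rw [← h.mulN_iff hyz]
      convert hne using 2
      ring
    have hxye : x * y * e ∈ pos U N := by
      refine ⟨mul_ne_zero (mul_ne_zero x0 y0) he.1, ?_, ?_⟩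
      · rw [h.mulU_iff (h.idx x0 y0 hx.2.1 hy.2.1)]; exact he.2.1
      · have e1 : 1 - x * y * e = (1 - x) + x * (1 - y * e) := by ring
        have e2 : 1 - x * y * e = (1 - e) + e * (1 - x * y) := by ring
        rcases h.add_mem x0 hx.2.1 hx.2.2 (h.one_sub_mul_mem hu hy he) with h1 | h1
        · rwa [e1]
        rcases h.add_mem he.1 he.2.1 he.2.2 (h.one_sub_mul_mem hu hx hy) with h2 | h2
        · rwa [e2]
        exfalso
        rw [← e1] at h1
        rw [← e2] at h2
        have h0 : 1 - x * y * e ≠ 0 := by rintro h0; rw [h0, mul_zero] at h1; exact h.zero (h.le h1)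
        apply hxe
        rw [← h.sq_mulN h0]
        convert h.mulN h1 h2 using 1
        ring
    convert h.one_sub_mul_mem hu hxye hz using 1
    ring
  set x' := x * y * z with hx'
  have hz : x' * u⁻¹ ∉ U := h.div_notMem hu hxyz
  have hz0 : x' * u⁻¹ ≠ 0 := mul_ne_zero hxyz0 (inv_ne_zero u0)
  rcases h.pos_or hz0 hz with hq | hq
  · have := h.one_sub_mul_mem hu hq hp
    have e : x' * u⁻¹ * d = u⁻¹ := by rw [hd]; field_simp
    rw [e] at this
    exact h.witness_inv hu this
  · have e : x' * (x' * u⁻¹)⁻¹ = u := by field_simp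
    have := key _ hq (by rw [e]; exact hu.h1)
    rw [e] at this
    exact hu.h2 this

omit h hu in
/-- The nonnegative part of `U`. -/
def nonneg (U N : Set K) : Set K := {x | x ∈ U ∧ ∀ a ∈ pos U N, x * a ∈ pos U N}

omit hu in
lemma nonneg_mul {x y : K} (hx : x ∈ nonneg U N) (hy : y ∈ nonneg U N) : x * y ∈ nonneg U N :=
  ⟨h.mulU hx.1 hy.1, fun a ha => by rw [mul_assoc]; exact hx.2 _ (hy.2 _ ha)⟩

lemma pos_mul {x y : K} (hx : x ∈ pos U N) (hy : y ∈ pos U N) : x * y ∈ nonneg U N :=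
  ⟨h.idx hx.1 hy.1 hx.2.1 hy.2.1, fun _ hz => h.pos_mul_mul hu hx hy hz⟩

omit hu in
/-- A failure of nonnegativity produces an element of `pos`. -/
lemma exists_of_not_nonneg {x : K} (hx : x ∈ U) (hn : x ∉ nonneg U N) :
    ∃ a ∈ pos U N, (x * a)⁻¹ ∈ pos U N := by
  have : ∃ a ∈ pos U N, x * a ∉ pos U N := by
    by_contra! hc
    exact hn ⟨hx, hc⟩
  obtain ⟨a, ha, hxa⟩ := this
  refine ⟨a, ha, (h.pos_or (mul_ne_zero (h.ne_zero hx) ha.1) ?_).resolve_left hxa⟩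
  rw [h.mulU_iff hx]
  exact ha.2.1

lemma inv_nonneg_of {x : K} (hx : x ∈ U) (hn : x ∉ nonneg U N) : x⁻¹ ∈ nonneg U N := by
  obtain ⟨a, ha, hb⟩ := h.exists_of_not_nonneg hx hn
  refine ⟨h.invU hx, fun b hb' => ?_⟩
  have := h.pos_mul_mul hu hb' ha hb
  convert this using 1
  have := h.ne_zero hx
  have := ha.1
  field_simp

lemma neg_nonneg {x : K} (hx : x ∈ nonneg U N) : -x ∈ nonneg U N :=
  ⟨h.neg hx.1, fun a ha => by
    have := hx.2 _ (h.pos_neg hu ha)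
    convert this using 1
    ring⟩

omit hu in
lemma one_nonneg : (1 : K) ∈ nonneg U N := ⟨h.le h.one, fun a ha => by simpa using ha⟩

lemma one_add_pos {y : K} (hy : y ∈ pos U N) : 1 + y ∈ N := by
  have := (h.pos_neg hu hy).2.2
  simpa using this

lemma one_add_pos_nonneg {y : K} (hy : y ∈ pos U N) : 1 + y ∈ nonneg U N := by
  have hN := h.one_add_pos hu hy
  have h0 := h.ne_zeroN hN
  by_contra hc
  obtain ⟨z, hz, hr⟩ := h.exists_of_not_nonneg (h.le hN) hc
  have := h.one_sub_mul_mem hu hr hz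
  have z0 := hz.1
  have e : 1 - ((1 + y) * z)⁻¹ * z = (1 + y)⁻¹ * y := by field_simp; ring
  rw [e, h.mulN_iff (h.invN hN)] at this
  exact hy.2.1 (h.le this)

lemma inv_one_sub_nonneg {z : K} (hz : z ∈ pos U N) : (1 - z)⁻¹ ∈ nonneg U N := by
  have hN := hz.2.2
  have h0 := h.ne_zeroN hN
  by_contra hc
  obtain ⟨b, hb, hr⟩ := h.exists_of_not_nonneg (h.invU (h.le hN)) hc
  have := h.one_sub_mul_mem hu hr hb
  have z0 := hb.1
  have e : 1 - ((1 - z)⁻¹ * b)⁻¹ * b = z := by field_simp; ring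
  rw [e] at this
  exact hz.2.1 (h.le this)

omit h hu in
/-- The underlying set of the valuation ring. -/
def ring (U N : Set K) : Set K := {x | x = 0 ∨ x ∈ pos U N ∨ x ∈ nonneg U N}

lemma one_add_nonneg {y : K} (hy : y ∈ nonneg U N) : 1 + y ∈ ring U N := by
  by_cases h0 : 1 + y = 0
  · exact .inl h0
  right
  by_cases hU : 1 + y ∈ U
  · right
    refine ⟨hU, fun z hz => ⟨mul_ne_zero h0 hz.1, ?_, ?_⟩⟩
    · rw [h.mulU_iff hU]; exact hz.2.1
    · have h1 := h.nonneg_mul (h.inv_one_sub_nonneg hu hz) hy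
      have h2 := (h1.2 _ hz).2.2
      have h3 := h.mulN hz.2.2 h2
      have h4 := h.ne_zeroN hz.2.2
      convert h3 using 1
      field_simp
      ring
  · left
    rcases h.pos_or h0 hU with hp | hp
    · exact hp
    exfalso
    have := hp.2.2
    have e : 1 - (1 + y)⁻¹ = y * (1 + y)⁻¹ := by field_simp; ring
    rw [e] at this
    exact hp.2.1 ((h.mulU_iff hy.1).1 (h.le this))

lemma ring_mul {x y : K} (hx : x ∈ ring U N) (hy : y ∈ ring U N) : x * y ∈ ring U N := by
  rcases hx with rfl | hx | hx
  · left; simp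
  · rcases hy with rfl | hy | hy
    · left; simp
    · exact .inr (.inr (h.pos_mul hu hx hy))
    · rw [mul_comm]; exact .inr (.inl (hy.2 _ hx))
  · rcases hy with rfl | hy | hy
    · left; simp
    · exact .inr (.inl (hx.2 _ hy))
    · exact .inr (.inr (h.nonneg_mul hx hy))

lemma ring_or (x : K) : x ∈ ring U N ∨ x⁻¹ ∈ ring U N := by
  by_cases h0 : x = 0
  · left; exact .inl h0
  by_cases hU : x ∈ U
  · by_cases hn : x ∈ nonneg U N
    · exact .inl (.inr (.inr hn))
    · exact .inr (.inr (.inr (h.inv_nonneg_of hu hU hn)))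
  · rcases h.pos_or h0 hU with hp | hp
    · exact .inl (.inr (.inl hp))
    · exact .inr (.inr (.inl hp))

lemma ring_one_add {x : K} (hx : x ∈ ring U N) : 1 + x ∈ ring U N := by
  rcases hx with rfl | hx | hx
  · rw [add_zero]
    exact .inr (.inr h.one_nonneg)
  · exact .inr (.inr (h.one_add_pos_nonneg hu hx))
  · exact h.one_add_nonneg hu hx

lemma ring_add {x y : K} (hx : x ∈ ring U N) (hy : y ∈ ring U N) : x + y ∈ ring U N := by
  by_cases x0 : x = 0
  · simpa [x0] using hy
  by_cases y0 : y = 0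
  · simpa [y0] using hx
  rcases h.ring_or hu (y * x⁻¹) with h1 | h1
  · convert h.ring_mul hu hx (h.ring_one_add hu h1) using 1
    field_simp
  · convert h.ring_mul hu hy (h.ring_one_add hu h1) using 1
    field_simp
    ring

omit h hu in
/-- The valuation ring attached to a non-exceptional rigid pair. -/
def valuationSubring (h : IsRigidPair U N) (hu : IsRigidWitness U N u) : ValuationSubring K where
  carrier := ring U N
  mul_mem' := h.ring_mul hu
  one_mem' := .inr (.inr h.one_nonneg)
  add_mem' := h.ring_add hu
  zero_mem' := .inl rfl
  neg_mem' := by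
    rintro x (rfl | hx | hx)
    · left; simp
    · exact .inr (.inl (h.pos_neg hu hx))
    · exact .inr (.inr (h.neg_nonneg hu hx))
  mem_or_inv_mem' := h.ring_or hu

/-- Units of the valuation ring lie in `U`. -/
lemma mem_of_unit {x : K} (hx : x ∈ h.valuationSubring hu) (hx0 : x ≠ 0)
    (hx' : x⁻¹ ∈ h.valuationSubring hu) : x ∈ U := by
  rcases hx with rfl | hx | hx
  · exact absurd rfl hx0
  · rcases hx' with hx' | hx' | hx'
    · exact absurd (inv_eq_zero.1 hx') hx0
    · exact absurd hx' (h.pos_not hx)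
    · exact absurd (h.inv_iff.1 hx'.1) hx.2.1
  · exact hx.1

/-- One-units of the valuation ring lie in `N`. -/
lemma one_sub_mem {x : K} (hx : x ∈ h.valuationSubring hu)
    (hx' : x⁻¹ ∉ h.valuationSubring hu) : 1 - x ∈ N := by
  rcases hx with rfl | hx | hx
  · simpa using h.one
  · exact hx.2.2
  · have hn : x⁻¹ ∉ nonneg U N := fun hc => hx' (.inr (.inr hc))
    obtain ⟨a, ha, hb⟩ := h.exists_of_not_nonneg (h.invU hx.1) hn
    have := h.one_sub_mul_mem hu ha hb
    have a0 := ha.1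
    have x0 := h.ne_zero hx.1
    have e : a * (x⁻¹ * a)⁻¹ = x := by field_simp
    rwa [e] at this

end IsRigidPair

/-- A commutative group with a distinguished element and a binary relation; the model is the
group of square classes of a field `F`, with the class of `-1`, and with the relation
`rep u y` meaning that `y` is of the form `a ^ 2 - u * b ^ 2`. -/
structure QuadData (G : Type*) [CommGroup G] where
  neg : G
  rep : G → G → Prop

namespace QuadData

variable {G : Type*} [CommGroup G] (S : QuadData G)

/-- The subgroup generated by the elements of `U` represented by `⟨1, -b⟩` for some `b ∉ U`. -/
def core (U : Subgroup G) : Subgroup G :=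
  Subgroup.closure {y | y ∈ U ∧ ∃ b, b ∉ U ∧ S.rep b y}

lemma core_le (U : Subgroup G) : S.core U ≤ U := by
  rw [core, Subgroup.closure_le]
  exact fun y hy => hy.1

/-- Non-exceptionality of `U`. -/
def HasWitness (U : Subgroup G) : Prop :=
  ∃ u ∈ U, u ∉ S.core U ∧ S.neg * u ∉ S.core U ∧
    ∃ y, S.rep u y ∧ y ∉ S.core U ∧ S.neg * u * y ∉ S.core U

/-- Subgroups of index two that come from a valuation. -/
structure Admissible (U : Subgroup G) : Prop where
  index : U.index = 2
  neg : S.neg ∈ U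
  wit : S.HasWitness U

/-- Representability up to the core of `U`. -/
def Absorbs (U : Subgroup G) (x y : G) : Prop :=
  ∃ n ∈ S.core U, ∃ m ∈ S.core U, S.rep (x * n) (y * m)

/-- The admissible subgroups with universal residual binary forms. -/
def EvenType : Set (Subgroup G) :=
  {U | S.Admissible U ∧ ∀ x ∈ U, x ∉ S.core U → ∀ y ∈ U, S.Absorbs U x y}

/-- The admissible subgroups for which `Absorbs` is not transitive. -/
def OddType : Set (Subgroup G) :=
  {U | S.Admissible U ∧ ∃ x y z, y ∉ S.core U ∧ S.Absorbs U x y ∧ S.Absorbs U y z ∧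
    ¬ S.Absorbs U x z}

/-- Finite subsets of the core of `U` are contained in members of `T` missing a fixed element. -/
def Approx (U : Subgroup G) (T : Set (Subgroup G)) : Prop :=
  ∃ g, ∀ E : Finset G, (∀ x ∈ E, x ∈ S.core U) → ∃ V ∈ T, (∀ x ∈ E, x ∈ V) ∧ g ∉ V

/-- Admissible subgroups coming from valuations that are trivial on constants. -/
def Horizontal : Set (Subgroup G) :=
  {U | S.Admissible U ∧ S.Approx U S.EvenType ∧ S.Approx U S.OddType}

/-- The subgroup of constants. -/
def const : Subgroup G := sInf S.Horizontal

/-- The traces on the constants of the admissible subgroups. -/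
def traces : Set (Subgroup G) := {D | ∃ U, S.Admissible U ∧ ¬ S.const ≤ U ∧ D = U ⊓ S.const}

open Classical in
/-- The number of classes of finite families of traces, up to the parities of the constants. -/
def classCard : ℕ :=
  Nat.card (Quot fun f g : Multiset S.traces =>
    ∃ c ∈ S.const, ∀ D : S.traces, Odd (f.count D + g.count D) ↔ c ∉ D.1)

/-- A realisation of `S` as the square class data of a field. -/
structure Realizes {F : Type*} [Field F] (φ : Fˣ →* G) : Prop where
  surj : Function.Surjective φ
  ker : ∀ x, φ x = 1 ↔ ∃ y, x = y * y
  neg : φ (-1) = S.neg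
  rep : ∀ u y : Fˣ, S.rep (φ u) (φ y) ↔ ∃ a b : F, (y : F) = a ^ 2 - u * b ^ 2

end QuadData

/-- The set of field elements with class in a subgroup. -/
def realSet {G : Type*} [CommGroup G] {F : Type*} [Field F] (φ : Fˣ →* G) (H : Subgroup G) :
    Set F := {x | ∃ u : Fˣ, (u : F) = x ∧ φ u ∈ H}

section realSet

variable {G : Type*} [CommGroup G] {F : Type*} [Field F] {φ : Fˣ →* G} {H H' : Subgroup G}

lemma coe_mem_realSet {u : Fˣ} : (u : F) ∈ realSet φ H ↔ φ u ∈ H :=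
  ⟨fun ⟨v, hv, h⟩ => by rwa [← Units.ext hv], fun h => ⟨u, rfl, h⟩⟩

lemma realSet_mono (h : H ≤ H') : realSet φ H ⊆ realSet φ H' := fun _ ⟨u, hu, hu'⟩ =>
  ⟨u, hu, h hu'⟩

lemma realSet_mul {x y : F} (hx : x ∈ realSet φ H) (hy : y ∈ realSet φ H) :
    x * y ∈ realSet φ H := by
  obtain ⟨u, rfl, hu⟩ := hx
  obtain ⟨v, rfl, hv⟩ := hy
  exact ⟨u * v, by simp, by simpa using H.mul_mem hu hv⟩

lemma realSet_inv {x : F} (hx : x ∈ realSet φ H) : x⁻¹ ∈ realSet φ H := by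
  obtain ⟨u, rfl, hu⟩ := hx
  exact ⟨u⁻¹, by simp, by simpa using H.inv_mem hu⟩

lemma one_mem_realSet : (1 : F) ∈ realSet φ H := ⟨1, by simp, by simp⟩

lemma realSet_ne {x : F} (hx : x ∈ realSet φ H) : x ≠ 0 := by
  obtain ⟨u, rfl, hu⟩ := hx
  exact u.ne_zero

lemma realSet_mul_iff {x y : F} (hx : x ∈ realSet φ H) :
    x * y ∈ realSet φ H ↔ y ∈ realSet φ H :=
  ⟨fun hy => by
    have := realSet_mul (realSet_inv hx) hy
    rwa [inv_mul_cancel_left₀ (realSet_ne hx)] at this, realSet_mul hx⟩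

end realSet

namespace QuadData.Realizes

variable {G : Type*} [CommGroup G] {S : QuadData G} {F : Type*} [Field F] {φ : Fˣ →* G}
  (hφ : S.Realizes φ) {U H : Subgroup G}

include hφ

lemma map_sq (y : Fˣ) : φ (y * y) = 1 := (hφ.ker _).2 ⟨y, rfl⟩

lemma sq_mem {x : F} (hx : x ≠ 0) : x * x ∈ realSet φ H :=
  ⟨Units.mk0 x hx * Units.mk0 x hx, by simp, by rw [hφ.map_sq]; exact H.one_mem⟩

lemma neg_mem_iff (hH : S.neg ∈ H) {x : F} : -x ∈ realSet φ H ↔ x ∈ realSet φ H := by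
  have h : (-1 : F) ∈ realSet φ H := ⟨-1, by simp, by rwa [hφ.neg]⟩
  rw [neg_eq_neg_one_mul, realSet_mul_iff h]

lemma mem_core {x b : F} (hx : x ∈ realSet φ U) (hb0 : b ≠ 0) (hb : b ∉ realSet φ U)
    {p q : F} (h : x = p ^ 2 - b * q ^ 2) : x ∈ realSet φ (S.core U) := by
  obtain ⟨x, rfl, hx'⟩ := hx
  refine ⟨x, rfl, Subgroup.subset_closure ⟨hx', φ (Units.mk0 b hb0), fun hc => hb ?_, ?_⟩⟩
  · exact ⟨_, by simp, hc⟩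
  · rw [hφ.rep]
    exact ⟨p, q, by simpa using h⟩

lemma isRigidPair (hidx : U.index = 2) (hneg : S.neg ∈ U) :
    IsRigidPair (realSet φ U) (realSet φ (S.core U)) where
  le := realSet_mono (S.core_le U)
  zero := fun h => realSet_ne h rfl
  mulN := realSet_mul
  invN := realSet_inv
  mulU := realSet_mul
  invU := realSet_inv
  sq := hφ.sq_mem
  neg := (hφ.neg_mem_iff hneg).2
  idx := by
    intro x y hx hy hxU hyU
    refine ⟨Units.mk0 x hx * Units.mk0 y hy, by simp, ?_⟩
    rw [map_mul, Subgroup.mul_mem_iff_of_index_two hidx]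
    refine iff_of_false (fun hc => hxU ⟨_, by simp, hc⟩) (fun hc => hyU ⟨_, by simp, hc⟩)
  rigid := by
    intro b hb0 hb h1
    exact hφ.mem_core h1 hb0 hb (p := 1) (q := 1) (by ring)

lemma exists_witness (h : S.HasWitness U) : ∃ u : F, u ∈ realSet φ U ∧
    u ∉ realSet φ (S.core U) ∧ -u ∉ realSet φ (S.core U) ∧ 1 - u ∉ realSet φ (S.core U) ∧
      -(u * (1 - u)) ∉ realSet φ (S.core U) := by
  obtain ⟨u, huU, h1, h2, y, hr, h3, h4⟩ := h
  obtain ⟨u, rfl⟩ := hφ.surj u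
  obtain ⟨y, rfl⟩ := hφ.surj y
  rw [hφ.rep] at hr
  obtain ⟨a, b, hab⟩ := hr
  rw [← hφ.neg, ← map_mul, ← coe_mem_realSet (φ := φ)] at h2
  rw [← hφ.neg, ← map_mul, ← map_mul, ← coe_mem_realSet (φ := φ)] at h4
  rw [← coe_mem_realSet (φ := φ)] at h1 h3 huU
  push_cast at h2 h4
  have hb : b ≠ 0 := by
    rintro rfl
    apply h3
    have ha : a ≠ 0 := by rintro rfl; simp at hab
    rw [hab]
    simpa [pow_two] using hφ.sq_mem ha
  have ha : a ≠ 0 := by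
    rintro rfl
    apply h4
    rw [hab]
    have := hφ.sq_mem (H := S.core U) (mul_ne_zero u.ne_zero hb)
    convert this using 1
    ring
  have hs : b / a ≠ 0 := div_ne_zero hb ha
  have e1 : (b / a) * (b / a) * u = u * (b / a) ^ 2 := by ring
  have e2 : 1 - u * (b / a) ^ 2 = a⁻¹ * a⁻¹ * y := by rw [hab]; field_simp
  refine ⟨u * (b / a) ^ 2, ?_, ?_, ?_, ?_, ?_⟩
  · rw [← e1, realSet_mul_iff (hφ.sq_mem hs)]; exact huU
  · rw [← e1, realSet_mul_iff (hφ.sq_mem hs)]; exact h1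
  · rw [← e1, ← mul_neg, realSet_mul_iff (hφ.sq_mem hs)]; simpa using h2
  · rw [e2, realSet_mul_iff (hφ.sq_mem (inv_ne_zero ha))]; exact h3
  · have e3 : -(u * (b / a) ^ 2 * (1 - u * (b / a) ^ 2)) =
        (b / a * a⁻¹) * (b / a * a⁻¹) * (-1 * u * y) := by rw [e2]; ring
    rw [e3, realSet_mul_iff (hφ.sq_mem (mul_ne_zero hs (inv_ne_zero ha)))]
    exact h4

/-- Admissible subgroups come from valuation rings. -/
lemma exists_valuationSubring (h : S.Admissible U) : ∃ O : ValuationSubring F,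
    (∀ x, O.valuation x = 1 → x ∈ realSet φ U) ∧
      ∀ x, O.valuation x < 1 → 1 - x ∈ realSet φ (S.core U) := by
  obtain ⟨u, h1, h2, -, h3, h4⟩ := hφ.exists_witness h.wit
  have hR := hφ.isRigidPair h.index h.neg
  have hw : IsRigidWitness (realSet φ U) (realSet φ (S.core U)) u := ⟨h1, h2, h3, h4⟩
  refine ⟨hR.valuationSubring hw, fun x hx => ?_, fun x hx => ?_⟩
  · have hx0 : x ≠ 0 := by rintro rfl; simp at hx
    refine hR.mem_of_unit hw ?_ hx0 ?_
    · rw [← ValuationSubring.valuation_le_one_iff]; exact hx.le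
    · rw [← ValuationSubring.valuation_le_one_iff, map_inv₀, hx, inv_one]
  · by_cases hx0 : x = 0
    · simpa [hx0] using (one_mem_realSet (φ := φ) (H := S.core U))
    refine hR.one_sub_mem hw ?_ ?_
    · rw [← ValuationSubring.valuation_le_one_iff]; exact hx.le
    · rw [← ValuationSubring.valuation_le_one_iff, map_inv₀, not_le]
      exact (one_lt_inv₀ (zero_lt_iff.2 (by simpa using hx0))).2 hx

section Valuation

variable {Γ : Type*} [LinearOrderedCommGroupWithZero Γ] {v : Valuation F Γ}

/-- If the units of a valuation lie in `U`, the core consists of one-units, up to squares. -/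
lemma core_subset (hidx : U.index = 2) (hneg : S.neg ∈ U)
    (hv : ∀ x, v x = 1 → x ∈ realSet φ U) {x : F}
    (hx : x ∈ realSet φ (S.core U)) : ∃ m y : F, v m < 1 ∧ y ≠ 0 ∧ x = (1 - m) * y ^ 2 := by
  have hR := hφ.isRigidPair hidx hneg
  have unit {m : F} (hm : v m < 1) : v (1 - m) = 1 := v.map_one_sub_of_lt hm
  obtain ⟨u, rfl, hu⟩ := hx
  obtain ⟨g, hg⟩ : ∃ g, g = φ u := ⟨_, rfl⟩
  rw [← hg] at hu
  induction hu using Subgroup.closure_induction generalizing u with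
  | mem y hy =>
    subst hg
    obtain ⟨hyU, b, hb, hr⟩ := hy
    obtain ⟨b, rfl⟩ := hφ.surj b
    rw [hφ.rep] at hr
    obtain ⟨p, q, hpq⟩ := hr
    rw [← coe_mem_realSet (φ := φ)] at hyU hb
    by_cases hp : p = 0
    · exfalso
      have hq : q ≠ 0 := by rintro rfl; simp [hp] at hpq
      rw [hpq, hp] at hyU
      have : (0 : F) ^ 2 - b * q ^ 2 = -(q * q * b) := by ring
      rw [this, hR.neg_iff, hR.mulU_iff (hφ.sq_mem hq)] at hyU
      exact hb hyU
    by_cases hq : q = 0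
    · exact ⟨0, p, by simp, hp, by simpa [hq] using hpq⟩
    set c := b * (q / p) ^ 2 with hc
    have hcU : c ∉ realSet φ U := by
      have hs : q / p ≠ 0 := div_ne_zero hq hp
      have : c = (q / p) * (q / p) * b := by rw [hc]; ring
      rw [this, hR.mulU_iff (hφ.sq_mem hs)]
      exact hb
    have h1c : 1 - c ∈ realSet φ U := by
      have : 1 - c = p⁻¹ * p⁻¹ * u := by rw [hpq, hc]; field_simp
      rw [this, hR.mulU_iff (hφ.sq_mem (inv_ne_zero hp))]
      exact hyU
    refine ⟨c, p, ?_, hp, by rw [hpq, hc]; field_simp⟩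
    by_contra hlt
    rcases (not_lt.1 hlt).eq_or_lt with h | h
    · exact hcU (hv c h.symm)
    · have hc0 : c ≠ 0 := by intro h0; rw [h0] at h; simp at h
      have h2 : v c⁻¹ < 1 := by
        rw [map_inv₀]; exact inv_lt_one_of_one_lt₀ h
      have h3 := hv _ (unit h2)
      apply hcU
      have : 1 - c = -((1 - c⁻¹) * c) := by field_simp; ring
      rw [this, hR.neg_iff, hR.mulU_iff h3] at h1c
      exact h1c
  | one =>
    obtain ⟨y, hy⟩ := (hφ.ker u).1 hg.symm
    exact ⟨0, y, by simp, y.ne_zero, by rw [hy]; push_cast; ring⟩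
  | mul g₁ g₂ h₁ h₂ ih₁ ih₂ =>
    obtain ⟨u₁, rfl⟩ := hφ.surj g₁
    obtain ⟨m₁, y₁, hm₁, hy₁, e₁⟩ := ih₁ u₁ rfl
    obtain ⟨m₂, y₂, hm₂, hy₂, e₂⟩ := ih₂ (u * u₁⁻¹) (by rw [map_mul, ← hg, map_inv, mul_comm, inv_mul_cancel_left])
    refine ⟨1 - (1 - m₁) * (1 - m₂), y₁ * y₂, ?_, mul_ne_zero hy₁ hy₂, ?_⟩
    · have : 1 - (1 - m₁) * (1 - m₂) = m₁ + (1 - m₁) * m₂ := by ring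
      rw [this]
      refine v.map_add_lt hm₁ ?_
      rw [map_mul, unit hm₁, one_mul]
      exact hm₂
    · have : (u : F) = u₁ * ((u * u₁⁻¹ : Fˣ) : F) := by push_cast; field_simp
      rw [this, e₁, e₂]
      ring
  | inv g hg' ih =>
    obtain ⟨m, y, hm, hy, e⟩ := ih u⁻¹ (by rw [map_inv, ← hg, inv_inv])
    have h0 : 1 - m ≠ 0 := by
      intro h0
      have := unit hm
      rw [h0] at this
      simp at this
    refine ⟨1 - (1 - m)⁻¹, y⁻¹, ?_, inv_ne_zero hy, ?_⟩
    · have : 1 - (1 - m)⁻¹ = -((1 - m)⁻¹ * m) := by field_simp; ring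
      rw [this, Valuation.map_neg, map_mul, map_inv₀, unit hm, inv_one, one_mul]
      exact hm
    · have : (u : F) = ((u⁻¹ : Fˣ) : F)⁻¹ := by simp
      rw [this, e]
      field_simp
      ring

lemma mem_core_of_eq (hU : ∀ x, v x < 1 → 1 - x ∈ realSet φ (S.core U)) {x m y : F}
    (hm : v m < 1) (hy : y ≠ 0) (hx : x = (1 - m) * y ^ 2) : x ∈ realSet φ (S.core U) := by
  rw [hx, pow_two, mul_comm, realSet_mul_iff (hφ.sq_mem hy)]
  exact hU m hm

end Valuation

/-- `Absorbs` in terms of the field. -/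
lemma absorbs_iff {x y : Fˣ} : S.Absorbs U (φ x) (φ y) ↔
    ∃ p q : F, (p = 0 ∨ p ∈ realSet φ (S.core U)) ∧ (q = 0 ∨ q ∈ realSet φ (S.core U)) ∧
      (y : F) = p - x * q := by
  constructor
  · rintro ⟨n, hn, m, hm, h⟩
    obtain ⟨n, rfl⟩ := hφ.surj n
    obtain ⟨m, rfl⟩ := hφ.surj m
    rw [← map_mul, ← map_mul, hφ.rep] at h
    obtain ⟨a, b, hab⟩ := h
    rw [← coe_mem_realSet (φ := φ)] at hn hm
    push_cast at hab
    refine ⟨(m : F)⁻¹ * (a * a), (m : F)⁻¹ * n * (b * b), ?_, ?_, ?_⟩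
    · by_cases ha : a = 0
      · simp [ha]
      · exact .inr (realSet_mul (realSet_inv hm) (hφ.sq_mem ha))
    · by_cases hb : b = 0
      · simp [hb]
      · exact .inr (realSet_mul (realSet_mul (realSet_inv hm) hn) (hφ.sq_mem hb))
    · have hm0 := realSet_ne hm
      field_simp
      rw [hab]
  · rintro ⟨p, q, hp, hq, h⟩
    rcases hp with rfl | ⟨p, rfl, hp⟩
    · rcases hq with rfl | ⟨q, rfl, hq⟩
      · simp at h
      · refine ⟨1, one_mem _, φ q⁻¹, by simpa using hq, ?_⟩
        rw [mul_one, ← map_mul, hφ.rep]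
        refine ⟨0, 1, ?_⟩
        push_cast
        rw [h]
        field_simp
        ring
    · rcases hq with rfl | ⟨q, rfl, hq⟩
      · refine ⟨1, one_mem _, φ p⁻¹, by simpa using hp, ?_⟩
        rw [mul_one, ← map_mul, hφ.rep]
        refine ⟨1, 0, ?_⟩
        push_cast
        rw [h]
        field_simp
        ring
      · refine ⟨φ (q * p⁻¹), ?_, φ p⁻¹, by simpa using hp, ?_⟩
        · rw [map_mul, map_inv]
          exact mul_mem hq (inv_mem hp)
        rw [← map_mul, ← map_mul, hφ.rep]
        refine ⟨1, 1, ?_⟩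
        push_cast
        rw [h]
        field_simp

end QuadData.Realizes

namespace QuadData.Realizes

variable {G : Type*} [CommGroup G] {S : QuadData G} {F : Type*} [Field F] {φ : Fˣ →* G}
  (hφ : S.Realizes φ) {U H : Subgroup G}
  {Γ : Type*} [LinearOrderedCommGroupWithZero Γ] {v : Valuation F Γ}

include hφ

/-- In residue characteristic two, differences of core elements are in the core or small. -/
lemma sub_mem_core (hidx : U.index = 2) (hneg : S.neg ∈ U)
    (hv : ∀ x, v x = 1 → x ∈ realSet φ U)
    (hU : ∀ x, v x < 1 → 1 - x ∈ realSet φ (S.core U)) (h2 : v 2 < 1) {n m : F}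
    (hn : n ∈ realSet φ (S.core U)) (hm : m ∈ realSet φ (S.core U)) :
    n - m ∈ realSet φ (S.core U) ∨ v (n - m) < v m := by
  have n0 := realSet_ne hn
  have m0 := realSet_ne hm
  have vm0 : v m ≠ 0 := by simpa using m0
  have vn0 : v n ≠ 0 := by simpa using n0
  have h1 : (-1 : F) ∈ realSet φ (S.core U) := by
    have := hU 2 h2
    convert this using 1
    norm_num
  rcases lt_trichotomy (v n) (v m) with h | h | h
  · left
    have h3 : v (n / m) < 1 := by rw [map_div₀]; exact (div_lt_one₀ (zero_lt_iff.2 vm0)).2 h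
    convert realSet_mul (realSet_mul h1 hm) (hU _ h3) using 1
    field_simp
    ring
  · have hq : n / m ∈ realSet φ (S.core U) := by
      rw [div_eq_mul_inv]; exact realSet_mul hn (realSet_inv hm)
    obtain ⟨e, t, he, ht, hq'⟩ := hφ.core_subset hidx hneg hv hq
    have vq : v (n / m) = 1 := by rw [map_div₀, h, div_self vm0]
    have ve : v (1 - e) = 1 := v.map_one_sub_of_lt he
    have vt : v t = 1 := by
      rw [hq', map_mul, ve, one_mul, map_pow] at vq
      exact (pow_eq_one_iff_of_nonneg zero_le two_ne_zero).1 vq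
    have key : n / m - 1 ∈ realSet φ (S.core U) ∨ v (n / m - 1) < 1 := by
      have e1 : n / m - 1 = (t - 1) ^ 2 + 2 * (t - 1) - e * t ^ 2 := by rw [hq']; ring
      have vt1 : v (t - 1) ≤ 1 := by
        refine (v.map_sub _ _).trans ?_
        simp [vt]
      have vs : v (2 * (t - 1) - e * t ^ 2) < 1 := by
        refine v.map_sub_lt ?_ ?_
        · rw [map_mul]
          exact mul_lt_one_of_lt_of_le h2 vt1
        · rw [map_mul, map_pow, vt]; simpa using he
      rcases vt1.eq_or_lt with h4 | h4
      · left
        have ht1 : t - 1 ≠ 0 := by intro h0; rw [h0] at h4; simp at h4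
        have h5 : v (-((2 * (t - 1) - e * t ^ 2) / (t - 1) ^ 2)) < 1 := by
          rw [Valuation.map_neg, map_div₀, map_pow, h4, one_pow, div_one]; exact vs
        convert realSet_mul (hφ.sq_mem ht1) (hU _ h5) using 1
        rw [e1]
        field_simp
        ring
      · right
        rw [e1, add_sub_assoc]
        refine v.map_add_lt ?_ vs
        rw [map_pow]
        exact pow_lt_one₀ zero_le h4 two_ne_zero
    rcases key with h3 | h3
    · left
      convert realSet_mul hm h3 using 1
      field_simp
    · right
      have : n - m = (n / m - 1) * m := by field_simp
      rw [this, map_mul]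
      exact mul_lt_of_lt_one_left (zero_lt_iff.2 vm0) h3
  · left
    have h3 : v (m / n) < 1 := by rw [map_div₀]; exact (div_lt_one₀ (zero_lt_iff.2 vn0)).2 h
    convert realSet_mul hn (hU _ h3) using 1
    field_simp

/-- Subgroups of odd type have odd residue characteristic. -/
lemma two_unit_of_odd (hodd : U ∈ S.OddType)
    (hv : ∀ x, v x = 1 → x ∈ realSet φ U)
    (hU : ∀ x, v x < 1 → 1 - x ∈ realSet φ (S.core U)) : ¬ v 2 < 1 := by
  intro h2
  obtain ⟨hA, x, y, z, hy, hxy, hyz, hxz⟩ := hodd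
  obtain ⟨x, rfl⟩ := hφ.surj x
  obtain ⟨y, rfl⟩ := hφ.surj y
  obtain ⟨z, rfl⟩ := hφ.surj z
  rw [hφ.absorbs_iff] at hxy hyz
  apply hxz
  rw [hφ.absorbs_iff]
  obtain ⟨p₁, q₁, hp₁, hq₁, e₁⟩ := hxy
  obtain ⟨p₂, q₂, hp₂, hq₂, e₂⟩ := hyz
  rw [← coe_mem_realSet (φ := φ)] at hy
  have h1 : (-1 : F) ∈ realSet φ (S.core U) := by
    have := hU 2 h2
    convert this using 1
    norm_num
  have mul0 {a b : F} (ha : a = 0 ∨ a ∈ realSet φ (S.core U))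
      (hb : b = 0 ∨ b ∈ realSet φ (S.core U)) : a * b = 0 ∨ a * b ∈ realSet φ (S.core U) := by
    rcases ha with rfl | ha
    · simp
    rcases hb with rfl | hb
    · simp
    exact .inr (realSet_mul ha hb)
  have neg0 {a : F} (ha : a = 0 ∨ a ∈ realSet φ (S.core U)) :
      -a = 0 ∨ -a ∈ realSet φ (S.core U) := by
    have := mul0 (.inr h1) ha
    simpa using this
  have key : (p₂ - p₁ * q₂ = 0 ∨ p₂ - p₁ * q₂ ∈ realSet φ (S.core U)) ∨
      v (p₂ - p₁ * q₂) < v (p₁ * q₂) := by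
    rcases mul0 hp₁ hq₂ with h0 | hm
    · left; rw [h0, sub_zero]; exact hp₂
    rcases hp₂ with rfl | hn
    · left; rw [zero_sub]; exact neg0 (.inr hm)
    rcases hφ.sub_mem_core hA.index hA.neg hv hU h2 hn hm with h | h
    · exact .inl (.inr h)
    · exact .inr h
  rcases key with h | h
  · exact ⟨p₂ - p₁ * q₂, -(q₁ * q₂), h, neg0 (mul0 hq₁ hq₂), by rw [e₂, e₁]; ring⟩
  · have hp₁0 : p₁ ≠ 0 := by rintro rfl; simp at h
    have hq₂0 : q₂ ≠ 0 := by rintro rfl; simp at h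
    have hle : v p₁ ≤ v (x * q₁) := by
      by_contra hlt
      apply hy
      have : v (x * q₁ / p₁) < 1 := by
        rw [map_div₀]
        exact (div_lt_one₀ (zero_lt_iff.2 (by simpa using hp₁0))).2 (not_le.1 hlt)
      convert realSet_mul (hp₁.resolve_left hp₁0) (hU _ this) using 1
      rw [e₁]
      field_simp
    have hlt : v (p₂ - p₁ * q₂) < v (x * q₁ * q₂) := by
      refine h.trans_le ?_
      rw [map_mul, map_mul _ _ q₂]
      gcongr
    have hne : (x * q₁ * q₂ : F) ≠ 0 := by intro h0; rw [h0] at hlt; simp at hlt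
    have hq₁0 : q₁ ≠ 0 := by rintro rfl; simp at hne
    have h3 : v (-((p₂ - p₁ * q₂) / (x * q₁ * q₂))) < 1 := by
      rw [Valuation.map_neg, map_div₀]
      exact (div_lt_one₀ (zero_lt_iff.2 (by simpa using hne))).2 hlt
    refine ⟨0, -(q₁ * q₂ * (1 - -((p₂ - p₁ * q₂) / (x * q₁ * q₂)))), .inl rfl,
      neg0 (mul0 (mul0 hq₁ hq₂) (.inr (hU _ h3))), ?_⟩
    have hx := x.ne_zero
    rw [e₂, e₁]
    field_simp
    ring

/-- Core-representability of a unit by a non-square unit descends to the residue field. -/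
lemma residue_of_absorbs (hidx : U.index = 2) (hneg : S.neg ∈ U)
    (hv : ∀ x, v x = 1 → x ∈ realSet φ U) {x y : Fˣ} (hx : v x = 1) (hy : v y = 1)
    (hns : ∀ a, v a ≤ 1 → ¬ v (x - a ^ 2) < 1) (h : S.Absorbs U (φ x) (φ y)) :
    ∃ a b : F, v a ≤ 1 ∧ v b ≤ 1 ∧ v (y - (a ^ 2 - x * b ^ 2)) < 1 := by
  rw [hφ.absorbs_iff] at h
  obtain ⟨p, q, hp, hq, e⟩ := h
  have ex {p : F} (hp : p = 0 ∨ p ∈ realSet φ (S.core U)) :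
      ∃ m y : F, v m < 1 ∧ p = (1 - m) * y ^ 2 := by
    rcases hp with rfl | hp
    · exact ⟨0, 0, by simp, by simp⟩
    · obtain ⟨m, y, hm, -, h⟩ := hφ.core_subset hidx hneg hv hp
      exact ⟨m, y, hm, h⟩
  obtain ⟨m, s, hm, hp⟩ := ex hp
  obtain ⟨m', r, hm', hq⟩ := ex hq
  have vm : v (1 - m) = 1 := v.map_one_sub_of_lt hm
  have vm' : v (1 - m') = 1 := v.map_one_sub_of_lt hm'
  have vp : v p = v s ^ 2 := by rw [hp, map_mul, vm, one_mul, map_pow]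
  have vq : v (x * q) = v r ^ 2 := by rw [map_mul, hx, one_mul, hq, map_mul, vm', one_mul, map_pow]
  have hsr : v s = v r ∨ (v s ≤ 1 ∧ v r ≤ 1) := by
    rcases lt_trichotomy (v s) (v r) with h | h | h
    · right
      have h2 : v p < v (x * q) := by
        rw [vp, vq]; exact pow_lt_pow_left₀ h zero_le two_ne_zero
      have h3 : v y = v (x * q) := by rw [e]; exact v.map_sub_eq_of_lt_right h2
      rw [hy, vq] at h3
      have := (pow_eq_one_iff_of_nonneg zero_le two_ne_zero).1 h3.symm
      exact ⟨this ▸ h.le, this.le⟩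
    · exact .inl h
    · right
      have h2 : v (x * q) < v p := by
        rw [vp, vq]; exact pow_lt_pow_left₀ h zero_le two_ne_zero
      have h3 : v y = v p := by rw [e]; exact v.map_sub_eq_of_lt_left h2
      rw [hy, vp] at h3
      have := (pow_eq_one_iff_of_nonneg zero_le two_ne_zero).1 h3.symm
      exact ⟨this.le, this ▸ h.le⟩
  have hr : v s ≤ 1 ∧ v r ≤ 1 := by
    rcases hsr with h | h
    swap
    · exact h
    rw [h, and_self]
    by_contra hlt
    rw [not_le] at hlt
    have hr0 : r ≠ 0 := by rintro rfl; simp at hlt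
    apply hns (s / r)
    · rw [map_div₀, h, div_self (by simpa using hr0)]
    · have hsr1 : v (s / r) = 1 := by rw [map_div₀, h, div_self (by simpa using hr0)]
      have e2 : (x : F) - (s / r) ^ 2 = x * m' - (s / r) ^ 2 * m - y * r⁻¹ ^ 2 := by
        rw [e, hp, hq]; field_simp; ring
      rw [e2]
      refine v.map_sub_lt (v.map_sub_lt ?_ ?_) ?_
      · rwa [map_mul, hx, one_mul]
      · rwa [map_mul, map_pow, hsr1, one_pow, one_mul]
      · rw [map_mul, hy, one_mul, map_pow, map_inv₀]
        exact pow_lt_one₀ zero_le (inv_lt_one_of_one_lt₀ hlt) two_ne_zero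
  refine ⟨s, r, hr.1, hr.2, ?_⟩
  have e2 : (y : F) - (s ^ 2 - x * r ^ 2) = x * m' * r ^ 2 - m * s ^ 2 := by
    rw [e, hp, hq]; ring
  rw [e2]
  refine v.map_sub_lt ?_ ?_
  · rw [map_mul, map_mul, hx, one_mul, map_pow]
    exact mul_lt_one_of_lt_of_le hm' (pow_le_one₀ zero_le hr.2)
  · rw [map_mul, map_pow]
    exact mul_lt_one_of_lt_of_le hm (pow_le_one₀ zero_le hr.1)

/-- The residue field of an admissible subgroup contains a suitable non-exceptional element. -/
lemma residue_witness (hA : S.Admissible U)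
    (hU : ∀ x, v x < 1 → 1 - x ∈ realSet φ (S.core U)) :
    ∃ x : F, v x = 1 ∧ v (1 - x) = 1 ∧ ∀ a, v a ≤ 1 → ¬ v (x - a ^ 2) < 1 ∧
      ¬ v (-x - a ^ 2) < 1 ∧ ¬ v (1 - x - a ^ 2) < 1 ∧ ¬ v (-(x * (1 - x)) - a ^ 2) < 1 := by
  obtain ⟨x, hxU, h1, h2, h3, h4⟩ := hφ.exists_witness hA.wit
  have hx0 := realSet_ne hxU
  have vx : v x = 1 := by
    rcases lt_trichotomy (v x) 1 with h | h | h
    · exact absurd (hU _ h) h3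
    · exact h
    · exfalso
      apply h4
      have : v x⁻¹ < 1 := by rw [map_inv₀]; exact inv_lt_one_of_one_lt₀ h
      convert realSet_mul (hφ.sq_mem hx0) (hU _ this) using 1
      field_simp
      ring
  have vx1 : v (1 - x) = 1 := by
    have : v (1 - x) ≤ 1 := (v.map_sub _ _).trans (by simp [vx])
    refine this.eq_or_lt.resolve_right fun h => h1 ?_
    have := hU _ h
    simpa using this
  have key : ∀ y : F, y ∉ realSet φ (S.core U) → v y = 1 → ∀ a, ¬ v (y - a ^ 2) < 1 := by
    intro y hy vy a hlt
    apply hy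
    have ha : a ≠ 0 := by rintro rfl; simp [vy] at hlt
    have hva : v (a ^ 2) = 1 := by
      have := v.map_sub_eq_of_lt_left (x := y) (y := y - a ^ 2) (by rwa [vy])
      rw [sub_sub_cancel] at this
      rw [this, vy]
    have : v (-((y - a ^ 2) / a ^ 2)) < 1 := by rwa [Valuation.map_neg, map_div₀, hva, div_one]
    convert realSet_mul (hφ.sq_mem ha) (hU _ this) using 1
    field_simp
    ring
  refine ⟨x, vx, vx1, fun a _ => ⟨key _ h1 vx _, key _ h2 (by simpa using vx) _, key _ h3 vx1 _,
    key _ h4 (by simp [vx, vx1]) _⟩⟩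

end QuadData.Realizes

/-- A relation in two variables may be chosen not divisible by the first one. -/
lemma exists_relation_not_dvd {κ F : Type*} [Field κ] [Field F] [Algebra κ F] {s f : F}
    (hs : s ≠ 0) {Q : Polynomial (Polynomial κ)} (hQ : Q ≠ 0)
    (h : Q.eval₂ (Polynomial.aeval s).toRingHom f = 0) :
    ∃ Q' : Polynomial (Polynomial κ), Q'.map (Polynomial.evalRingHom 0) ≠ 0 ∧
      Q'.natDegree ≤ Q.natDegree ∧ Q'.eval₂ (Polynomial.aeval s).toRingHom f = 0 := by
  have hX : ¬ IsUnit (Polynomial.C Polynomial.X : Polynomial (Polynomial κ)) := by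
    rw [Polynomial.isUnit_C]
    exact Polynomial.not_isUnit_X
  obtain ⟨Q', hQ', hnd⟩ :=
    (FiniteMultiplicity.of_not_isUnit hX hQ).exists_eq_pow_mul_and_not_dvd
  set n := multiplicity (Polynomial.C Polynomial.X : Polynomial (Polynomial κ)) Q
  have hQ0 : Q' ≠ 0 := by rintro rfl; simp at hnd
  refine ⟨Q', ?_, ?_, ?_⟩
  · intro h0
    apply hnd
    rw [Polynomial.C_dvd_iff_dvd_coeff]
    intro i
    rw [Polynomial.X_dvd_iff, Polynomial.coeff_zero_eq_eval_zero]
    have := congrArg (fun p => Polynomial.coeff p i) h0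
    simpa using this
  · rw [hQ', Polynomial.natDegree_mul (pow_ne_zero _ (by simp)) hQ0]
    omega
  · rw [hQ', Polynomial.eval₂_mul, Polynomial.eval₂_pow, Polynomial.eval₂_C] at h
    simpa [hs] using h

/-- The value of `b(s)` under a valuation with `v s < 1` and trivial on constants. -/
lemma exists_val_aeval {κ F : Type*} [Field κ] [Field F] [Algebra κ F] {Γ : Type*}
    [LinearOrderedCommGroupWithZero Γ] (w : Valuation F Γ)
    (hκ : ∀ c : κ, c ≠ 0 → w (algebraMap κ F c) = 1) {s : F} (hs : w s < 1)
    {b : Polynomial κ} (hb : b ≠ 0) : ∃ n : ℕ, w (Polynomial.aeval s b) = w s ^ n := by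
  have hle : ∀ c : κ, w (algebraMap κ F c) ≤ 1 := by
    intro c
    by_cases hc : c = 0
    · simp [hc]
    · exact (hκ c hc).le
  have h_integral : ∀ p : Polynomial κ, w (Polynomial.aeval s p) ≤ 1 := by
    intro p
    rw [Polynomial.aeval_eq_sum_range]
    refine w.map_sum_le fun i _ => ?_
    rw [Algebra.smul_def, map_mul, map_pow]
    exact mul_le_one' (hle _) (pow_le_one' hs.le _)
  obtain ⟨p, hp, hnd⟩ :=
    (FiniteMultiplicity.of_not_isUnit (Polynomial.not_isUnit_X (R := κ)) hb).exists_eq_pow_mul_and_not_dvd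
  refine ⟨multiplicity Polynomial.X b, ?_⟩
  rw [Polynomial.X_dvd_iff] at hnd
  conv_lhs => rw [hp]
  rw [map_mul, map_mul, map_pow, map_pow, Polynomial.aeval_X]
  convert mul_one _
  rw [← Polynomial.X_mul_divX_add p, map_add, map_mul, Polynomial.aeval_X, Polynomial.aeval_C,
    w.map_add_eq_of_lt_right, hκ _ hnd]
  rw [hκ _ hnd, map_mul]
  exact mul_lt_one_of_lt_of_le hs (h_integral _)

/-- A finite sum of terms with distinct nonzero values does not vanish. -/
lemma sum_ne_zero_of_injOn {F ι : Type*} [Field F] {Γ : Type*}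
    [LinearOrderedCommGroupWithZero Γ] (w : Valuation F Γ) (I : Finset ι) (hI : I.Nonempty)
    (f : ι → F) (hf : ∀ i ∈ I, f i ≠ 0) (hinj : Set.InjOn (fun i => w (f i)) I) :
    ∑ i ∈ I, f i ≠ 0 := by
  classical
  obtain ⟨j, hj, hmax⟩ := I.exists_max_image (fun i => w (f i)) hI
  intro h0
  rw [← Finset.add_sum_erase _ _ hj] at h0
  have : w (∑ i ∈ I.erase j, f i) < w (f j) := by
    refine w.map_sum_lt (by simpa using hf j hj) fun i hi => ?_
    refine lt_of_le_of_ne (hmax i (Finset.mem_of_mem_erase hi)) fun h => ?_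
    exact Finset.ne_of_mem_erase hi (hinj (Finset.mem_of_mem_erase hi) hj h)
  have h1 := w.map_add_eq_of_lt_left this
  rw [h0] at h1
  exact hf j hj (by simpa using h1.symm)

/-- A field which is of degree at most `m` over `κ(s)`, with `κ` finite of odd characteristic,
carries a binary form `⟨1, -x⟩` that is neither isotropic nor universal. -/
theorem exists_not_universal {κ F : Type*} [Field κ] [Finite κ] [Field F] [Algebra κ F] (s : F)
    (hs : Transcendental κ s) (h2 : (2 : κ) ≠ 0) (m : ℕ)
    (h : ∀ f : F, ∃ Q : Polynomial (Polynomial κ), Q ≠ 0 ∧ Q.natDegree ≤ m ∧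
      Q.eval₂ (Polynomial.aeval s).toRingHom f = 0) :
    ∃ x y : F, ¬ IsSquare x ∧ ∀ a b : F, y ≠ a ^ 2 - x * b ^ 2 := by
  classical
  have hs0 : s ≠ 0 := by
    rintro rfl
    exact hs (isAlgebraic_zero)
  -- a valuation ring of `F` containing `κ[s]` in which `s` is not invertible
  let A : Subring F := (Polynomial.aeval (R := κ) s).toRingHom.range
  have hsA : s ∈ A := ⟨Polynomial.X, by simp⟩
  let I : Ideal A := Ideal.span {⟨s, hsA⟩}
  have hI : I ≠ ⊤ := by
    intro hI
    rw [Ideal.eq_top_iff_one, Ideal.mem_span_singleton] at hI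
    obtain ⟨⟨_, p, rfl⟩, hp⟩ := hI
    have hp' : (1 : F) = s * Polynomial.aeval s p := congrArg Subtype.val hp
    apply hs
    refine ⟨1 - Polynomial.X * p, ?_, by simp [← hp']⟩
    intro h0
    have := congrArg (Polynomial.eval 0) h0
    simp at this
  obtain ⟨W, hAW, hIW⟩ := Ideal.image_subset_nonunits_valuationSubring I hI
  have hsW : W.valuation s < 1 := by
    rw [← ValuationSubring.mem_nonunits_iff]
    exact hIW ⟨⟨s, hsA⟩, Ideal.subset_span rfl, rfl⟩
  set w := W.valuation with hw
  have hle : ∀ c : κ, w (algebraMap κ F c) ≤ 1 := fun c => by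
    rw [hw, ValuationSubring.valuation_le_one_iff]
    exact hAW ⟨Polynomial.C c, by simp⟩
  have hκ : ∀ c : κ, c ≠ 0 → w (algebraMap κ F c) = 1 := by
    intro c hc
    refine le_antisymm (hle c) ?_
    have := hle c⁻¹
    rw [map_inv₀, map_inv₀] at this
    have h0 : 0 < w (algebraMap κ F c) := zero_lt_iff.2 (by simpa using hc)
    exact (inv_le_one₀ h0).1 this
  have hcW : ∀ c : κ, algebraMap κ F c ∈ W := fun c => by
    rw [← ValuationSubring.valuation_le_one_iff]; exact hle c
  have hsW' : s ∈ W := by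
    rw [← ValuationSubring.valuation_le_one_iff]; exact hsW.le
  let i : κ →+* W := (algebraMap κ F).codRestrict W.toSubring hcW
  let sW : W := ⟨s, hsW'⟩
  let r := IsLocalRing.residue W
  have hrs : r sW = 0 := by
    rw [IsLocalRing.residue_eq_zero_iff, ValuationSubring.valuation_lt_one_iff]
    exact hsW
  have r0 : ∀ z : W, r z = 0 ↔ w z < 1 := fun z => by
    rw [IsLocalRing.residue_eq_zero_iff, ValuationSubring.valuation_lt_one_iff]
  -- the residue field is finite
  have hres : ∀ z : IsLocalRing.ResidueField W, ∃ q : Polynomial κ, q ≠ 0 ∧ q.natDegree ≤ m ∧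
      q.eval₂ (r.comp i) z = 0 := by
    intro z
    obtain ⟨f, rfl⟩ := IsLocalRing.residue_surjective z
    obtain ⟨Q, hQ, hd, hQf⟩ := h f
    obtain ⟨Q', h1, h2, h3⟩ := exists_relation_not_dvd hs0 hQ hQf
    refine ⟨_, h1, Polynomial.natDegree_map_le.trans (h2.trans hd), ?_⟩
    have h4 : Q'.eval₂ (Polynomial.eval₂RingHom i sW) f = 0 := by
      apply Subtype.val_injective
      have e : (Polynomial.aeval s).toRingHom =
          W.subtype.comp (Polynomial.eval₂RingHom i sW) := by
        ext <;> simp [i, sW]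
      rw [e] at h3
      have := Polynomial.hom_eval₂ Q' (Polynomial.eval₂RingHom i sW) W.subtype f
      exact this.trans h3
    have h5 := congrArg r h4
    rw [Polynomial.hom_eval₂, map_zero] at h5
    rw [Polynomial.eval₂_map]
    have e : (r.comp i).comp (Polynomial.evalRingHom 0) =
        r.comp (Polynomial.eval₂RingHom i sW) := by
      ext <;> simp [hrs]
    rw [e]
    exact h5
  have : Finite (IsLocalRing.ResidueField W) := by
    have hfin : {q : Polynomial κ | q.natDegree ≤ m}.Finite := by
      have : Finite (Polynomial.degreeLT κ (m + 1)) :=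
        Finite.of_equiv _ (Polynomial.degreeLTEquiv κ (m + 1)).symm.toEquiv
      refine (Set.toFinite (Polynomial.degreeLT κ (m + 1) : Set (Polynomial κ))).subset ?_
      intro q hq
      rw [SetLike.mem_coe, Polynomial.mem_degreeLT]
      exact lt_of_le_of_lt Polynomial.degree_le_natDegree
        (by exact_mod_cast Nat.lt_succ_of_le hq)
    have : (⋃ q ∈ {q : Polynomial κ | q.natDegree ≤ m},
        ((q.map (r.comp i)).roots.toFinset : Set (IsLocalRing.ResidueField W))).Finite :=
      hfin.biUnion fun _ _ => Finset.finite_toSet _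
    rw [← Set.finite_univ_iff]
    refine this.subset fun z _ => ?_
    obtain ⟨q, h1, h2, h3⟩ := hres z
    simp only [Set.mem_iUnion]
    refine ⟨q, h2, ?_⟩
    rw [Finset.mem_coe, Multiset.mem_toFinset, Polynomial.mem_roots', Polynomial.IsRoot,
      Polynomial.eval_map]
    exact ⟨by rwa [Polynomial.map_ne_zero_iff (RingHom.injective _)], h3⟩
  obtain ⟨xb, hxb⟩ := FiniteField.exists_nonsquare (F := IsLocalRing.ResidueField W) (by
    intro hc
    have h3 : ((2 : ℕ) : IsLocalRing.ResidueField W) = 0 := by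
      rw [ringChar.spec, hc]
    have h4 : (r.comp i) 2 = 0 := by rw [map_ofNat]; exact_mod_cast h3
    exact h2 ((map_eq_zero _).1 h4))
  obtain ⟨x, rfl⟩ := IsLocalRing.residue_surjective xb
  have hxns : ∀ a : F, w a ≤ 1 → w (a ^ 2 - x) = 1 := by
    intro a ha
    have haW : a ∈ W := by rwa [← ValuationSubring.valuation_le_one_iff]
    refine (W.valuation_le_one ((⟨a, haW⟩ : W) ^ 2 - x)).eq_or_lt.resolve_right fun hlt => ?_
    rw [← hw, ← r0] at hlt
    apply hxb
    refine ⟨r ⟨a, haW⟩, ?_⟩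
    rw [map_sub, map_pow, sub_eq_zero] at hlt
    rw [← pow_two, hlt]
  have hx1 : w x = 1 := by
    have := hxns 0 (by simp)
    simpa using this
  -- an element whose value is not a square
  obtain ⟨y, hy⟩ : ∃ y : F, ∀ z : F, w y ≠ w z ^ 2 := by
    by_contra! hcon
    have key : ∀ j : ℕ, ∃ y : F, w s = w y ^ (2 ^ j) := by
      intro j
      induction j with
      | zero => exact ⟨s, by simp⟩
      | succ j ih =>
        obtain ⟨y, hy⟩ := ih
        obtain ⟨z, hz⟩ := hcon y
        exact ⟨z, by rw [hy, hz, ← pow_mul, pow_succ']⟩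
    obtain ⟨y, hy⟩ := key m
    have hm : m < 2 ^ m := Nat.lt_two_pow_self
    obtain ⟨Q, hQ, hd, hQf⟩ := h y
    have hwy : w y < 1 := by
      by_contra hc
      rw [hy] at hsW
      exact absurd hsW (not_lt.2 (one_le_pow₀ (not_lt.1 hc)))
    have hy0 : y ≠ 0 := by
      rintro rfl
      rw [map_zero, zero_pow (by positivity)] at hy
      exact hs0 (by simpa using hy)
    have hwy0 : 0 < w y := zero_lt_iff.2 (by simpa using hy0)
    rw [Polynomial.eval₂_eq_sum, Polynomial.sum] at hQf
    have hex : ∀ i ∈ Q.support, ∃ n : ℕ,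
        w ((Polynomial.aeval s).toRingHom (Q.coeff i) * y ^ i) = w y ^ (2 ^ m * n + i) := by
      intro i hi
      obtain ⟨n, hn⟩ := exists_val_aeval w hκ hsW (Polynomial.mem_support_iff.1 hi)
      refine ⟨n, ?_⟩
      rw [map_mul, map_pow, pow_add, pow_mul, ← hy, ← hn]
      rfl
    have hinj : Function.Injective (fun n : ℕ => w y ^ n) :=
      (pow_right_strictAnti₀ hwy0 hwy).injective
    refine sum_ne_zero_of_injOn w Q.support (Polynomial.support_nonempty.2 hQ) _ ?_ ?_ hQf
    · intro i hi h0
      obtain ⟨n, hn⟩ := hex i hi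
      rw [h0, map_zero] at hn
      exact (pow_ne_zero _ hwy0.ne') hn.symm
    · intro i hi j hj hij
      obtain ⟨n, hn⟩ := hex i hi
      obtain ⟨n', hn'⟩ := hex j hj
      simp only at hij
      rw [hn, hn'] at hij
      have h1 := hinj hij
      have hi' : i < 2 ^ m := ((Polynomial.le_natDegree_of_mem_supp i hi).trans hd).trans_lt hm
      have hj' : j < 2 ^ m := ((Polynomial.le_natDegree_of_mem_supp j hj).trans hd).trans_lt hm
      have h2 := congrArg (· % 2 ^ m) h1
      simpa [Nat.mul_add_mod, Nat.mod_eq_of_lt hi', Nat.mod_eq_of_lt hj'] using h2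
  refine ⟨x, y, ?_, ?_⟩
  · rintro ⟨a, ha⟩
    have hwa : w a ≤ 1 := by
      rw [ha, map_mul, ← pow_two] at hx1
      exact ((pow_eq_one_iff_of_nonneg zero_le two_ne_zero).1 hx1).le
    have := hxns a hwa
    rw [ha, pow_two, sub_self, map_zero] at this
    exact zero_ne_one this
  · intro a b hab
    rcases lt_trichotomy (w a) (w b) with hlt | heq | hlt
    · apply hy b
      rw [hab, w.map_sub_eq_of_lt_right]
      · rw [map_mul, hx1, one_mul, map_pow]
      · rw [map_mul, hx1, one_mul, map_pow, map_pow]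
        exact pow_lt_pow_left₀ hlt zero_le two_ne_zero
    · by_cases hb : b = 0
      · subst hb
        have ha : a = 0 := by simpa using heq
        exact hy 0 (by rw [hab, ha]; simp)
      · apply hy b
        have hab' : w (a / b) = 1 := by rw [map_div₀, heq, div_self (by simpa using hb)]
        have e : y = ((a / b) ^ 2 - x) * b ^ 2 := by rw [hab]; field_simp
        rw [e, map_mul, hxns _ hab'.le, one_mul, map_pow]
    · apply hy a
      rw [hab, w.map_sub_eq_of_lt_left, map_pow]
      rw [map_mul, hx1, one_mul, map_pow, map_pow]
      exact pow_lt_pow_left₀ hlt zero_le two_ne_zero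

section NumberFieldValuation

open IsDedekindDomain

variable {k : Type*} [Field k] {Γ : Type*} [LinearOrderedCommGroupWithZero Γ]

/-- Valuations of a number field are integral on the ring of integers. -/
lemma val_integer_le_one (v : Valuation k Γ) (a : NumberField.RingOfIntegers k) :
    v (a : k) ≤ 1 := by
  have h1 : IsIntegral ℤ (a : k) := a.isIntegral_coe
  have h2 : IsIntegral v.integer (a : k) := h1.tower_top
  exact (Valuation.integer.integers v).mem_of_integral h2

variable [NumberField k]

/-- A nontrivial valuation of a number field is equivalent to a prime one. -/
lemma exists_prime_isEquiv (v : Valuation k Γ) (hv : ∃ c, c ≠ 0 ∧ v c ≠ 1) :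
    ∃ q : HeightOneSpectrum (NumberField.RingOfIntegers k), v.IsEquiv (q.valuation k) := by
  let I : Ideal (NumberField.RingOfIntegers k) :=
    { carrier := {a | v (a : k) < 1}
      add_mem' := fun {a b} ha hb => by
        simp only [Set.mem_ofPred_eq, map_add]
        exact v.map_add_lt ha hb
      zero_mem' := by simp
      smul_mem' := fun c a ha => by
        simp only [Set.mem_ofPred_eq, smul_eq_mul, map_mul]
        rw [mul_comm]
        exact mul_lt_one_of_lt_of_le ha (val_integer_le_one v c) }
  have hI : ∀ a, a ∈ I ↔ v (a : k) < 1 := fun a => Iff.rfl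
  have hp : I.IsPrime := by
    refine ⟨fun h => ?_, fun {a b} hab => ?_⟩
    · rw [Ideal.eq_top_iff_one, hI] at h
      simp at h
    · by_contra! hc
      rw [hI, hI, not_lt, not_lt] at hc
      have e : ((a * b : NumberField.RingOfIntegers k) : k) = a * b := rfl
      rw [hI, e, map_mul] at hab
      have h1 : v (a : k) = 1 := le_antisymm (val_integer_le_one v a) hc.1
      have h2 : v (b : k) = 1 := le_antisymm (val_integer_le_one v b) hc.2
      rw [h1, h2] at hab
      simp at hab
  have hb : I ≠ ⊥ := by
    intro hbot
    have h1 : ∀ a : NumberField.RingOfIntegers k, a ≠ 0 → v (a : k) = 1 := by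
      intro a ha
      refine (val_integer_le_one v a).eq_or_lt.resolve_right fun hlt => ha ?_
      rw [← hI, hbot] at hlt
      simpa using hlt
    obtain ⟨c, hc0, hc⟩ := hv
    obtain ⟨a, b, hb, rfl⟩ := IsFractionRing.div_surjective (A := NumberField.RingOfIntegers k) c
    apply hc
    have ha0 : a ≠ 0 := by rintro rfl; simp at hc0
    rw [map_div₀, h1 a ha0, h1 b (nonZeroDivisors.ne_zero hb), div_one]
  let q : HeightOneSpectrum (NumberField.RingOfIntegers k) := ⟨I, hp, hb⟩
  refine ⟨q, ?_⟩
  have hq : ∀ a : NumberField.RingOfIntegers k, q.valuation k (a : k) < 1 ↔ v (a : k) < 1 :=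
    fun a => (q.valuation_lt_one_iff_mem a).trans (hI a)
  have hd : ∀ d : q.asIdeal.primeCompl, v ((d : NumberField.RingOfIntegers k) : k) = 1 ∧
      q.valuation k ((d : NumberField.RingOfIntegers k) : k) = 1 := by
    intro d
    have : ¬ v ((d : NumberField.RingOfIntegers k) : k) < 1 := d.2
    exact ⟨le_antisymm (val_integer_le_one v d) (not_lt.1 this),
      le_antisymm (val_integer_le_one (q.valuation k) (d : NumberField.RingOfIntegers k)) (not_lt.1 (mt (hq d).1 this))⟩
  have h1 : ∀ x, q.valuation k x ≤ 1 → v x ≤ 1 ∧ (q.valuation k x < 1 → v x < 1) := by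
    intro x hx
    obtain ⟨n, d, hnd⟩ := q.exists_primeCompl_mul_eq_of_integer x hx
    have h2 := congrArg v hnd
    have h3 := congrArg (q.valuation k) hnd
    rw [map_mul] at h2 h3
    erw [(hd d).1, mul_one] at h2
    erw [(hd d).2, mul_one] at h3
    rw [h2, h3]
    exact ⟨val_integer_le_one v n, (hq n).1⟩
  rw [Valuation.isEquiv_iff_val_le_one]
  intro x
  refine ⟨fun hx => ?_, fun hx => (h1 x hx).1⟩
  by_contra hlt
  rw [not_le] at hlt
  have h2 : q.valuation k x⁻¹ < 1 := by rw [map_inv₀]; exact inv_lt_one_of_one_lt₀ hlt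
  have h3 := (h1 _ h2.le).2 h2
  have hx0 : x ≠ 0 := by rintro rfl; simp at hlt
  rw [map_inv₀, inv_lt_one₀ (zero_lt_iff.2 (by simpa using hx0))] at h3
  exact absurd hx (not_le.2 h3)

/-- Each prime has a residue characteristic. -/
lemma exists_rat_prime (v : Valuation k Γ) (hv : ∃ c, c ≠ 0 ∧ v c ≠ 1) :
    ∃ p : ℕ, p.Prime ∧ v (p : k) < 1 := by
  obtain ⟨q, hq⟩ := exists_prime_isEquiv v hv
  have h1 : v ((Ideal.absNorm q.asIdeal : ℕ) : k) < 1 := by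
    rw [hq.lt_one_iff_lt_one]
    have := (q.valuation_lt_one_iff_mem (K := k) _).2 (Ideal.absNorm_mem q.asIdeal)
    simpa using this
  have h0 : Ideal.absNorm q.asIdeal ≠ 0 := by
    rw [Ideal.absNorm_ne_zero_iff]
    exact Ideal.finiteQuotientOfFreeOfNeBot _ q.ne_bot
  by_contra! hc
  have hle : ∀ n : ℕ, v (n : k) ≤ 1 := fun n => by
    have := val_integer_le_one v (n : NumberField.RingOfIntegers k)
    simpa using this
  have : ∀ n : ℕ, n ≠ 0 → 1 ≤ v (n : k) := by
    intro n
    induction n using Nat.recOnMul with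
    | zero => simp
    | one => simp
    | prime p hp => exact fun _ => hc p hp
    | mul a b iha ihb =>
      intro hab
      rw [Nat.cast_mul, map_mul]
      exact one_le_mul_of_one_le_of_one_le (iha (left_ne_zero_of_mul hab))
        (ihb (right_ne_zero_of_mul hab))
  exact absurd h1 (not_lt.2 (this _ h0))

/-- Powers of an element of positive value are cofinal. -/
lemma exists_pow_lt_val (v : Valuation k Γ) {p : k} (hp0 : p ≠ 0) (hp : v p < 1) {c : k}
    (hc : c ≠ 0) : ∃ M : ℕ, v p ^ M < v c := by
  obtain ⟨q, hq⟩ := exists_prime_isEquiv v ⟨p, hp0, hp.ne⟩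
  have h1 : q.valuation k p < 1 := hq.lt_one_iff_lt_one.1 hp
  obtain ⟨M, hM⟩ := exists_pow_lt₀ h1 (Units.mk0 (q.valuation k c) (by simpa using hc))
  refine ⟨M, ?_⟩
  rw [← map_pow, hq.lt_iff_lt, map_pow]
  exact hM

end NumberFieldValuation

section Relations

open IntermediateField

/-- Elements of a finite extension of `k(s)` satisfy a polynomial relation of bounded degree
over `k[s]`. -/
lemma exists_relation {k K : Type*} [Field k] [Field K] [Algebra k K] (s : K)
    [FiniteDimensional k⟮s⟯ K] (f : K) :
    ∃ P : Polynomial (Polynomial k), P ≠ 0 ∧ P.natDegree ≤ Module.finrank k⟮s⟯ K ∧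
      P.eval₂ (Polynomial.aeval s).toRingHom f = 0 := by
  classical
  set q := minpoly k⟮s⟯ f
  have hq0 : q ≠ 0 := minpoly.ne_zero (Algebra.IsIntegral.isIntegral f)
  have hc : ∀ i, ∃ r t : Polynomial k, Polynomial.aeval s t ≠ 0 ∧
      ((q.coeff i : k⟮s⟯) : K) * Polynomial.aeval s t = Polynomial.aeval s r := by
    intro i
    obtain ⟨r, t, h⟩ := (mem_adjoin_simple_iff k _).1 (q.coeff i).2
    by_cases ht : Polynomial.aeval s t = 0
    · refine ⟨0, 1, by simp, ?_⟩
      rw [h, ht]; simp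
    · exact ⟨r, t, ht, by rw [h, div_mul_cancel₀ _ ht]⟩
  choose r t ht hrt using hc
  let I := Finset.range (q.natDegree + 1)
  let P : Polynomial (Polynomial k) :=
    ∑ i ∈ I, Polynomial.monomial i (r i * ∏ j ∈ I.erase i, t j)
  have hval : ∀ i ∈ I, Polynomial.aeval s (r i * ∏ j ∈ I.erase i, t j) =
      (q.coeff i : K) * ∏ j ∈ I, Polynomial.aeval s (t j) := by
    intro i hi
    rw [map_mul, ← hrt, map_prod, mul_assoc, Finset.mul_prod_erase I
      (fun j => Polynomial.aeval s (t j)) hi]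
  refine ⟨P, fun h0 => ?_, ?_, ?_⟩
  · have h1 : P.coeff q.natDegree = r q.natDegree * ∏ j ∈ I.erase q.natDegree, t j := by
      simp only [P, Polynomial.finsetSum_coeff, Polynomial.coeff_monomial]
      rw [Finset.sum_ite_eq' I, if_pos (by simp [I])]
    have h2 := hval q.natDegree (by simp [I])
    rw [← h1, h0, Polynomial.coeff_zero, map_zero, eq_comm, mul_eq_zero, Finset.prod_eq_zero_iff]
      at h2
    rcases h2 with h2 | ⟨j, -, h2⟩
    · rw [Polynomial.coeff_natDegree] at h2
      exact hq0 (Polynomial.leadingCoeff_eq_zero.1 (by exact_mod_cast h2))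
    · exact ht j h2
  · refine (Polynomial.natDegree_sum_le_of_forall_le (n := q.natDegree) I _ fun i hi => ?_).trans
      (minpoly.natDegree_le f)
    refine (Polynomial.natDegree_monomial_le _).trans ?_
    simpa [I, Nat.lt_succ_iff] using hi
  · have h1 : Polynomial.aeval f q = 0 := minpoly.aeval _ _
    rw [Polynomial.aeval_eq_sum_range] at h1
    simp only [P, Polynomial.eval₂_finsetSum, Polynomial.eval₂_monomial]
    have : ∀ i ∈ I, (Polynomial.aeval s).toRingHom (r i * ∏ j ∈ I.erase i, t j) * f ^ i =
        (q.coeff i • f ^ i) * ∏ j ∈ I, Polynomial.aeval s (t j) := by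
      intro i hi
      have h2 := hval i hi
      change Polynomial.aeval s (r i * ∏ j ∈ I.erase i, t j) * f ^ i = _
      rw [h2, Algebra.smul_def]
      change _ = ((q.coeff i : K) * f ^ i) * _
      ring
    rw [Finset.sum_congr rfl this, ← Finset.sum_mul, h1, zero_mul]

lemma finiteDimensional_adjoin_ratFunc {k : Type*} [Field k] (s : RatFunc k)
    (hs : ¬ ∃ c, s = RatFunc.C c) : FiniteDimensional k⟮s⟯ (RatFunc k) := by
  have h1 : FiniteDimensional k⟮s⟯ k⟮s⟯⟮(RatFunc.X : RatFunc k)⟯ :=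
    IntermediateField.adjoin.finiteDimensional
      (isAlgebraic_iff_isIntegral.1 (RatFunc.isAlgebraic_adjoin_simple_X s hs))
  exact (RatFunc.IntermediateField.adjoinXEquiv k⟮s⟯).toLinearEquiv.finiteDimensional

end Relations

section ResidueExtension

open IsLocalRing

variable {k K : Type*} [Field k] [Field K] (ι : k →+* K) (O : ValuationSubring K)

/-- The ring homomorphism between the valuation rings induced by a field embedding. -/
def comapHom : O.comap ι →+* O :=
  (ι.comp (O.comap ι).subtype).codRestrict O.toSubring fun x => x.2

@[simp] lemma coe_comapHom (x : O.comap ι) : (comapHom ι O x : K) = ι x := rfl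

instance : IsLocalHom (comapHom ι O) where
  map_nonunit x hx := by
    obtain ⟨⟨u, w, h1, h2⟩, hu⟩ := hx
    change u = _ at hu
    have e : ι x * (w : K) = 1 := by
      rw [← coe_comapHom, ← hu]
      exact congrArg Subtype.val h1
    have hx0 : (x : k) ≠ 0 := by
      intro h0
      rw [h0] at e
      simp at e
    refine IsUnit.of_mul_eq_one ⟨(x : k)⁻¹, ?_⟩ ?_
    · change ι (x : k)⁻¹ ∈ O
      rw [map_inv₀, ← eq_inv_of_mul_eq_one_right e]
      exact w.2
    · apply Subtype.ext
      exact mul_inv_cancel₀ hx0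

/-- The embedding of residue fields. -/
def comapResidue : ResidueField (O.comap ι) →+* ResidueField O :=
  ResidueField.map (comapHom ι O)

lemma comapResidue_residue (x : O.comap ι) :
    comapResidue ι O (residue _ x) = residue _ (comapHom ι O x) := rfl

lemma residue_eq_zero_iff_val (x : O) : residue O x = 0 ↔ O.valuation x < 1 := by
  rw [residue_eq_zero_iff, ValuationSubring.valuation_lt_one_iff]

lemma residue_ne_zero_iff_val (x : O) : residue O x ≠ 0 ↔ O.valuation x = 1 := by
  rw [Ne, residue_eq_zero_iff_val, not_lt]
  exact ⟨fun h => le_antisymm (O.valuation_le_one x) h, fun h => h.ge⟩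

variable {ι O}

/-- Normalising a polynomial to be integral with nonzero reduction. -/
lemma exists_primitive_lift {A : ValuationSubring k} {ι' : Type*} (I : Finset ι') (c : ι' → k)
    (hc : ∃ i ∈ I, c i ≠ 0) : ∃ d : k, d ≠ 0 ∧ (∀ i ∈ I, d * c i ∈ A) ∧
      (∃ i ∈ I, A.valuation (d * c i) = 1) := by
  classical
  obtain ⟨i, hi, hi0⟩ := hc
  obtain ⟨j, hj, hmax⟩ := I.exists_max_image (fun i => A.valuation (c i)) ⟨i, hi⟩
  have hj0 : c j ≠ 0 := by
    intro h0
    have := hmax i hi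
    rw [h0, map_zero, le_zero_iff, Valuation.zero_iff] at this
    exact hi0 this
  refine ⟨(c j)⁻¹, inv_ne_zero hj0, fun i hi => ?_, j, hj, by rw [inv_mul_cancel₀ hj0, map_one]⟩
  rw [← A.valuation_le_one_iff, map_mul, map_inv₀, inv_mul_le_one₀ (by
    rw [zero_lt_iff]; simpa using hj0)]
  exact hmax i hi

/-- If the residue of `s` is transcendental, the value of `f(s)` is the Gauss value of `f`. -/
lemma exists_gauss_value {s : O}
    (hs : ∀ p : Polynomial (ResidueField (O.comap ι)), p ≠ 0 →
      p.eval₂ (comapResidue ι O) (residue O s) ≠ 0) (f : Polynomial k) (hf : f ≠ 0) :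
    ∃ c : k, c ≠ 0 ∧ O.valuation (f.eval₂ ι s) = O.valuation (ι c) ∧
      ∀ i, O.valuation (ι (f.coeff i)) ≤ O.valuation (ι c) := by
  set A := O.comap ι
  obtain ⟨d, hd0, hd, j, hj, hdj⟩ := exists_primitive_lift (A := A) f.support f.coeff (by
    obtain ⟨i, hi⟩ := Polynomial.support_nonempty.2 hf
    exact ⟨i, hi, Polynomial.mem_support_iff.1 hi⟩)
  have hd' : ∀ i, d * f.coeff i ∈ A := by
    intro i
    by_cases hi : i ∈ f.support
    · exact hd i hi
    · rw [Polynomial.notMem_support_iff.1 hi, mul_zero]; exact A.zero_mem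
  obtain ⟨g, hg⟩ := (Polynomial.mem_lifts _).1
    ((Polynomial.lifts_iff_coeff_lifts (f := A.subtype) (Polynomial.C d * f)).2 fun i =>
      ⟨⟨_, hd' i⟩, by simp⟩)
  have hg0 : g.map (residue A) ≠ 0 := by
    intro h0
    have h1 := congrArg (fun p => Polynomial.coeff p j) h0
    simp only [Polynomial.coeff_map, Polynomial.coeff_zero] at h1
    rw [residue_eq_zero_iff_val] at h1
    have h2 := congrArg (fun p => Polynomial.coeff p j) hg
    simp only [Polynomial.coeff_map, Polynomial.coeff_C_mul] at h2
    change (g.coeff j : k) = _ at h2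
    rw [h2, hdj] at h1
    exact lt_irrefl _ h1
  have h3 := hs _ hg0
  rw [Polynomial.eval₂_map] at h3
  have e1 : (comapResidue ι O).comp (residue A) = (residue O).comp (comapHom ι O) := rfl
  rw [e1, ← Polynomial.hom_eval₂, residue_ne_zero_iff_val] at h3
  have e2 : ((g.eval₂ (comapHom ι O) s : O) : K) = ι d * f.eval₂ ι s := by
    change O.subtype _ = _
    rw [Polynomial.hom_eval₂]
    have : O.subtype.comp (comapHom ι O) = ι.comp A.subtype := rfl
    rw [this, ← Polynomial.eval₂_map, hg, Polynomial.eval₂_mul, Polynomial.eval₂_C]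
    rfl
  rw [e2, map_mul] at h3
  have vd0 : O.valuation (ι d) ≠ 0 := by simpa using hd0
  refine ⟨d⁻¹, inv_ne_zero hd0, ?_, fun i => ?_⟩
  · rw [map_inv₀, map_inv₀]
    exact eq_inv_of_mul_eq_one_right h3
  · rw [map_inv₀, map_inv₀]
    have := hd' i
    change ι (d * f.coeff i) ∈ O at this
    rw [← O.valuation_le_one_iff, map_mul, map_mul] at this
    rw [← mul_one (O.valuation (ι d))⁻¹]
    exact (le_inv_mul_iff₀ (zero_lt_iff.2 vd0)).2 this

/-- Reduction of polynomial relations. -/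
lemma exists_residue_relation {s : O} {f : O} {m : ℕ} {P : Polynomial (Polynomial k)}
    (hP : P ≠ 0) (hm : P.natDegree ≤ m)
    (h : P.eval₂ (Polynomial.eval₂RingHom ι (s : K)) f = 0) :
    ∃ Q : Polynomial (Polynomial (ResidueField (O.comap ι))), Q ≠ 0 ∧ Q.natDegree ≤ m ∧
      Q.eval₂ (Polynomial.eval₂RingHom (comapResidue ι O) (residue O s)) (residue O f) = 0 := by
  classical
  set A := O.comap ι
  let I : Finset (ℕ × ℕ) := P.support.biUnion fun i => (P.coeff i).support.image fun j => (i, j)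
  have hI : ∀ i j, (i, j) ∉ I → (P.coeff i).coeff j = 0 := by
    intro i j hij
    by_contra h0
    apply hij
    simp only [I, Finset.mem_biUnion, Finset.mem_image]
    refine ⟨i, ?_, j, Polynomial.mem_support_iff.2 h0, rfl⟩
    rw [Polynomial.mem_support_iff]
    rintro h1
    simp [h1] at h0
  obtain ⟨d, hd0, hd, ⟨a, b⟩, hab, hdab⟩ := exists_primitive_lift (A := A) I
    (fun x => (P.coeff x.1).coeff x.2) (by
      by_contra! hc
      apply hP
      ext i j
      by_cases hij : (i, j) ∈ I
      · simpa using hc _ hij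
      · simpa using hI i j hij)
  have hd' : ∀ i j, d * (P.coeff i).coeff j ∈ A := by
    intro i j
    by_cases hij : (i, j) ∈ I
    · exact hd _ hij
    · rw [hI i j hij, mul_zero]; exact A.zero_mem
  obtain ⟨g, hg⟩ := (Polynomial.mem_lifts _).1
    ((Polynomial.lifts_iff_coeff_lifts (f := Polynomial.mapRingHom A.subtype)
      (Polynomial.C (Polynomial.C d) * P)).2 fun i => (Polynomial.mem_lifts _).1
      ((Polynomial.lifts_iff_coeff_lifts _).2 fun j => ⟨⟨_, hd' i j⟩, by simp⟩))
  have hinj : Function.Injective (Polynomial.mapRingHom A.subtype) :=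
    Polynomial.map_injective _ A.subtype_injective
  refine ⟨g.map (Polynomial.mapRingHom (residue A)), fun h0 => ?_, ?_, ?_⟩
  · have h1 := congrArg (fun p => (Polynomial.coeff p a).coeff b) h0
    simp only [Polynomial.coeff_map, Polynomial.coeff_zero, Polynomial.coe_mapRingHom] at h1
    rw [residue_eq_zero_iff_val] at h1
    have h2 := congrArg (fun p => (Polynomial.coeff p a).coeff b) hg
    simp only [Polynomial.coeff_map, Polynomial.coeff_C_mul, Polynomial.coe_mapRingHom] at h2
    change ((g.coeff a).coeff b : k) = _ at h2
    rw [h2, hdab] at h1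
    exact lt_irrefl _ h1
  · refine Polynomial.natDegree_map_le.trans ?_
    rw [← Polynomial.natDegree_map_eq_of_injective hinj, hg]
    exact (Polynomial.natDegree_C_mul_le _ _).trans hm
  · have e1 : (Polynomial.eval₂RingHom (comapResidue ι O) (residue O s)).comp
        (Polynomial.mapRingHom (residue A)) =
        (residue O).comp (Polynomial.eval₂RingHom (comapHom ι O) s) := by
      refine Polynomial.ringHom_ext (fun a => ?_) ?_
      · simp
        rfl
      · simp
    have e2 : O.subtype.comp (Polynomial.eval₂RingHom (comapHom ι O) s) =
        (Polynomial.eval₂RingHom ι (s : K)).comp (Polynomial.mapRingHom A.subtype) := by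
      refine Polynomial.ringHom_ext (fun a => ?_) ?_
      · simp
      · simp
    rw [Polynomial.eval₂_map, e1, ← Polynomial.hom_eval₂]
    have : g.eval₂ (Polynomial.eval₂RingHom (comapHom ι O) s) f = 0 := by
      apply O.subtype_injective
      rw [Polynomial.hom_eval₂, e2, ← Polynomial.eval₂_map, hg, Polynomial.eval₂_mul]
      change _ * P.eval₂ (Polynomial.eval₂RingHom ι (s : K)) f = _
      rw [h, mul_zero, map_zero]
    rw [this, map_zero]

end ResidueExtension

section FiniteResidue

open IsLocalRing IsDedekindDomain

/-- Nontrivial valuation rings of number fields have finite residue fields. -/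
lemma finite_residueField {k : Type*} [Field k] [NumberField k] (A : ValuationSubring k)
    (hA : ∃ c, c ≠ 0 ∧ A.valuation c ≠ 1) : Finite (ResidueField A) := by
  obtain ⟨q, hq⟩ := exists_prime_isEquiv A.valuation hA
  let j : NumberField.RingOfIntegers k →+* A :=
    (algebraMap (NumberField.RingOfIntegers k) k).codRestrict A.toSubring fun a =>
      A.mem_of_valuation_le_one _ (val_integer_le_one A.valuation a)
  have hj : ∀ a, (j a : k) = (a : k) := fun a => rfl
  let f : NumberField.RingOfIntegers k →+* ResidueField A := (residue A).comp j
  have hker : ∀ a ∈ q.asIdeal, f a = 0 := by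
    intro a ha
    change residue A (j a) = 0
    rw [residue_eq_zero_iff_val, hj, hq.lt_one_iff_lt_one]
    exact (q.valuation_lt_one_iff_mem a).2 ha
  have hsurj : Function.Surjective f := by
    intro y
    obtain ⟨x, rfl⟩ := residue_surjective y
    obtain ⟨a, ha⟩ := q.exists_valuation_sub_lt_of_integer (K := k) (x := (x : k))
      ((hq.le_one_iff_le_one).1 (A.valuation_le_one x)) 1
    refine ⟨a, ?_⟩
    change residue A (j a) = _
    rw [← sub_eq_zero, ← map_sub, residue_eq_zero_iff_val, hq.lt_one_iff_lt_one]
    rw [Units.val_one] at ha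
    exact ha
  have : Finite (NumberField.RingOfIntegers k ⧸ q.asIdeal) :=
    Ideal.finiteQuotientOfFreeOfNeBot _ q.ne_bot
  exact Finite.of_surjective (Ideal.Quotient.lift q.asIdeal f hker)
    (Ideal.Quotient.lift_surjective_of_surjective _ _ hsurj)

lemma finite_field_square {E : Type*} [Field E] [Finite E] (x : E) :
    IsSquare x ∨ IsSquare (-x) ∨ IsSquare (1 - x) ∨ IsSquare (-(x * (1 - x))) := by
  classical
  have := Fintype.ofFinite E
  by_cases h2 : ringChar E = 2
  · exact .inl (FiniteField.isSquare_of_char_two h2 x)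
  have mul {a b : E} (ha : ¬ IsSquare a) (hb : ¬ IsSquare b) : IsSquare (a * b) := by
    have ha0 : a ≠ 0 := by rintro rfl; exact ha ⟨0, by simp⟩
    have hb0 : b ≠ 0 := by rintro rfl; exact hb ⟨0, by simp⟩
    rw [← quadraticChar_one_iff_isSquare (mul_ne_zero ha0 hb0), map_mul,
      quadraticChar_neg_one_iff_not_isSquare.2 ha, quadraticChar_neg_one_iff_not_isSquare.2 hb]
    norm_num
  by_contra! hc
  obtain ⟨h1, h3, h4, h5⟩ := hc
  obtain ⟨a, ha⟩ := mul h1 h3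
  obtain ⟨b, hb⟩ := mul h1 h4
  have hx : x ≠ 0 := by rintro rfl; exact h1 ⟨0, by simp⟩
  apply h5
  refine ⟨a / x * b, ?_⟩
  rw [hb]
  field_simp
  linear_combination b ^ 2 * ha

lemma eval₂_ne_zero_of_not_isSquare {κ F : Type*} [Field κ] [Finite κ] [Field F] (f : κ →+* F)
    {x : F} (h1 : ¬ IsSquare x) (h2 : ¬ IsSquare (-x)) (h3 : ¬ IsSquare (1 - x))
    (h4 : ¬ IsSquare (-(x * (1 - x)))) (p : Polynomial κ) (hp : p ≠ 0) : p.eval₂ f x ≠ 0 := by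
  intro h0
  let _ : Algebra κ F := f.toAlgebra
  have hx : IsIntegral κ x := IsAlgebraic.isIntegral ⟨p, hp, h0⟩
  have : FiniteDimensional κ (IntermediateField.adjoin κ {x}) :=
    IntermediateField.adjoin.finiteDimensional hx
  have : Finite (IntermediateField.adjoin κ {x}) := Module.finite_of_finite κ
  have key : ∀ a : IntermediateField.adjoin κ {x}, IsSquare a → IsSquare (a : F) := by
    rintro _ ⟨b, rfl⟩
    exact ⟨b, rfl⟩
  rcases finite_field_square (IntermediateField.AdjoinSimple.gen κ x) with h | h | h | h
  · exact h1 (key _ h)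
  · exact h2 (key _ h)
  · exact h3 (key _ h)
  · exact h4 (key _ h)

end FiniteResidue

section RatFuncValuation

open IsLocalRing

variable {k : Type*} [Field k] {O : ValuationSubring (RatFunc k)} {s : O}

lemma not_const_of_residue
    (hs : ∀ p : Polynomial (ResidueField (O.comap RatFunc.C)), p ≠ 0 →
      p.eval₂ (comapResidue RatFunc.C O) (residue O s) ≠ 0) :
    ¬ ∃ c, (s : RatFunc k) = RatFunc.C c := by
  rintro ⟨c, hc⟩
  let c' : O.comap (RatFunc.C (K := k)) := ⟨c, by
    change RatFunc.C c ∈ O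
    rw [← hc]; exact s.2⟩
  apply hs (Polynomial.X - Polynomial.C (residue _ c')) (Polynomial.X_sub_C_ne_zero _)
  rw [Polynomial.eval₂_sub, Polynomial.eval₂_X, Polynomial.eval₂_C, comapResidue_residue,
    sub_eq_zero]
  congr 1
  exact Subtype.ext hc

lemma aeval_toRingHom_eq (s : RatFunc k) :
    (Polynomial.aeval (R := k) s).toRingHom = Polynomial.eval₂RingHom RatFunc.C s := by
  refine Polynomial.ringHom_ext (fun a => ?_) ?_
  · simp [RatFunc.algebraMap_eq_C]
  · simp

/-- Powers of constants of positive value are cofinal. -/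
lemma exists_pow_mul_val_lt_one [NumberField k]
    (hs : ∀ p : Polynomial (ResidueField (O.comap RatFunc.C)), p ≠ 0 →
      p.eval₂ (comapResidue RatFunc.C O) (residue O s) ≠ 0) {c : k} (hc0 : c ≠ 0)
    (hc : O.valuation (RatFunc.C c) < 1) (g : RatFunc k) :
    ∃ M : ℕ, ∀ n, M ≤ n → O.valuation (RatFunc.C c ^ n * g) < 1 := by
  have := finiteDimensional_adjoin_ratFunc (s : RatFunc k) (not_const_of_residue hs)
  suffices ∃ M : ℕ, O.valuation (RatFunc.C c ^ M * g) < 1 by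
    obtain ⟨M, hM⟩ := this
    refine ⟨M, fun n hn => ?_⟩
    obtain ⟨r, rfl⟩ := Nat.exists_eq_add_of_le hn
    rw [pow_add, mul_assoc, mul_left_comm, map_mul, map_pow]
    exact (mul_le_of_le_one_left' (pow_le_one₀ zero_le hc.le)).trans_lt hM
  rcases lt_or_ge (O.valuation g) 1 with hg | hg
  · exact ⟨0, by simpa using hg⟩
  obtain ⟨P, hP0, -, hP⟩ := exists_relation (k := k) (s : RatFunc k) g
  rw [aeval_toRingHom_eq] at hP
  obtain ⟨b, hb0, hb, -⟩ := exists_gauss_value hs P.leadingCoeff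
    (Polynomial.leadingCoeff_ne_zero.2 hP0)
  set v := O.valuation
  have hle : ∀ p : Polynomial k, ∃ e : k, e ≠ 0 ∧ v (p.eval₂ RatFunc.C s) ≤ v (RatFunc.C e) := by
    intro p
    by_cases hp : p = 0
    · exact ⟨1, one_ne_zero, by simp [hp]⟩
    · obtain ⟨e, he, h, -⟩ := exists_gauss_value hs p hp
      exact ⟨e, he, h.le⟩
  choose e he0 he using hle
  let d := P.natDegree
  have hvc : ∀ x : k, x ≠ 0 → ∃ M : ℕ, v (RatFunc.C c) ^ M < v (RatFunc.C x) := fun x hx =>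
    exists_pow_lt_val (v.comap RatFunc.C) hc0 hc hx
  have hg0 : v g ≠ 0 := fun h => by rw [h] at hg; exact absurd hg (by simp)
  have hgp : 0 < v g := zero_lt_iff.2 hg0
  rw [Polynomial.eval₂_eq_sum_range, Finset.sum_range_succ] at hP
  have hlead : v (P.leadingCoeff.eval₂ RatFunc.C s * g ^ d) ≤
      v (∑ i ∈ Finset.range d, (P.coeff i).eval₂ RatFunc.C s * g ^ i) := by
    have : P.leadingCoeff.eval₂ RatFunc.C s * g ^ d =
        -(∑ i ∈ Finset.range d, (P.coeff i).eval₂ RatFunc.C s * g ^ i) := by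
      rw [eq_neg_iff_add_eq_zero, add_comm]
      exact hP
    rw [this, Valuation.map_neg]
  have hne : v (P.leadingCoeff.eval₂ RatFunc.C s * g ^ d) ≠ 0 := by
    rw [map_mul, hb, map_pow]
    exact mul_ne_zero (by simpa using hb0) (pow_ne_zero _ hg0)
  have hI : (Finset.range d).Nonempty := by
    rw [Finset.nonempty_iff_ne_empty]
    intro h
    rw [h, Finset.sum_empty, map_zero, le_zero_iff] at hlead
    exact hne hlead
  obtain ⟨i, hi, hmax⟩ := (Finset.range d).exists_max_image
    (fun i => v ((P.coeff i).eval₂ RatFunc.C s * g ^ i)) hI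
  have h1 := hlead.trans (v.map_sum_le hmax)
  rw [map_mul, map_mul, map_pow, map_pow, hb] at h1
  obtain ⟨j, hj⟩ := Nat.exists_eq_add_of_lt (Finset.mem_range.1 hi)
  have h2 : v (RatFunc.C b) * v g ≤ v (RatFunc.C (e (P.coeff i))) := by
    have h3 : v (RatFunc.C b) * v g ^ (j + 1) ≤ v (RatFunc.C (e (P.coeff i))) := by
      have h4 : v (RatFunc.C b) * v g ^ (j + 1) * v g ^ i ≤
          v (RatFunc.C (e (P.coeff i))) * v g ^ i := by
        refine le_trans (le_of_eq ?_) (h1.trans (mul_le_mul_left (he _) _))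
        rw [mul_assoc, ← pow_add, hj]
        congr 2
        omega
      exact le_of_mul_le_mul_right h4 (pow_pos hgp _)
    refine le_trans ?_ h3
    rw [pow_succ]
    refine mul_le_mul_right ?_ _
    exact le_mul_of_one_le_left' (one_le_pow₀ hg)
  obtain ⟨M, hM⟩ := hvc (b / e (P.coeff i)) (div_ne_zero hb0 (he0 _))
  refine ⟨M, ?_⟩
  rw [map_mul, map_pow]
  refine (mul_lt_mul_of_pos_right hM hgp).trans_le ?_
  rw [map_div₀, map_div₀, div_mul_eq_mul_div]
  exact (div_le_one₀ (zero_lt_iff.2 (by simpa using he0 _))).2 h2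

end RatFuncValuation

namespace QuadData.Realizes

section

variable {G : Type*} [CommGroup G] {S : QuadData G} {F : Type*} [Field F] {φ : Fˣ →* G} {V : Subgroup G}

/-- If `1 + c * g` and `1 + c / g` lie in `V` for a unit `c`, so does `g`. -/
lemma mem_of_approx {Γ : Type*} [LinearOrderedCommGroupWithZero Γ] {v : Valuation F Γ}
    (hv : ∀ x, v x = 1 → x ∈ realSet φ V)
    (hV : ∀ x, v x < 1 → 1 - x ∈ realSet φ (S.core V)) {c g : F} (hc : v c = 1) (hg : g ≠ 0)
    (h1 : 1 + c * g ∈ realSet φ V) (h2 : 1 + c * g⁻¹ ∈ realSet φ V) : g ∈ realSet φ V := by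
  have hc0 : c ≠ 0 := by rintro rfl; simp at hc
  have hcV := hv c hc
  have key : ∀ h : F, h ≠ 0 → v h < 1 → 1 + c * h⁻¹ ∈ realSet φ V → h ∈ realSet φ V := by
    intro h h0 hh h3
    have h4 : v (-(h * c⁻¹)) < 1 := by
      rw [Valuation.map_neg, map_mul, map_inv₀, hc, inv_one, mul_one]; exact hh
    have h5 := realSet_mono (S.core_le V) (hV _ h4)
    have h6 := realSet_mul (realSet_mul h5 (realSet_inv h3)) hcV
    convert h6 using 1
    have h7 := realSet_ne h3
    have h8 : 1 + c * h⁻¹ = (h + c) / h := by field_simp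
    rw [h8] at h7 ⊢
    have h9 : h + c ≠ 0 := fun h => h7 (by rw [h, zero_div])
    field_simp
    ring
  rcases lt_trichotomy (v g) 1 with h | h | h
  · exact key g hg h h2
  · exact hv g h
  · have := key g⁻¹ (inv_ne_zero hg) (by rw [map_inv₀]; exact inv_lt_one_of_one_lt₀ h)
      (by rwa [inv_inv])
    simpa using realSet_inv this

end

variable {G : Type*} [CommGroup G] {S : QuadData G} {k : Type*} [Field k] [NumberField k]
  {φ : (RatFunc k)ˣ →* G} (hφ : S.Realizes φ) {U : Subgroup G} {O : ValuationSubring (RatFunc k)}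

open IsLocalRing

lemma _root_.comap_valuation_ne_one {k K : Type*} [Field k] [Field K] {ι : k →+* K}
    {O : ValuationSubring K} {c : k} (hc0 : c ≠ 0) (hc : O.valuation (ι c) ≠ 1) :
    (O.comap ι).valuation c ≠ 1 := by
  intro h
  have h1 : c ∈ O.comap ι := (O.comap ι).mem_of_valuation_le_one _ h.le
  have h2 : c⁻¹ ∈ O.comap ι := (O.comap ι).mem_of_valuation_le_one _ (by rw [map_inv₀, h, inv_one])
  change ι c ∈ O at h1
  change ι c⁻¹ ∈ O at h2
  rw [← O.valuation_le_one_iff] at h1 h2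
  rw [map_inv₀, map_inv₀, inv_le_one₀ (zero_lt_iff.2 (by simpa using hc0))] at h2
  exact hc (le_antisymm h1 h2)

include hφ

lemma exists_transcendental_residue (hA : S.Admissible U)
    (hU : ∀ x, O.valuation x < 1 → 1 - x ∈ realSet φ (S.core U))
    (hO : ∃ c, c ≠ 0 ∧ O.valuation (RatFunc.C c) ≠ 1) :
    ∃ s : O, ∀ p : Polynomial (ResidueField (O.comap (RatFunc.C (K := k)))), p ≠ 0 →
      p.eval₂ (comapResidue RatFunc.C O) (residue O s) ≠ 0 := by
  obtain ⟨c, hc0, hc⟩ := hO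
  have := finite_residueField (O.comap RatFunc.C) ⟨c, hc0, comap_valuation_ne_one hc0 hc⟩
  obtain ⟨x, hx, hx1, h⟩ := hφ.residue_witness hA hU
  let s : O := ⟨x, O.mem_of_valuation_le_one _ hx.le⟩
  refine ⟨s, ?_⟩
  have key : ∀ y : O, (∀ a : O, ¬ O.valuation (y - a ^ 2 : RatFunc k) < 1) →
      ¬ IsSquare (residue O y) := by
    rintro y hy ⟨b, hb⟩
    obtain ⟨a, rfl⟩ := residue_surjective b
    apply hy a
    rw [← map_mul, ← sub_eq_zero, ← map_sub, residue_eq_zero_iff_val] at hb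
    rw [pow_two]
    exact hb
  refine eval₂_ne_zero_of_not_isSquare _ ?_ ?_ ?_ ?_
  · exact key s fun a => (h a (O.valuation_le_one a)).1
  · rw [← map_neg]
    exact key (-s) fun a => (h a (O.valuation_le_one a)).2.1
  · rw [← map_one (residue O), ← map_sub]
    exact key (1 - s) fun a => (h a (O.valuation_le_one a)).2.2.1
  · rw [← map_one (residue O), ← map_sub, ← map_mul, ← map_neg]
    exact key (-(s * (1 - s))) fun a => (h a (O.valuation_le_one a)).2.2.2

/-- Subgroups of even type that are nontrivial on constants have even residue characteristic. -/
lemma two_of_even (hE : U ∈ S.EvenType)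
    (hv : ∀ x, O.valuation x = 1 → x ∈ realSet φ U)
    (hU : ∀ x, O.valuation x < 1 → 1 - x ∈ realSet φ (S.core U))
    (hO : ∃ c, c ≠ 0 ∧ O.valuation (RatFunc.C c) ≠ 1) : O.valuation 2 < 1 := by
  by_contra h2
  obtain ⟨s, hs⟩ := hφ.exists_transcendental_residue hE.1 hU hO
  obtain ⟨c, hc0, hc⟩ := hO
  have := finite_residueField (O.comap RatFunc.C) ⟨c, hc0, comap_valuation_ne_one hc0 hc⟩
  have := finiteDimensional_adjoin_ratFunc (s : RatFunc k) (not_const_of_residue hs)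
  let _ : Algebra (ResidueField (O.comap (RatFunc.C (K := k)))) (ResidueField O) :=
    (comapResidue RatFunc.C O).toAlgebra
  have e : (Polynomial.aeval (R := ResidueField (O.comap (RatFunc.C (K := k))))
      (residue O s)).toRingHom =
      Polynomial.eval₂RingHom (comapResidue RatFunc.C O) (residue O s) := by
    refine Polynomial.ringHom_ext (fun a => ?_) ?_
    · simp; rfl
    · simp
  obtain ⟨x, y, hx, hy⟩ := exists_not_universal
    (κ := ResidueField (O.comap (RatFunc.C (K := k)))) (residue O s)
    (by
      rintro ⟨p, hp, h0⟩
      exact hs p hp h0)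
    (by
      intro h0
      have h1 := congrArg (comapResidue RatFunc.C O) h0
      rw [map_zero, map_ofNat, ← map_ofNat (residue O), residue_eq_zero_iff_val] at h1
      exact h2 h1)
    (Module.finrank (IntermediateField.adjoin k {(s : RatFunc k)}) (RatFunc k))
    (by
      intro f
      obtain ⟨f, rfl⟩ := residue_surjective f
      obtain ⟨P, hP0, hPm, hP⟩ := exists_relation (k := k) (s : RatFunc k) (f : RatFunc k)
      rw [aeval_toRingHom_eq] at hP
      rw [e]
      exact exists_residue_relation hP0 hPm hP)
  obtain ⟨x, rfl⟩ := residue_surjective x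
  obtain ⟨y, rfl⟩ := residue_surjective y
  have hx1 : O.valuation (x : RatFunc k) = 1 := by
    rw [← residue_ne_zero_iff_val]
    intro h0
    exact hx (h0 ▸ ⟨0, by simp⟩)
  have hy1 : O.valuation (y : RatFunc k) = 1 := by
    rw [← residue_ne_zero_iff_val]
    intro h0
    exact hy 0 0 (by simpa using h0)
  have hx0 : (x : RatFunc k) ≠ 0 := by intro h0; rw [h0] at hx1; simp at hx1
  have hy0 : (y : RatFunc k) ≠ 0 := by intro h0; rw [h0] at hy1; simp at hy1
  have hns : ∀ a, O.valuation a ≤ 1 → ¬ O.valuation (x - a ^ 2) < 1 := by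
    intro a ha hlt
    apply hx
    refine ⟨residue O ⟨a, O.mem_of_valuation_le_one _ ha⟩, ?_⟩
    rw [← map_mul, ← sub_eq_zero, ← map_sub, residue_eq_zero_iff_val]
    rw [pow_two] at hlt
    exact hlt
  have hxc : φ (Units.mk0 _ hx0) ∉ S.core U := by
    rw [← coe_mem_realSet (φ := φ), Units.val_mk0]
    intro h
    obtain ⟨m, z, hm, hz, hxz⟩ := hφ.core_subset hE.1.index hE.1.neg hv h
    have h1 : O.valuation (1 - m) = 1 := O.valuation.map_one_sub_of_lt hm
    have hz1 : O.valuation z = 1 := by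
      rw [hxz, map_mul, h1, one_mul, map_pow] at hx1
      exact (pow_eq_one_iff_of_nonneg zero_le two_ne_zero).1 hx1
    apply hns z hz1.le
    have : (x : RatFunc k) - z ^ 2 = -m * z ^ 2 := by rw [hxz]; ring
    rw [this, map_mul, Valuation.map_neg, map_pow, hz1, one_pow, mul_one]
    exact hm
  have hxU : φ (Units.mk0 _ hx0) ∈ U := by
    rw [← coe_mem_realSet (φ := φ)]; exact hv _ hx1
  have hyU : φ (Units.mk0 _ hy0) ∈ U := by
    rw [← coe_mem_realSet (φ := φ)]; exact hv _ hy1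
  obtain ⟨a, b, ha, hb, hab⟩ := hφ.residue_of_absorbs hE.1.index hE.1.neg hv hx1 hy1 hns
    (hE.2 _ hxU hxc _ hyU)
  apply hy (residue O ⟨a, O.mem_of_valuation_le_one _ ha⟩)
    (residue O ⟨b, O.mem_of_valuation_le_one _ hb⟩)
  rw [← map_pow, ← map_pow, ← map_mul, ← map_sub, ← sub_eq_zero, ← map_sub,
    residue_eq_zero_iff_val]
  exact hab

/-- Approximating subgroups have a prescribed residue characteristic. -/
lemma exists_mem_of_approx {T : Set (Subgroup G)} (hT : ∀ V ∈ T, S.Admissible V)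
    (hA : S.Admissible U) (hUT : S.Approx U T)
    (hU : ∀ x, O.valuation x < 1 → 1 - x ∈ realSet φ (S.core U)) {p : ℕ} (hp : p.Prime)
    (hpO : O.valuation (p : RatFunc k) < 1) :
    ∃ V ∈ T, ∃ O' : ValuationSubring (RatFunc k), (∀ x, O'.valuation x = 1 → x ∈ realSet φ V) ∧
      (∀ x, O'.valuation x < 1 → 1 - x ∈ realSet φ (S.core V)) ∧
      O'.valuation (p : RatFunc k) < 1 := by
  classical
  have hp0 : (p : k) ≠ 0 := Nat.cast_ne_zero.2 hp.ne_zero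
  have e : ((p : RatFunc k)) = RatFunc.C (p : k) := by simp
  rw [e] at hpO
  obtain ⟨s, hs⟩ := hφ.exists_transcendental_residue hA hU ⟨p, hp0, hpO.ne⟩
  obtain ⟨g, hg⟩ := hUT
  obtain ⟨g, rfl⟩ := hφ.surj g
  obtain ⟨M₁, hM₁⟩ := exists_pow_mul_val_lt_one hs hp0 hpO g
  obtain ⟨M₂, hM₂⟩ := exists_pow_mul_val_lt_one hs hp0 hpO (g⁻¹ : RatFunc k)
  set c : RatFunc k := RatFunc.C (p : k) ^ max M₁ M₂
  have h1 := hM₁ (max M₁ M₂) (le_max_left _ _)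
  have h2 := hM₂ (max M₁ M₂) (le_max_right _ _)
  have core {y : RatFunc k} (hy : O.valuation y < 1) : 1 + y ∈ realSet φ (S.core U) := by
    have := hU (-y) (by rwa [Valuation.map_neg])
    rwa [sub_neg_eq_add] at this
  obtain ⟨u₁, hu₁, hc₁⟩ := core h1
  obtain ⟨u₂, hu₂, hc₂⟩ := core h2
  obtain ⟨V, hVT, hVE, hgV⟩ := hg {φ u₁, φ u₂} (by
    intro x hx
    rw [Finset.mem_insert, Finset.mem_singleton] at hx
    rcases hx with rfl | rfl
    · exact hc₁
    · exact hc₂)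
  obtain ⟨O', hv', hV'⟩ := hφ.exists_valuationSubring (hT V hVT)
  refine ⟨V, hVT, O', hv', hV', ?_⟩
  rw [e]
  by_contra hlt
  have hle : O'.valuation (RatFunc.C (p : k)) ≤ 1 := by
    rw [← e]
    exact (O'.valuation_le_one_iff _).2 (natCast_mem O'.toSubring p)
  have heq : O'.valuation (RatFunc.C (p : k)) = 1 := le_antisymm hle (not_lt.1 hlt)
  apply hgV
  rw [← coe_mem_realSet (φ := φ)]
  refine mem_of_approx (c := c) hv' hV' (by rw [map_pow, heq, one_pow]) g.ne_zero ?_ ?_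
  · exact ⟨u₁, hu₁, hVE _ (by simp)⟩
  · exact ⟨u₂, hu₂, hVE _ (by simp)⟩

/-- Horizontal subgroups contain the constants. -/
lemma const_mem_of_horizontal (hU : U ∈ S.Horizontal) {c : k} (hc : c ≠ 0) :
    RatFunc.C c ∈ realSet φ U := by
  obtain ⟨hA, hev, hodd⟩ := hU
  obtain ⟨O, hv, hU⟩ := hφ.exists_valuationSubring hA
  by_contra hcU
  have hc1 : O.valuation (RatFunc.C c) ≠ 1 := fun h => hcU (hv _ h)
  obtain ⟨p, hp, hpv⟩ := exists_rat_prime (O.valuation.comap RatFunc.C) ⟨c, hc, hc1⟩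
  have hpO : O.valuation (p : RatFunc k) < 1 := by
    have e : ((p : RatFunc k)) = RatFunc.C (p : k) := by simp
    rw [e]; exact hpv
  obtain ⟨V, hV, O', hv', hV', hp'⟩ := hφ.exists_mem_of_approx (fun V hV => hV.1) hA hev hU hp hpO
  have h2 : O'.valuation 2 < 1 := by
    refine hφ.two_of_even hV hv' hV' ⟨(p : k), Nat.cast_ne_zero.2 hp.ne_zero, ?_⟩
    rw [map_natCast]
    exact hp'.ne
  have hp2 : p = 2 := by
    by_contra hne
    obtain ⟨a, b, hab⟩ := Nat.isCoprime_iff_coprime.2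
      ((Nat.coprime_primes hp Nat.prime_two).2 hne)
    have h3 := congrArg (fun n : ℤ => (n : RatFunc k)) hab
    push_cast at h3
    have h4 : O'.valuation ((a : RatFunc k) * p + b * 2) < 1 := by
      refine O'.valuation.map_add_lt ?_ ?_
      · rw [map_mul]
        exact (mul_le_of_le_one_left' ((O'.valuation_le_one_iff _).2
          (intCast_mem O'.toSubring a))).trans_lt hp'
      · rw [map_mul]
        exact (mul_le_of_le_one_left' ((O'.valuation_le_one_iff _).2
          (intCast_mem O'.toSubring b))).trans_lt h2
    rw [h3, map_one] at h4
    exact lt_irrefl _ h4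
  obtain ⟨V₁, hV₁, O₁, hv₁, hV₁', hp₁⟩ :=
    hφ.exists_mem_of_approx (fun V hV => hV.1) hA hodd hU hp hpO
  refine hφ.two_unit_of_odd hV₁ hv₁ hV₁' ?_
  rw [hp2] at hp₁
  exact_mod_cast hp₁

end QuadData.Realizes

open WithZero in
lemma isSquare_iff_even_log {a : WithZero (Multiplicative ℤ)} (ha : a ≠ 0) :
    IsSquare a ↔ Even (log a) := by
  constructor
  · rintro ⟨b, rfl⟩
    have hb : b ≠ 0 := fun h => ha (by simp [h])
    exact ⟨log b, log_mul hb hb⟩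
  · rintro ⟨n, hn⟩
    refine ⟨exp n, ?_⟩
    rw [← exp_add, ← hn, exp_log ha]

open WithZero in
lemma not_isSquare_exp_neg_one : ¬ IsSquare (exp (-1 : ℤ)) := by
  rw [isSquare_iff_even_log exp_ne_zero, log_exp]
  decide

/-- The classes of the elements of even value. -/
def evenSubgroup {G : Type*} [CommGroup G] {F : Type*} [Field F] (φ : Fˣ →* G)
    (v : Valuation F (WithZero (Multiplicative ℤ))) : Subgroup G where
  carrier := {g | ∃ u : Fˣ, φ u = g ∧ IsSquare (v u)}
  mul_mem' := by
    rintro _ _ ⟨u, rfl, hu⟩ ⟨w, rfl, hw⟩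
    exact ⟨u * w, map_mul _ _ _, by simpa using hu.mul hw⟩
  one_mem' := ⟨1, map_one _, by simp⟩
  inv_mem' := by
    rintro _ ⟨u, rfl, hu⟩
    exact ⟨u⁻¹, map_inv _ _, by simpa using hu⟩

namespace QuadData.Realizes

variable {G : Type*} [CommGroup G] {S : QuadData G} {F : Type*} [Field F] {φ : Fˣ →* G}
  (hφ : S.Realizes φ) {U : Subgroup G} {v : Valuation F (WithZero (Multiplicative ℤ))}

include hφ

lemma mem_evenSubgroup {u : Fˣ} : φ u ∈ evenSubgroup φ v ↔ IsSquare (v u) := by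
  refine ⟨fun ⟨w, hw, h⟩ => ?_, fun h => ⟨u, rfl, h⟩⟩
  obtain ⟨y, hy⟩ := (hφ.ker (u / w)).1 (by rw [map_div, hw, div_self'])
  obtain rfl : u = w * (y * y) := by rw [← hy, mul_div_cancel]
  simpa using h.mul ⟨v y, rfl⟩

lemma mem_realSet_evenSubgroup {x : F} :
    x ∈ realSet φ (evenSubgroup φ v) ↔ x ≠ 0 ∧ IsSquare (v x) := by
  constructor
  · rintro ⟨u, rfl, hu⟩
    exact ⟨u.ne_zero, hφ.mem_evenSubgroup.1 hu⟩
  · rintro ⟨h0, h⟩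
    exact ⟨Units.mk0 x h0, rfl, hφ.mem_evenSubgroup.2 h⟩

lemma mem_evenSubgroup_of_eq_one {x : F} (hx : v x = 1) :
    x ∈ realSet φ (evenSubgroup φ v) :=
  hφ.mem_realSet_evenSubgroup.2 ⟨fun h => by simp [h] at hx, by simp [hx]⟩

lemma neg_mem_evenSubgroup : S.neg ∈ evenSubgroup φ v := by
  rw [← hφ.neg, hφ.mem_evenSubgroup]
  simp [Valuation.map_neg]

lemma index_evenSubgroup {ϖ : F} (hϖ : v ϖ = WithZero.exp (-1 : ℤ)) :
    (evenSubgroup φ v).index = 2 := by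
  have h0 : ϖ ≠ 0 := fun h => WithZero.exp_ne_zero (by rw [← hϖ, h, map_zero])
  rw [Subgroup.index_eq_two_iff]
  refine ⟨φ (Units.mk0 ϖ h0), fun g => ?_⟩
  obtain ⟨u, rfl⟩ := hφ.surj g
  have vu : v u ≠ 0 := by simp
  rw [← map_mul, hφ.mem_evenSubgroup, hφ.mem_evenSubgroup, isSquare_iff_even_log (by simpa using h0),
    isSquare_iff_even_log vu]
  simp only [Units.val_mul, Units.val_mk0, map_mul]
  rw [WithZero.log_mul vu (by simpa using h0), hϖ, WithZero.log_exp, Int.even_add]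
  have : ¬ Even (-1 : ℤ) := by decide
  simp only [this, iff_false]
  by_cases h : Even (WithZero.log (v u)) <;> simp [h, Xor]

lemma one_sub_mem_core_evenSubgroup {ϖ : F} (hϖ : v ϖ = WithZero.exp (-1 : ℤ)) {m : F}
    (hm : v m < 1) : 1 - m ∈ realSet φ (S.core (evenSubgroup φ v)) := by
  have hU {x : F} (hx : v x < 1) : 1 - x ∈ realSet φ (evenSubgroup φ v) :=
    hφ.mem_evenSubgroup_of_eq_one (v.map_one_sub_of_lt hx)
  have odd {b x : F} (hx : v x < 1) (hb : b ∉ realSet φ (evenSubgroup φ v)) (hb0 : b ≠ 0)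
      (h : b = x) : 1 - x ∈ realSet φ (S.core (evenSubgroup φ v)) :=
    hφ.mem_core (hU hx) hb0 hb (p := 1) (q := 1) (by rw [h]; ring)
  have ϖ0 : ϖ ≠ 0 := fun h => WithZero.exp_ne_zero (by rw [← hϖ, h, map_zero])
  have hϖU : ϖ ∉ realSet φ (evenSubgroup φ v) := fun h => by
    have := (hφ.mem_realSet_evenSubgroup.1 h).2
    rw [hϖ] at this
    exact not_isSquare_exp_neg_one this
  have hϖ1 : v ϖ < 1 := by
    rw [hϖ, ← WithZero.exp_zero, WithZero.exp_lt_exp]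
    norm_num
  by_cases hm0 : m = 0
  · simpa [hm0] using one_mem_realSet
  by_cases hmU : m ∈ realSet φ (evenSubgroup φ v)
  · have h1 : (1 : F) - ϖ ≠ 0 := by
      have := v.map_one_sub_of_lt hϖ1
      intro h
      simp [h] at this
    have v1 : v (1 - ϖ) = 1 := v.map_one_sub_of_lt hϖ1
    set b := (m - ϖ) / (1 - ϖ) with hb
    have e : 1 - m = (1 - ϖ) * (1 - b) := by
      rw [hb]; field_simp; ring
    have hsq := (hφ.mem_realSet_evenSubgroup.1 hmU).2
    have hne : v m ≠ v ϖ := fun h => by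
      rw [h, hϖ] at hsq
      exact not_isSquare_exp_neg_one hsq
    have vb : v b = max (v m) (v ϖ) := by
      rw [hb, map_div₀, v1, div_one, sub_eq_add_neg, Valuation.map_add_of_distinct_val, v.map_neg]
      rwa [v.map_neg]
    have vb1 : v b < 1 := by rw [vb]; exact max_lt hm hϖ1
    have hmϖ : v m < v ϖ := by
      refine lt_of_le_of_ne ?_ hne
      have : v m ≠ 0 := by simpa using hm0
      rw [hϖ, ← WithZero.exp_log this, WithZero.exp_le_exp]
      rw [← WithZero.exp_log this, ← WithZero.exp_zero, WithZero.exp_lt_exp] at hm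
      lia
    have vb' : v b = v ϖ := by rw [vb, max_eq_right hmϖ.le]
    rw [e]
    refine realSet_mul (odd hϖ1 hϖU ϖ0 rfl) (odd vb1 (fun h => ?_) (fun h => ?_) rfl)
    · have := (hφ.mem_realSet_evenSubgroup.1 h).2
      rw [vb', hϖ] at this
      exact not_isSquare_exp_neg_one this
    · rw [h] at vb'
      exact ϖ0 (by simpa using vb'.symm)
  · exact odd hm hmU hm0 rfl

/-- Elements whose residue is not a square are not in the core. -/
lemma notMem_core_of_residue {Γ : Type*} [LinearOrderedCommGroupWithZero Γ] {v : Valuation F Γ}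
    (hidx : U.index = 2) (hneg : S.neg ∈ U)
    (hv : ∀ x, v x = 1 → x ∈ realSet φ U) {x : F} (hx : v x = 1)
    (h : ∀ a, v a ≤ 1 → ¬ v (x - a ^ 2) < 1) : x ∉ realSet φ (S.core U) := by
  intro hc
  obtain ⟨m, y, hm, hy, rfl⟩ := hφ.core_subset hidx hneg hv hc
  rw [map_mul, v.map_one_sub_of_lt hm, one_mul, map_pow] at hx
  have hy1 : v y = 1 := (pow_eq_one_iff_of_nonneg (zero_le) two_ne_zero).1 hx
  refine h y hy1.le ?_
  rw [show (1 - m) * y ^ 2 - y ^ 2 = -(m * y ^ 2) by ring, v.map_neg, map_mul, map_pow, hy1]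
  simpa using hm

lemma admissible_evenSubgroup {ϖ : F} (hϖ : v ϖ = WithZero.exp (-1 : ℤ)) {x : F}
    (hx : v x = 1) (hx' : v (1 - x) = 1) (h : ∀ a, v a ≤ 1 → ¬ v (x - a ^ 2) < 1 ∧
      ¬ v (-x - a ^ 2) < 1 ∧ ¬ v (1 - x - a ^ 2) < 1 ∧ ¬ v (-(x * (1 - x)) - a ^ 2) < 1) :
    S.Admissible (evenSubgroup φ v) := by
  have hidx := hφ.index_evenSubgroup hϖ
  have hneg := hφ.neg_mem_evenSubgroup (v := v)
  have key {x : F} (hx : v x = 1) (h : ∀ a, v a ≤ 1 → ¬ v (x - a ^ 2) < 1) :=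
    hφ.notMem_core_of_residue hidx hneg (fun _ => hφ.mem_evenSubgroup_of_eq_one) hx h
  have x0 : x ≠ 0 := fun h => by simp [h] at hx
  have x1 : 1 - x ≠ 0 := fun h => by simp [h] at hx'
  refine ⟨hidx, hneg, φ (Units.mk0 x x0), ?_, ?_, ?_, φ (Units.mk0 (1 - x) x1), ?_, ?_, ?_⟩
  · rw [hφ.mem_evenSubgroup]
    simp [hx]
  · rw [← coe_mem_realSet]
    exact key hx fun a ha => (h a ha).1
  · rw [← hφ.neg, ← map_mul, ← coe_mem_realSet]
    simpa using key (x := -x) (by rwa [v.map_neg]) fun a ha => (h a ha).2.1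
  · rw [hφ.rep]
    exact ⟨1, 1, by simp⟩
  · rw [← coe_mem_realSet]
    exact key hx' fun a ha => (h a ha).2.2.1
  · rw [← hφ.neg, ← map_mul, ← map_mul, ← coe_mem_realSet]
    simpa using key (x := -(x * (1 - x))) (by simp [v.map_neg, hx, hx'])
      fun a ha => (h a ha).2.2.2

end QuadData.Realizes

section RatFunc

variable {κ : Type*} [Field κ]

lemma RatFunc.exists_polynomial_of_sq {f : Polynomial κ} {r : RatFunc κ}
    (h : algebraMap (Polynomial κ) (RatFunc κ) f = r * r) :
    ∃ g : Polynomial κ, f = g * g := by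
  have hr : IsIntegral (Polynomial κ) r := by
    refine IsIntegral.of_pow (n := 2) two_pos ?_
    rw [pow_two, ← h]
    exact isIntegral_algebraMap
  obtain ⟨g, rfl⟩ := IsIntegrallyClosed.isIntegral_iff.1 hr
  exact ⟨g, RatFunc.algebraMap_injective κ (by rw [h, map_mul])⟩

lemma RatFunc.not_isSquare_of_squarefree {f : Polynomial κ} (hf : Squarefree f)
    (hu : ¬ IsUnit f) : ¬ IsSquare (algebraMap (Polynomial κ) (RatFunc κ) f) := by
  rintro ⟨r, hr⟩
  obtain ⟨g, rfl⟩ := RatFunc.exists_polynomial_of_sq hr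
  exact hu ((hf g dvd_rfl).mul (hf g dvd_rfl))

lemma RatFunc.not_isSquare_C {ε : κ} (hε : ¬ IsSquare ε) : ¬ IsSquare (RatFunc.C ε) := by
  rintro ⟨r, hr⟩
  rw [← RatFunc.algebraMap_C] at hr
  obtain ⟨g, hg⟩ := RatFunc.exists_polynomial_of_sq hr
  refine hε ⟨g.eval 0, ?_⟩
  simpa using congrArg (Polynomial.eval 0) hg

lemma RatFunc.exists_sq_add_X_mul_sq [PerfectField κ] (h2 : (2 : κ) = 0) (r : RatFunc κ) :
    ∃ a b : RatFunc κ, r = a ^ 2 + RatFunc.X * b ^ 2 := by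
  have h2' : (2 : RatFunc κ) = 0 := by
    rw [← map_ofNat RatFunc.C 2, h2, map_zero]
  have hsq (c : κ) : ∃ d, c = d ^ 2 := by
    have : CharP κ 2 := CharTwo.of_one_ne_zero_of_two_eq_zero one_ne_zero h2
    have : Fact (Nat.Prime 2) := ⟨Nat.prime_two⟩
    have : ExpChar κ 2 := ExpChar.prime Nat.prime_two
    have : PerfectRing κ 2 := PerfectField.toPerfectRing 2
    obtain ⟨d, hd⟩ := surjective_frobenius κ 2 c
    exact ⟨d, by rw [← hd, frobenius_def]⟩
  have hp (f : Polynomial κ) : ∃ a b : RatFunc κ,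
      algebraMap (Polynomial κ) (RatFunc κ) f = a ^ 2 + RatFunc.X * b ^ 2 := by
    induction f using Polynomial.induction_on' with
    | add f g hf hg =>
      obtain ⟨a, b, h⟩ := hf
      obtain ⟨a', b', h'⟩ := hg
      refine ⟨a + a', b + b', ?_⟩
      rw [map_add, h, h']
      linear_combination (-(a * a') - RatFunc.X * (b * b')) * h2'
    | monomial n c =>
      obtain ⟨d, rfl⟩ := hsq c
      rw [← Polynomial.C_mul_X_pow_eq_monomial, map_mul, map_pow _ Polynomial.X,
        RatFunc.algebraMap_X, RatFunc.algebraMap_C, map_pow]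
      rcases Nat.even_or_odd' n with ⟨m, rfl | rfl⟩
      · exact ⟨RatFunc.C d * RatFunc.X ^ m, 0, by ring⟩
      · exact ⟨0, RatFunc.C d * RatFunc.X ^ m, by ring⟩
  obtain ⟨a, b, h⟩ := hp (r.num * r.denom)
  have hd : algebraMap (Polynomial κ) (RatFunc κ) r.denom ≠ 0 :=
    RatFunc.algebraMap_ne_zero r.denom_ne_zero
  refine ⟨a / algebraMap _ _ r.denom, b / algebraMap _ _ r.denom, ?_⟩
  rw [map_mul] at h
  nth_rw 1 [← r.num_div_denom]
  field_simp
  linear_combination h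

/-- In characteristic two, `⟨1, -x⟩` is universal for every nonsquare `x`. -/
lemma RatFunc.exists_sq_sub_mul_sq_of_two_eq_zero [PerfectField κ] (h2 : (2 : κ) = 0)
    {x : RatFunc κ} (hx : ¬ IsSquare x) (y : RatFunc κ) :
    ∃ a b : RatFunc κ, y = a ^ 2 - x * b ^ 2 := by
  have h2' : (2 : RatFunc κ) = 0 := by
    rw [← map_ofNat RatFunc.C 2, h2, map_zero]
  obtain ⟨p, q, hpq⟩ := RatFunc.exists_sq_add_X_mul_sq h2 x
  obtain ⟨e, o, heo⟩ := RatFunc.exists_sq_add_X_mul_sq h2 y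
  have hq : q ≠ 0 := by
    rintro rfl
    exact hx ⟨p, by rw [hpq]; ring⟩
  refine ⟨e - p * (o / q), o / q, ?_⟩
  rw [heo, hpq]
  field_simp
  linear_combination (e * p * o * q + RatFunc.X * o ^ 2 * q ^ 2) * h2'

/-- A polynomial with a simple root at `0` is not of the form `a ^ 2 - ε * b ^ 2` over the
rational functions when `ε` is not a square. -/
lemma RatFunc.not_norm_of_simple_root {ε : κ} (hε : ¬ IsSquare ε) {g : Polynomial κ}
    (hg : g.eval 0 ≠ 0) (a b : RatFunc κ) :
    algebraMap (Polynomial κ) (RatFunc κ) (Polynomial.X * g) ≠ a ^ 2 - RatFunc.C ε * b ^ 2 := by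
  have main (n : ℕ) : ∀ a b d : Polynomial κ, d ≠ 0 → d.natDegree = n →
      Polynomial.X * g * d ^ 2 ≠ a ^ 2 - Polynomial.C ε * b ^ 2 := by
    induction n using Nat.strong_induction_on with
    | _ n ih =>
      intro a b d hd hn h
      have h0 := congrArg (Polynomial.eval 0) h
      simp only [Polynomial.eval_mul, Polynomial.eval_X, zero_mul, Polynomial.eval_sub,
        Polynomial.eval_pow, Polynomial.eval_C] at h0
      have hb : b.eval 0 = 0 := by
        by_contra hb
        exact hε ⟨a.eval 0 / b.eval 0, by field_simp; linear_combination h0⟩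
      have ha : a.eval 0 = 0 := by
        rw [hb] at h0
        simpa using h0.symm
      rw [← Polynomial.IsRoot.def, Polynomial.zero_isRoot_iff_coeff_zero_eq_zero,
        ← Polynomial.X_dvd_iff] at ha hb
      obtain ⟨a, rfl⟩ := ha
      obtain ⟨b, rfl⟩ := hb
      have h1 : g * d ^ 2 = Polynomial.X * (a ^ 2 - Polynomial.C ε * b ^ 2) :=
        mul_left_cancel₀ Polynomial.X_ne_zero (by linear_combination h)
      have hd0 : d.eval 0 = 0 := by
        have := congrArg (Polynomial.eval 0) h1
        simpa [hg] using this
      rw [← Polynomial.IsRoot.def, Polynomial.zero_isRoot_iff_coeff_zero_eq_zero,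
        ← Polynomial.X_dvd_iff] at hd0
      obtain ⟨d, rfl⟩ := hd0
      have hd' : d ≠ 0 := right_ne_zero_of_mul hd
      refine ih d.natDegree ?_ a b d hd' rfl
        (mul_left_cancel₀ Polynomial.X_ne_zero (by linear_combination h1))
      rw [← hn, Polynomial.natDegree_X_mul hd']
      lia
  intro h
  obtain ⟨⟨d, hd⟩, hI⟩ := IsLocalization.exist_integer_multiples
    (nonZeroDivisors (Polynomial κ)) (Finset.univ : Finset Bool) fun i => cond i a b
  obtain ⟨a', ha'⟩ := hI true (by simp)
  obtain ⟨b', hb'⟩ := hI false (by simp)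
  rw [Algebra.smul_def] at ha' hb'
  simp only [cond_true, cond_false] at ha' hb'
  refine main _ a' b' d (nonZeroDivisors.ne_zero hd) rfl (RatFunc.algebraMap_injective κ ?_)
  simp only [map_sub, map_mul, map_pow, ha', hb', RatFunc.algebraMap_C]
  simp only [map_mul] at h
  rw [h]
  ring

end RatFunc

/-- `ρ` is a model of the residue map of the valuation `v`. -/
structure IsResidueMap {F Γ κ' : Type*} [Field F] [LinearOrderedCommGroupWithZero Γ] [Field κ']
    (v : Valuation F Γ) (ρ : v.integer →+* κ') : Prop where
  surj : Function.Surjective ρ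
  ker : ∀ x, ρ x = 0 ↔ v x < 1

namespace IsResidueMap

variable {F Γ κ' : Type*} [Field F] [LinearOrderedCommGroupWithZero Γ] [Field κ']
  {v : Valuation F Γ} {ρ : v.integer →+* κ'} (h : IsResidueMap v ρ)

include h

lemma val_eq_one_iff {x : v.integer} : v x = 1 ↔ ρ x ≠ 0 := by
  rw [Ne, h.ker]
  exact ⟨fun h => h.not_lt, fun h => le_antisymm x.2 (not_lt.1 h)⟩

lemma not_sq {x : v.integer} (hx : ¬ IsSquare (ρ x)) {a : F} (ha : v a ≤ 1) :
    ¬ v (x - a ^ 2) < 1 := by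
  intro hc
  have := (h.ker (x - ⟨a, ha⟩ ^ 2)).2 (by simpa using hc)
  rw [map_sub, map_pow, sub_eq_zero] at this
  exact hx ⟨_, this.trans (pow_two _)⟩

end IsResidueMap

namespace QuadData.Realizes

variable {G : Type*} [CommGroup G] {S : QuadData G} {F : Type*} [Field F] {φ : Fˣ →* G}
  (hφ : S.Realizes φ) {U : Subgroup G}

include hφ

lemma absorbs_of_residue {Γ : Type*} [LinearOrderedCommGroupWithZero Γ] {v : Valuation F Γ}
    (hU : ∀ x, v x < 1 → 1 - x ∈ realSet φ (S.core U)) {x y : Fˣ} (hy : v y = 1) {a b : F}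
    (h : v (y - (a ^ 2 - x * b ^ 2)) < 1) : S.Absorbs U (φ x) (φ y) := by
  set z := a ^ 2 - x * b ^ 2 with hz
  set m := (y - z) / y with hm
  have y0 : (y : F) ≠ 0 := y.ne_zero
  have hm1 : v m < 1 := by rwa [hm, map_div₀, hy, div_one]
  obtain ⟨w, hw, hw'⟩ := hU m hm1
  refine ⟨1, Subgroup.one_mem _, φ w, hw', ?_⟩
  rw [mul_one, ← map_mul, hφ.rep]
  refine ⟨a, b, ?_⟩
  rw [← hz, Units.val_mul, hw, hm]
  field_simp
  ring

variable {v : Valuation F (WithZero (Multiplicative ℤ))}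

/-- Elements of even value are units up to squares. -/
lemma exists_unit_of_mem_evenSubgroup {ϖ : F} (hϖ : v ϖ = WithZero.exp (-1 : ℤ)) {g : G}
    (hg : g ∈ evenSubgroup φ v) : ∃ u : Fˣ, v u = 1 ∧ φ u = g := by
  obtain ⟨u, rfl, hu⟩ := hg
  have h0 : ϖ ≠ 0 := fun h => WithZero.exp_ne_zero (by rw [← hϖ, h, map_zero])
  have vu : v u ≠ 0 := by simp
  rw [isSquare_iff_even_log vu] at hu
  obtain ⟨n, hn⟩ := hu
  set w := Units.mk0 ϖ h0 ^ n
  refine ⟨u * (w * w), ?_, by rw [map_mul, hφ.map_sq, mul_one]⟩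
  simp only [w, Units.val_mul, Units.val_zpow_eq_zpow_val, Units.val_mk0, map_mul, map_zpow₀, hϖ]
  rw [← WithZero.exp_log vu, hn, ← WithZero.exp_zsmul, ← WithZero.exp_add, ← WithZero.exp_add,
    ← WithZero.exp_zero]
  congr 1
  simp

variable {κ : Type*} [Field κ] {ρ : v.integer →+* RatFunc κ}

lemma admissible_of_residue (hρ : IsResidueMap v ρ) {ϖ : F}
    (hϖ : v ϖ = WithZero.exp (-1 : ℤ)) : S.Admissible (evenSubgroup φ v) := by
  obtain ⟨s, hs⟩ := hρ.surj RatFunc.X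
  have key {f : Polynomial κ} (hf : f.Separable) (hu : f.natDegree ≠ 0) {x : v.integer}
      (hx : ρ x = algebraMap _ _ f) {a : F} (ha : v a ≤ 1) : ¬ v (x - a ^ 2) < 1 :=
    hρ.not_sq (by
      rw [hx]
      exact RatFunc.not_isSquare_of_squarefree hf.squarefree
        fun h => hu (Polynomial.natDegree_eq_zero_of_isUnit h)) ha
  have ne {f : Polynomial κ} (hu : f.natDegree ≠ 0) {x : v.integer}
      (hx : ρ x = algebraMap _ _ f) : v x = 1 := by
    rw [hρ.val_eq_one_iff, hx]
    exact RatFunc.algebraMap_ne_zero (by rintro rfl; simp at hu)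
  have d1 : (Polynomial.X : Polynomial κ).natDegree ≠ 0 := by simp
  have d2 : (-Polynomial.X : Polynomial κ).natDegree ≠ 0 := by simp
  have d3 : (1 - Polynomial.X : Polynomial κ).natDegree ≠ 0 := by
    rw [Polynomial.natDegree_sub]
    simpa using (Polynomial.natDegree_X_sub_C (1 : κ)).trans_ne one_ne_zero
  have d4 : (-(Polynomial.X * (1 - Polynomial.X)) : Polynomial κ).natDegree ≠ 0 := by
    rw [Polynomial.natDegree_neg, Polynomial.natDegree_X_mul (by rintro h; simp [h] at d3)]
    simp
  have e1 : ρ s = algebraMap _ _ (Polynomial.X : Polynomial κ) := by simp [hs]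
  have e2 : ρ (-s) = algebraMap _ _ (-Polynomial.X : Polynomial κ) := by simp [hs]
  have e3 : ρ (1 - s) = algebraMap _ _ (1 - Polynomial.X : Polynomial κ) := by simp [hs]
  have e4 : ρ (-(s * (1 - s))) =
      algebraMap _ _ (-(Polynomial.X * (1 - Polynomial.X)) : Polynomial κ) := by simp [hs]
  refine hφ.admissible_evenSubgroup hϖ (x := s) (ne d1 e1) (ne d3 e3) fun a ha =>
    ⟨key Polynomial.separable_X d1 e1 ha, key (f := -Polynomial.X) ?_ d2 e2 ha,
      key (f := 1 - Polynomial.X) ?_ d3 e3 ha,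
      key (f := -(Polynomial.X * (1 - Polynomial.X))) ?_ d4 e4 ha⟩
  · exact ⟨0, -1, by simp⟩
  · exact ⟨0, -1, by simp⟩
  · refine ⟨-4, 2 * Polynomial.X - 1, ?_⟩
    simp only [Polynomial.derivative_neg, Polynomial.derivative_mul, Polynomial.derivative_X,
      Polynomial.derivative_sub, Polynomial.derivative_one]
    ring

lemma evenType_of_residue [PerfectField κ] (hρ : IsResidueMap v ρ) {ϖ : F}
    (hϖ : v ϖ = WithZero.exp (-1 : ℤ)) (h2 : (2 : κ) = 0) :
    evenSubgroup φ v ∈ S.EvenType := by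
  refine ⟨hφ.admissible_of_residue hρ hϖ, fun x hx hxc y hy => ?_⟩
  have hU := fun x => hφ.one_sub_mem_core_evenSubgroup hϖ (m := x)
  obtain ⟨x, vx, rfl⟩ := hφ.exists_unit_of_mem_evenSubgroup hϖ hx
  obtain ⟨y, vy, rfl⟩ := hφ.exists_unit_of_mem_evenSubgroup hϖ hy
  have hns : ¬ IsSquare (ρ ⟨x, vx.le⟩) := by
    rintro ⟨r, hr⟩
    obtain ⟨z, rfl⟩ := hρ.surj r
    have hz : v z = 1 := by
      rw [hρ.val_eq_one_iff]
      intro h0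
      rw [h0, mul_zero, hρ.ker] at hr
      exact hr.ne vx
    have z0 : (z : F) ≠ 0 := fun h => by simp [h] at hz
    rw [← map_mul, ← sub_eq_zero, ← map_sub, hρ.ker] at hr
    refine hxc (coe_mem_realSet.1 (hφ.mem_core_of_eq hU (m := 1 - x / z ^ 2) ?_ z0 ?_))
    · rw [show (1 : F) - x / z ^ 2 = -((x - z * z) / z ^ 2) by field_simp; ring, v.map_neg,
        map_div₀, map_pow, hz]
      simpa using hr
    · field_simp
      ring
  obtain ⟨a, b, hab⟩ := RatFunc.exists_sq_sub_mul_sq_of_two_eq_zero h2 hns (ρ ⟨y, vy.le⟩)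
  obtain ⟨a, rfl⟩ := hρ.surj a
  obtain ⟨b, rfl⟩ := hρ.surj b
  rw [← map_pow, ← map_pow, ← map_mul, ← map_sub, ← sub_eq_zero, ← map_sub, hρ.ker] at hab
  exact hφ.absorbs_of_residue hU vy (a := a) (b := b) (by simpa using hab)

lemma oddType_of_residue [Finite κ] (hρ : IsResidueMap v ρ) {ϖ : F}
    (hϖ : v ϖ = WithZero.exp (-1 : ℤ)) (h2 : (2 : κ) ≠ 0) :
    evenSubgroup φ v ∈ S.OddType := by
  have hA := hφ.admissible_of_residue hρ hϖ
  have hv := fun x => hφ.mem_evenSubgroup_of_eq_one (v := v) (x := x)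
  refine ⟨hA, ?_⟩
  obtain ⟨ε, hε⟩ : ∃ ε : κ, ¬ IsSquare ε := FiniteField.exists_nonsquare fun h =>
    h2 (by have := ringChar.of_eq h; exact CharTwo.two_eq_zero)
  have hε' : ¬ IsSquare (RatFunc.C ε) := RatFunc.not_isSquare_C hε
  obtain ⟨x, hx⟩ := hρ.surj (RatFunc.C ε)
  obtain ⟨s, hs⟩ := hρ.surj RatFunc.X
  set y := 1 - x * s ^ 2 with hy
  set z := 1 - y * (1 + s) ^ 2 with hz
  have ey : ρ y = algebraMap _ _ (1 - Polynomial.C ε * Polynomial.X ^ 2) := by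
    simp [y, hx, hs, RatFunc.algebraMap_C]
  set g : Polynomial κ := Polynomial.X * (-1 + Polynomial.C ε * (1 + Polynomial.X) ^ 2) - 2 with hg
  have hg0 : g.eval 0 ≠ 0 := by simpa [g] using h2
  have ez : ρ z = algebraMap _ _ (Polynomial.X * g) := by
    simp only [z, map_sub, map_one, map_mul, ey, map_pow, map_add, hs, g, RatFunc.algebraMap_C,
      RatFunc.algebraMap_X, map_neg, map_ofNat]
    ring
  have nsy : ¬ IsSquare (ρ y) := by
    rw [ey]
    refine RatFunc.not_isSquare_of_squarefree (Polynomial.Separable.squarefree ?_) fun h => ?_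
    · refine ⟨1, Polynomial.C (2⁻¹) * Polynomial.X * -1, ?_⟩
      have : (Polynomial.C (2⁻¹) * 2 : Polynomial κ) = 1 := by
        rw [← map_ofNat Polynomial.C 2, ← map_mul, inv_mul_cancel₀ h2, map_one]
      simp only [Polynomial.derivative_sub, Polynomial.derivative_one, Polynomial.derivative_mul,
        Polynomial.derivative_C, Polynomial.derivative_X_pow]
      simp only [zero_mul, zero_add, Nat.cast_ofNat, map_ofNat]
      linear_combination (Polynomial.C ε * Polynomial.X ^ 2) * this
    · have hd := Polynomial.natDegree_eq_zero_of_isUnit h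
      have h0 : ε ≠ 0 := by rintro rfl; exact hε (by simp)
      rw [Polynomial.natDegree_sub, ← Polynomial.C_1, Polynomial.natDegree_sub_C,
        Polynomial.natDegree_C_mul_X_pow 2 ε h0] at hd
      simp at hd
  have vx : v x = 1 := hρ.val_eq_one_iff.2 fun h => hε' (by rw [← hx, h]; simp)
  have vy : v y = 1 := hρ.val_eq_one_iff.2 fun h => nsy (by rw [h]; simp)
  have vz : v z = 1 := by
    rw [hρ.val_eq_one_iff, ez]
    refine RatFunc.algebraMap_ne_zero (mul_ne_zero Polynomial.X_ne_zero ?_)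
    intro h
    simp [h] at hg0
  have ne {x : v.integer} (hx : v x = 1) : (x : F) ≠ 0 := fun h => by simp [h] at hx
  have self {x y : Fˣ} (h : S.rep (φ x) (φ y)) :
      S.Absorbs (evenSubgroup φ v) (φ x) (φ y) :=
    ⟨1, Subgroup.one_mem _, 1, Subgroup.one_mem _, by simpa using h⟩
  refine ⟨φ (Units.mk0 x (ne vx)), φ (Units.mk0 y (ne vy)), φ (Units.mk0 z (ne vz)), ?_,
    self ?_, self ?_, fun h => ?_⟩
  · rw [← coe_mem_realSet]
    exact hφ.notMem_core_of_residue hA.index hA.neg hv vy fun a => hρ.not_sq nsy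
  · rw [hφ.rep]
    exact ⟨1, s, by simp [hy]⟩
  · rw [hφ.rep]
    exact ⟨1, 1 + s, by simp [hz]⟩
  · obtain ⟨a, b, ha, hb, h⟩ := hφ.residue_of_absorbs hA.index hA.neg hv vx vz
      (fun a => hρ.not_sq (by rwa [hx])) h
    lift a to v.integer using ha
    lift b to v.integer using hb
    have := (hρ.ker (z - (a ^ 2 - x * b ^ 2))).2 (by simpa using h)
    rw [map_sub ρ, sub_eq_zero, ez, map_sub, map_pow ρ, map_mul ρ, map_pow ρ, hx] at this
    exact RatFunc.not_norm_of_simple_root hε hg0 _ _ this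

end QuadData.Realizes

open IsDedekindDomain

lemma exists_isFractionRing.{u} (B : Type u) [CommRing B] [IsDomain B] :
    ∃ (E : Type u) (_ : Field E) (_ : Algebra B E), IsFractionRing B E :=
  ⟨FractionRing B, inferInstance, inferInstance, inferInstance⟩

section Gauss

variable {R k' κ : Type*} [CommRing R] [IsDedekindDomain R] [Field k'] [Algebra R k']
  [IsFractionRing R k'] (q : HeightOneSpectrum R)

omit [IsDedekindDomain R] in
lemma mem_map_C_iff_map_eq_zero [Field κ] {π : R →+* κ} (hker : ∀ x, π x = 0 ↔ x ∈ q.asIdeal)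
    {f : Polynomial R} : f ∈ q.asIdeal.map Polynomial.C ↔ f.map π = 0 := by
  rw [Ideal.mem_map_C_iff, Polynomial.ext_iff]
  simp [hker]

omit [IsDedekindDomain R] in
lemma C_mem_map_C_iff {a : R} : Polynomial.C a ∈ q.asIdeal.map Polynomial.C ↔ a ∈ q.asIdeal := by
  rw [Ideal.mem_map_C_iff]
  refine ⟨fun h => by simpa using h 0, fun h n => ?_⟩
  rw [Polynomial.coeff_C]
  split_ifs
  exacts [h, zero_mem _]

variable {B : Type*} [CommRing B] [IsDomain B] [Algebra (Polynomial R) B]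
  {P : Ideal (Polynomial R)} [P.IsPrime] [IsLocalization.AtPrime B P]

omit [IsDomain B] in
lemma maximalIdeal_gauss [IsLocalRing B] (hP : P = q.asIdeal.map Polynomial.C) {ϖ : R}
    (hϖ : q.intValuation ϖ = WithZero.exp (-1 : ℤ)) :
    IsLocalRing.maximalIdeal B = Ideal.span {algebraMap (Polynomial R) B (Polynomial.C ϖ)} := by
  have ϖ0 : ϖ ≠ 0 := by
    rintro rfl
    exact WithZero.exp_ne_zero (hϖ.symm.trans (map_zero _))
  apply le_antisymm
  · rw [← IsLocalization.AtPrime.map_eq_maximalIdeal P B, Ideal.map_le_iff_le_comap, hP, Ideal.map_le_iff_le_comap]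
    intro a ha
    rw [Ideal.mem_comap, Ideal.mem_comap, Ideal.mem_span_singleton]
    have hv : q.valuation (FractionRing R) (algebraMap R (FractionRing R) a / algebraMap R (FractionRing R) ϖ) ≤ 1 := by
      rw [map_div₀, HeightOneSpectrum.valuation_of_algebraMap,
        HeightOneSpectrum.valuation_of_algebraMap, hϖ]
      refine div_le_one_of_le₀ ?_ zero_le
      have := (q.intValuation_le_pow_iff_mem a 1).2 (by simpa using ha)
      simpa using this
    obtain ⟨n, ⟨d, hd⟩, hnd⟩ := q.exists_primeCompl_mul_eq_of_integer _ hv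
    have hϖ' : algebraMap R (FractionRing R) ϖ ≠ 0 := by simpa using ϖ0
    have e : a * d = ϖ * n := by
      apply IsFractionRing.injective R (FractionRing R)
      rw [map_mul, map_mul, ← hnd]
      field_simp
    have hu : IsUnit (algebraMap (Polynomial R) B (Polynomial.C d)) := by
      refine IsLocalization.map_units B (⟨Polynomial.C d, fun h => hd ?_⟩ : P.primeCompl)
      exact (C_mem_map_C_iff q).1 (hP ▸ h)
    rw [← hu.dvd_mul_right]
    exact ⟨algebraMap _ B (Polynomial.C n), by simp only [← map_mul, e]⟩
  · rw [Ideal.span_singleton_le_iff_mem]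
    refine (IsLocalization.AtPrime.to_map_mem_maximal_iff B P _).2 ?_
    rw [hP, C_mem_map_C_iff, ← q.intValuation_lt_one_iff_mem, hϖ,
      ← WithZero.exp_zero, WithZero.exp_lt_exp]
    norm_num

lemma isDiscreteValuationRing_gauss (hP : P = q.asIdeal.map Polynomial.C)
    (inj : Function.Injective (algebraMap (Polynomial R) B)) : IsDiscreteValuationRing B := by
  have hN : IsNoetherianRing B := IsLocalization.isNoetherianRing P.primeCompl B inferInstance
  have hl : IsLocalRing B := IsLocalization.AtPrime.isLocalRing B P
  obtain ⟨ϖ, hϖ⟩ := q.intValuation_exists_uniformizer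
  have ϖ0 : ϖ ≠ 0 := by
    rintro rfl
    exact WithZero.exp_ne_zero (hϖ.symm.trans (map_zero _))
  have hspan := maximalIdeal_gauss (B := B) q hP hϖ
  have hPID : IsPrincipalIdealRing B := by
    refine ((tfae_of_isNoetherianRing_of_isLocalRing_of_isDomain B).out 0 4).2 ?_
    rw [hspan]
    infer_instance
  refine { not_a_field' := ?_ }
  rw [hspan, Ne, Ideal.span_singleton_eq_bot, map_eq_zero_iff _ inj, Polynomial.C_eq_zero]
  exact ϖ0


variable (k') in
theorem exists_gauss_valuation_of_isFractionRing {E : Type*} [Field E] [Algebra B E]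
    [IsFractionRing B E] [IsDiscreteValuationRing B] [Field κ]
    {π : R →+* κ} (hπ : Function.Surjective π) (hker : ∀ x, π x = 0 ↔ x ∈ q.asIdeal)
    (hP : P = q.asIdeal.map Polynomial.C)
    (inj : Function.Injective (algebraMap (Polynomial R) B)) :
    ∃ (i : k' →+* E) (X : E) (v : Valuation E (WithZero (Multiplicative ℤ))) (ρ : v.integer →+* RatFunc κ),
      IsResidueMap v ρ ∧ (∀ r, ∃ x, ρ x = RatFunc.C (π r) ∧ (x : E) = i (algebraMap R k' r)) ∧
      (∃ x, ρ x = RatFunc.X ∧ (x : E) = X) ∧ (∀ ϖ, q.intValuation ϖ = WithZero.exp (-1 : ℤ) →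
        v (i (algebraMap R k' ϖ)) = WithZero.exp (-1 : ℤ)) ∧
      ∀ f : Polynomial k', f ≠ 0 → f.eval₂ i X ≠ 0 := by
  have memP {f : Polynomial R} : f ∈ P ↔ f.map π = 0 := by
    rw [hP, mem_map_C_iff_map_eq_zero q hker]
  let ψ : R →+* B := (algebraMap (Polynomial R) B).comp Polynomial.C
  have injψ : Function.Injective ψ := inj.comp Polynomial.C_injective
  let w := IsDiscreteValuationRing.maximalIdeal B
  let v := w.valuation E
  have injE : Function.Injective (algebraMap B E) := IsFractionRing.injective B E
  have injEψ : Function.Injective ((algebraMap B E).comp ψ) := by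
    rw [RingHom.coe_comp]
    exact injE.comp injψ
  let i : k' →+* E := IsFractionRing.lift injEψ
  have hi (r : R) : i (algebraMap R k' r) = algebraMap B E (ψ r) :=
    IsFractionRing.lift_algebraMap injEψ r
  -- the residue map
  let g : Polynomial R →+* RatFunc κ :=
    (algebraMap (Polynomial κ) (RatFunc κ)).comp (Polynomial.mapRingHom π)
  have hg {f : Polynomial R} : g f = 0 ↔ f ∈ P := by
    rw [memP]
    exact map_eq_zero_iff _ (RatFunc.algebraMap_injective κ)
  have hgu (y : P.primeCompl) : IsUnit (g y) := (Ne.isUnit fun h => y.2 (hg.1 h))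
  let ρ0 : B →+* RatFunc κ := IsLocalization.lift hgu
  have hρ0 (f : Polynomial R) : ρ0 (algebraMap _ B f) = g f := IsLocalization.lift_eq hgu f
  have hρk (b : B) : ρ0 b = 0 ↔ b ∈ IsLocalRing.maximalIdeal B := by
    obtain ⟨f, s, rfl⟩ := IsLocalization.exists_mk'_eq P.primeCompl b
    rw [IsLocalization.AtPrime.mk'_mem_maximal_iff B P f s, ← hg]
    change IsLocalization.lift hgu _ = 0 ↔ _
    rw [IsLocalization.lift_mk'_spec hgu]
    simp
  have hρs : Function.Surjective ρ0 := by
    intro r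
    obtain ⟨n, hn⟩ := Polynomial.map_surjective π hπ r.num
    obtain ⟨d, hd⟩ := Polynomial.map_surjective π hπ r.denom
    have hdP : d ∈ P.primeCompl := by
      intro h
      exact r.denom_ne_zero (hd ▸ memP.1 h)
    refine ⟨IsLocalization.mk' B n ⟨d, hdP⟩, ?_⟩
    change IsLocalization.lift hgu _ = _
    rw [IsLocalization.lift_mk'_spec hgu]
    have hd0 : algebraMap (Polynomial κ) (RatFunc κ) r.denom ≠ 0 :=
      RatFunc.algebraMap_ne_zero r.denom_ne_zero
    simp only [g, RingHom.comp_apply, Polynomial.coe_mapRingHom, hn, hd]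
    rw [mul_comm, ← div_eq_iff hd0, r.num_div_denom]
  let j : B →+* v.integer := (algebraMap B E).codRestrict v.integer fun b => w.valuation_le_one b
  have hj (b : B) : (j b : E) = algebraMap B E b := rfl
  have hjb : Function.Bijective j := by
    constructor
    · intro a b h
      exact injE (congrArg Subtype.val h)
    · rintro ⟨x, hx⟩
      obtain ⟨n, ⟨d, hd⟩, h⟩ := w.exists_primeCompl_mul_eq_of_integer x hx
      have hu : IsUnit d := by
        by_contra hu
        exact hd ((IsLocalRing.mem_maximalIdeal d).2 hu)
      obtain ⟨d, rfl⟩ := hu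
      refine ⟨n * ((d⁻¹ : Bˣ) : B), Subtype.ext ?_⟩
      rw [hj, map_mul, ← h, mul_assoc, ← map_mul, Units.mul_inv, map_one, mul_one]
  let e : B ≃+* v.integer := RingEquiv.ofBijective j hjb
  have hv (b : B) : v (algebraMap B E b) < 1 ↔ b ∈ IsLocalRing.maximalIdeal B :=
    w.valuation_lt_one_iff_mem b
  have he (b : B) : (ρ0.comp e.symm.toRingHom) (j b) = ρ0 b :=
    congrArg ρ0 (e.symm_apply_apply b)
  refine ⟨i, algebraMap B E (algebraMap (Polynomial R) B Polynomial.X), v,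
    ρ0.comp e.symm.toRingHom, ⟨hρs.comp e.symm.surjective, fun x => ?_⟩,
    fun r => ⟨j (ψ r), ?_, (hi r).symm⟩,
    ⟨j (algebraMap (Polynomial R) B Polynomial.X), ?_, rfl⟩, fun ϖ hϖ => ?_, fun f hf h => ?_⟩
  · obtain ⟨b, rfl⟩ := hjb.2 x
    rw [he, hρk, hj, hv]
  · rw [he]
    simp [ψ, hρ0, g, RatFunc.algebraMap_C]
  · rw [he]
    simp [hρ0, g]
  · rw [hi, HeightOneSpectrum.valuation_of_algebraMap]
    have ϖ0 : ϖ ≠ 0 := by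
      rintro rfl
      exact WithZero.exp_ne_zero (hϖ.symm.trans (map_zero _))
    have ψϖ0 : ψ ϖ ≠ 0 := fun h => ϖ0 (injψ (by rw [h, map_zero]))
    exact w.intValuation_singleton ψϖ0 (maximalIdeal_gauss (B := B) q hP hϖ)
  · obtain ⟨b, hb, hbf⟩ := IsLocalization.integerNormalization_spec (nonZeroDivisors R) f
    set F := IsLocalization.integerNormalization (nonZeroDivisors R) f
    have hF : F ≠ 0 := by
      rwa [Ne, IsLocalization.integerNormalization_eq_zero_iff le_rfl]
    have e1 : (F.map (algebraMap R k')).eval₂ i (algebraMap B E (algebraMap (Polynomial R) B Polynomial.X)) =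
        algebraMap B E (algebraMap _ B F) := by
      rw [Polynomial.eval₂_map]
      have : i.comp (algebraMap R k') = ((algebraMap B E).comp (algebraMap _ B)).comp
        Polynomial.C := RingHom.ext hi
      rw [this, ← RingHom.comp_apply, ← Polynomial.hom_eval₂, Polynomial.eval₂_C_X, RingHom.comp_apply]
    rw [hbf, Algebra.smul_def, Polynomial.eval₂_mul, h, mul_zero] at e1
    exact hF (inj (injE (by rw [← e1, map_zero, map_zero])))

variable (k') in
/-- The Gauss extension of the valuation of a height one prime to the rational functions. -/
theorem exists_gauss_valuation [Field κ]
    {π : R →+* κ} (hπ : Function.Surjective π) (hker : ∀ x, π x = 0 ↔ x ∈ q.asIdeal) :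
    ∃ (E : Type u_1) (_ : Field E) (i : k' →+* E) (X : E)
      (v : Valuation E (WithZero (Multiplicative ℤ))) (ρ : v.integer →+* RatFunc κ),
      IsResidueMap v ρ ∧ (∀ r, ∃ x, ρ x = RatFunc.C (π r) ∧ (x : E) = i (algebraMap R k' r)) ∧
      (∃ x, ρ x = RatFunc.X ∧ (x : E) = X) ∧ (∀ ϖ, q.intValuation ϖ = WithZero.exp (-1 : ℤ) →
        v (i (algebraMap R k' ϖ)) = WithZero.exp (-1 : ℤ)) ∧
      ∀ f : Polynomial k', f ≠ 0 → f.eval₂ i X ≠ 0 := by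
  have hP : (q.asIdeal.map Polynomial.C).IsPrime := by
    have := q.isPrime
    exact Ideal.isPrime_map_C_of_isPrime
  have hle := (q.asIdeal.map Polynomial.C).primeCompl_le_nonZeroDivisors
  have : IsDomain (Localization.AtPrime (q.asIdeal.map (Polynomial.C (R := R)))) :=
    IsLocalization.isDomain_localization hle
  have inj := IsLocalization.injective (Localization.AtPrime (q.asIdeal.map (Polynomial.C (R := R)))) hle
  have := isDiscreteValuationRing_gauss q rfl inj
  obtain ⟨E, _, _, _⟩ :
      ∃ (E : Type u_1) (_ : Field E) (_ : Algebra (Localization.AtPrime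
        (q.asIdeal.map (Polynomial.C (R := R)))) E), IsFractionRing (Localization.AtPrime
        (q.asIdeal.map (Polynomial.C (R := R)))) E :=
    exists_isFractionRing _
  exact ⟨E, inferInstance, exists_gauss_valuation_of_isFractionRing k' q hπ hker rfl inj⟩

end Gauss

section Approximation

open IsDedekindDomain

variable {k k' E : Type*} [Field k] [Field k'] [Field E] (i₀ : k →+* k') (θ : k') (i : k' →+* E)
  {X : E} {v : Valuation E (WithZero (Multiplicative ℤ))} {l : ℕ}

lemma exists_val_eval₂_le (h : Polynomial k') :
    ∃ M, ∀ y, v y ≤ 1 → v (h.eval₂ i y) ≤ M := by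
  induction h using Polynomial.induction_on' with
  | add p q hp hq =>
    obtain ⟨M, hM⟩ := hp
    obtain ⟨N, hN⟩ := hq
    refine ⟨max M N, fun y hy => ?_⟩
    rw [Polynomial.eval₂_add]
    exact (v.map_add _ _).trans (max_le_max (hM y hy) (hN y hy))
  | monomial n c =>
    refine ⟨v (i c), fun y hy => ?_⟩
    rw [Polynomial.eval₂_monomial, map_mul, map_pow]
    exact mul_le_of_le_one_right' (pow_le_one₀ zero_le hy)

lemma exists_val_eval₂_sub_le (hX : v X ≤ 1) (hl : v l ≤ 1) (f : Polynomial k) :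
    ∃ M, ∀ j : ℕ, v (f.eval₂ (i.comp i₀) (i θ + (l : E) ^ j * X) - i (f.eval₂ i₀ θ) -
      i (f.derivative.eval₂ i₀ θ) * ((l : E) ^ j * X)) ≤ v l ^ (2 * j) * M := by
  set h := Polynomial.taylor θ (f.map i₀) with hh
  obtain ⟨M, hM⟩ := exists_val_eval₂_le (v := v) i h.divX.divX
  refine ⟨M, fun j => ?_⟩
  have hy : v ((l : E) ^ j * X) ≤ 1 := by
    rw [map_mul, map_pow]
    exact mul_le_one' (pow_le_one₀ zero_le hl) hX
  set y := (l : E) ^ j * X with hyd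
  have e1 : f.eval₂ (i.comp i₀) (i θ + y) = h.eval₂ i y := by
    rw [hh, Polynomial.taylor_apply, Polynomial.eval₂_comp, ← Polynomial.eval₂_map]
    simp [add_comm]
  have e2 : h.eval₂ i y = h.divX.divX.eval₂ i y * y ^ 2 + i (h.coeff 1) * y + i (h.coeff 0) := by
    conv_lhs => rw [← h.divX_mul_X_add, ← h.divX.divX_mul_X_add]
    simp only [Polynomial.eval₂_add, Polynomial.eval₂_mul, Polynomial.eval₂_X,
      Polynomial.eval₂_C, Polynomial.coeff_divX]
    ring
  have c0 : h.coeff 0 = f.eval₂ i₀ θ := by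
    rw [hh, Polynomial.taylor_coeff_zero, Polynomial.eval_map]
  have c1 : h.coeff 1 = f.derivative.eval₂ i₀ θ := by
    rw [hh, Polynomial.taylor_coeff_one, Polynomial.derivative_map, Polynomial.eval_map]
  rw [e1, e2, c0, c1]
  have e3 : h.divX.divX.eval₂ i y * y ^ 2 + i (f.derivative.eval₂ i₀ θ) * y + i (f.eval₂ i₀ θ) -
      i (f.eval₂ i₀ θ) - i (f.derivative.eval₂ i₀ θ) * y = (l : E) ^ (2 * j) *
        (X ^ 2 * h.divX.divX.eval₂ i y) := by
    rw [hyd]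
    ring
  rw [e3, map_mul, map_pow, map_mul, map_pow]
  gcongr
  exact (mul_le_of_le_one_left' (pow_le_one₀ zero_le hX)).trans (hM y hy)

lemma exists_val_eval₂_sub_le' (hX : v X ≤ 1) (hl : v l ≤ 1) (f : Polynomial k) :
    ∃ M, ∀ j : ℕ, v (f.eval₂ (i.comp i₀) (i θ + (l : E) ^ j * X) - i (f.eval₂ i₀ θ)) ≤
      v l ^ j * M := by
  obtain ⟨M, hM⟩ := exists_val_eval₂_sub_le i₀ θ i hX hl f
  refine ⟨max M (v (i (f.derivative.eval₂ i₀ θ))), fun j => ?_⟩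
  rw [← sub_add_cancel (f.eval₂ (i.comp i₀) (i θ + (l : E) ^ j * X) - i (f.eval₂ i₀ θ))
    (i (f.derivative.eval₂ i₀ θ) * ((l : E) ^ j * X))]
  refine (v.map_add _ _).trans (max_le ((hM j).trans ?_) ?_)
  · rw [two_mul, pow_add, mul_assoc]
    gcongr
    exact (mul_le_of_le_one_left' (pow_le_one₀ zero_le hl)).trans (le_max_left _ _)
  · rw [map_mul, map_mul, map_pow, mul_comm, mul_assoc]
    gcongr
    exact (mul_le_of_le_one_left' hX).trans (le_max_right _ _)

lemma eventually_pow_mul_lt {Γ : Type*} [LinearOrderedCommGroupWithZero Γ] [MulArchimedean Γ]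
    {a : Γ} (ha : a < 1) (M : Γ) {ε : Γ} (hε : ε ≠ 0) :
    ∀ᶠ j : ℕ in Filter.atTop, a ^ j * M < ε := by
  rcases eq_or_ne M 0 with rfl | hM
  · simp [zero_lt_iff.2 hε]
  obtain ⟨N, hN⟩ := exists_pow_lt₀ ha (Units.mk0 (ε / M) (div_ne_zero hε hM))
  rw [Units.val_mk0, lt_div_iff₀ (zero_lt_iff.2 hM)] at hN
  filter_upwards [Filter.eventually_ge_atTop N] with j hj
  refine lt_of_le_of_lt ?_ hN
  gcongr 1
  exact pow_le_pow_right_of_le_one' ha.le hj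

lemma eventually_val_eval₂_sub_lt (hX : v X ≤ 1) (hl : v l < 1) (f : Polynomial k)
    {ε : WithZero (Multiplicative ℤ)} (hε : ε ≠ 0) :
    ∀ᶠ j : ℕ in Filter.atTop,
      v (f.eval₂ (i.comp i₀) (i θ + (l : E) ^ j * X) - i (f.eval₂ i₀ θ)) < ε := by
  obtain ⟨M, hM⟩ := exists_val_eval₂_sub_le' i₀ θ i hX hl.le f
  filter_upwards [eventually_pow_mul_lt hl M hε] with j hj
  exact (hM j).trans_lt hj

lemma eventually_val_eval₂_eq (hX : v X ≤ 1) (hl : v l < 1) {f : Polynomial k}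
    (hf : f.eval₂ i₀ θ ≠ 0) :
    ∀ᶠ j : ℕ in Filter.atTop,
      v (f.eval₂ (i.comp i₀) (i θ + (l : E) ^ j * X)) = v (i (f.eval₂ i₀ θ)) := by
  filter_upwards [eventually_val_eval₂_sub_lt i₀ θ i hX hl f
    (ε := v (i (f.eval₂ i₀ θ))) (by simpa using hf)] with j hj
  exact Valuation.map_eq_of_sub_lt v hj

lemma eval₂_comp_ne_zero (hX : ∀ f : Polynomial k', f ≠ 0 → f.eval₂ i X ≠ 0) {c : k'} (hc : c ≠ 0)
    {f : Polynomial k} (hf : f ≠ 0) : f.eval₂ (i.comp i₀) (i θ + i c * X) ≠ 0 := by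
  have h0 : (f.map i₀).comp (Polynomial.C θ + Polynomial.C c * Polynomial.X) ≠ 0 := by
    rw [Ne, Polynomial.comp_eq_zero_iff, not_or]
    refine ⟨(Polynomial.map_ne_zero_iff i₀.injective).2 hf, fun h => hc ?_⟩
    have := congrArg (fun p => p.coeff 1) h.2
    simpa [Polynomial.coeff_C] using this
  have := hX _ h0
  rwa [Polynomial.eval₂_comp, Polynomial.eval₂_map, Polynomial.eval₂_add, Polynomial.eval₂_mul,
    Polynomial.eval₂_C, Polynomial.eval₂_C, Polynomial.eval₂_X] at this

/-- A subring of the valuation ring surjects onto a residue field of rational functions as soon as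
it is closed under inverses and hits the constants and the variable. -/
lemma surjective_of_inv {A κ : Type*} [Ring A] [Field κ] (ρ : A →+* RatFunc κ)
    (inv : ∀ x, ρ x ≠ 0 → ∃ y, ρ y = (ρ x)⁻¹) (const : ∀ c, ∃ x, ρ x = RatFunc.C c)
    (var : ∃ x, ρ x = RatFunc.X) : Function.Surjective ρ := by
  have poly (p : Polynomial κ) : ∃ x, ρ x = algebraMap _ (RatFunc κ) p := by
    induction p using Polynomial.induction_on' with
    | add p q hp hq =>
      obtain ⟨x, hx⟩ := hp
      obtain ⟨y, hy⟩ := hq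
      exact ⟨x + y, by rw [map_add, hx, hy, map_add]⟩
    | monomial n c =>
      obtain ⟨x, hx⟩ := const c
      obtain ⟨y, hy⟩ := var
      refine ⟨x * y ^ n, ?_⟩
      rw [map_mul, map_pow, hx, hy, ← Polynomial.C_mul_X_pow_eq_monomial, map_mul, map_pow,
        RatFunc.algebraMap_C, RatFunc.algebraMap_X]
  intro r
  obtain ⟨x, hx⟩ := poly r.num
  obtain ⟨y, hy⟩ := poly r.denom
  obtain ⟨z, hz⟩ := inv y (by rw [hy]; exact RatFunc.algebraMap_ne_zero r.denom_ne_zero)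
  refine ⟨x * z, ?_⟩
  rw [map_mul, hx, hz, hy, ← div_eq_mul_inv, r.num_div_denom]

lemma IsResidueMap.comap {F E Γ κ : Type*} [Field F] [Field E] [LinearOrderedCommGroupWithZero Γ]
    [Field κ] {v : Valuation E Γ} {ρ : v.integer →+* RatFunc κ} (h : IsResidueMap v ρ)
    (σ : F →+* E) (const : ∀ c, ∃ x : F, ∃ y : v.integer, v (σ x - y) < 1 ∧ ρ y = RatFunc.C c)
    (var : ∃ x : F, ∃ y : v.integer, v (σ x - y) < 1 ∧ ρ y = RatFunc.X) :
    ∃ ρ' : (v.comap σ).integer →+* RatFunc κ, IsResidueMap (v.comap σ) ρ' := by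
  let τ : (v.comap σ).integer →+* v.integer :=
    (σ.comp (v.comap σ).integer.subtype).codRestrict v.integer fun x => x.2
  have hτ (x : (v.comap σ).integer) : (τ x : E) = σ x := rfl
  have lift {x : F} {y : v.integer} (hxy : v (σ x - y) < 1) :
      ∃ z : (v.comap σ).integer, ρ (τ z) = ρ y := by
    have hx : v (σ x) ≤ 1 := by
      rw [← sub_add_cancel (σ x) y]
      exact v.map_add_le hxy.le y.2
    refine ⟨⟨x, hx⟩, ?_⟩
    rw [← sub_eq_zero, ← map_sub, h.ker]
    exact hxy
  refine ⟨ρ.comp τ, surjective_of_inv _ (fun x hx => ?_) (fun c => ?_) ?_, fun x => ?_⟩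
  · have hx1 : v (σ x) = 1 := h.val_eq_one_iff.2 hx
    have hx0 : (x : F) ≠ 0 := by
      rintro h0
      simp [h0] at hx1
    refine ⟨⟨(x : F)⁻¹, ?_⟩, ?_⟩
    · change v (σ (x : F)⁻¹) ≤ 1
      rw [map_inv₀, map_inv₀, hx1, inv_one]
    · refine eq_inv_of_mul_eq_one_left ?_
      rw [← map_mul, ← map_one (ρ.comp τ)]
      congr 1
      exact Subtype.ext (inv_mul_cancel₀ hx0)
  · obtain ⟨x, y, hxy, hy⟩ := const c
    obtain ⟨z, hz⟩ := lift hxy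
    exact ⟨z, hz.trans hy⟩
  · obtain ⟨x, y, hxy, hy⟩ := var
    obtain ⟨z, hz⟩ := lift hxy
    exact ⟨z, hz.trans hy⟩
  · exact h.ker _

lemma val_eq_valuation {R : Type*} [CommRing R] [IsDedekindDomain R] [Algebra R k'] [IsFractionRing R k']
    (q : HeightOneSpectrum R) {v : Valuation k' (WithZero (Multiplicative ℤ))}
    (h1 : ∀ r, r ∉ q.asIdeal → v (algebraMap R k' r) = 1)
    (h2 : ∀ ϖ, q.intValuation ϖ = WithZero.exp (-1 : ℤ) →
      v (algebraMap R k' ϖ) = WithZero.exp (-1 : ℤ)) (x : k') : v x = q.valuation k' x := by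
  rcases eq_or_ne x 0 with rfl | hx
  · rw [map_zero, map_zero]
  obtain ⟨ϖ, hϖ⟩ := q.intValuation_exists_uniformizer
  have hq : q.valuation k' (algebraMap R k' ϖ) = WithZero.exp (-1 : ℤ) := by
    rw [HeightOneSpectrum.valuation_of_algebraMap, hϖ]
  have hv := h2 ϖ hϖ
  have hϖ0 : algebraMap R k' ϖ ≠ 0 := fun h => WithZero.exp_ne_zero (by rw [← hv, h, map_zero])
  set p := algebraMap R k' ϖ
  obtain ⟨n, hn⟩ : ∃ n : ℤ, q.valuation k' x = q.valuation k' (p ^ n) := by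
    refine ⟨-WithZero.log (q.valuation k' x), ?_⟩
    rw [map_zpow₀, hq, ← WithZero.exp_zsmul, smul_eq_mul, mul_neg_one, neg_neg,
      WithZero.exp_log (by simpa using hx)]
  have hpn : p ^ n ≠ 0 := zpow_ne_zero _ hϖ0
  have hu : q.valuation k' (x / p ^ n) = 1 := by
    rw [map_div₀, hn, div_self ((map_ne_zero _).2 hpn)]
  obtain ⟨a, ⟨d, hd⟩, had⟩ := q.exists_primeCompl_mul_eq_of_integer _ hu.le
  have hd' : d ∉ q.asIdeal := hd
  have ha : a ∉ q.asIdeal := by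
    rw [← HeightOneSpectrum.valuation_eq_one_iff_notMem (K := k'), ← had, map_mul, hu, one_mul,
      HeightOneSpectrum.valuation_eq_one_iff_notMem]
    exact hd'
  have hvu : v (x / p ^ n) = 1 := by
    have := congrArg v had
    rwa [map_mul, h1 d hd', h1 a ha, mul_one] at this
  rw [map_div₀, div_eq_one_iff_eq ((map_ne_zero _).2 hpn)] at hvu
  rw [hvu, hn, map_zpow₀, map_zpow₀, hq, hv]

/-- Valuations of `k(t)`, with a rational function field over a finite field as residue field,
that approach the composite of evaluation at `θ` with the valuation of a prime of `k'`. -/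
theorem exists_approx_valuations {R κ : Type*} [CommRing R] [IsDedekindDomain R] [Algebra R k']
    [IsFractionRing R k'] (q : HeightOneSpectrum R) [Field κ] [Finite κ] {π : R →+* κ}
    (hπ : Function.Surjective π) (hker : ∀ x, π x = 0 ↔ x ∈ q.asIdeal)
    (hsurj : ∀ x, ∃ f : Polynomial k, f.eval₂ i₀ θ = x) {P : Polynomial k}
    (hP : P.eval₂ i₀ θ = 0) (hP' : P.derivative.eval₂ i₀ θ = 1)
    {l : ℕ} (hl : (l : R) ∈ q.asIdeal) (hl0 : (l : k') ≠ 0) :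
    ∃ v : ℕ → Valuation (RatFunc k) (WithZero (Multiplicative ℤ)),
      (∀ᶠ j in Filter.atTop, ∃ ρ : (v j).integer →+* RatFunc κ, IsResidueMap (v j) ρ) ∧
      (∀ f : Polynomial k, f.eval₂ i₀ θ ≠ 0 → ∀ᶠ j in Filter.atTop,
        v j (algebraMap (Polynomial k) (RatFunc k) f) = q.valuation k' (f.eval₂ i₀ θ)) ∧
      ∀ j c, v j (RatFunc.C c) = q.valuation k' (i₀ c) := by
  obtain ⟨E, _, i, X, v, ρ, hρ, hconst, ⟨X', hX', hXX⟩, hϖ, htr⟩ :=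
    exists_gauss_valuation k' q hπ hker
  have hvX : v X ≤ 1 := hXX ▸ X'.2
  have hvR (r : R) : v (i (algebraMap R k' r)) < 1 ↔ r ∈ q.asIdeal := by
    obtain ⟨x, hx, hxr⟩ := hconst r
    rw [← hxr, ← hker, ← hρ.ker, hx, map_eq_zero]
  have hvR1 (r : R) (hr : r ∉ q.asIdeal) : v (i (algebraMap R k' r)) = 1 := by
    obtain ⟨x, hx, hxr⟩ := hconst r
    rw [← hxr]
    refine hρ.val_eq_one_iff.2 ?_
    rwa [hx, Ne, map_eq_zero, hker]
  have hvi : ∀ x, v (i x) = q.valuation k' x :=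
    val_eq_valuation (v := v.comap i) q hvR1 hϖ
  have hlE : i (l : k') = l := map_natCast i l
  have hlE0 : (l : E) ≠ 0 := by
    rw [← hlE]
    exact (map_ne_zero i).2 hl0
  have hvl : v l < 1 := by
    have := (hvR l).2 hl
    simpa using this
  have hl0' : (l : k) ≠ 0 := by
    intro h
    apply hl0
    rw [← map_natCast i₀, h, map_zero]
  have hinj (j : ℕ) : Function.Injective
      (Polynomial.eval₂RingHom (i.comp i₀) (i θ + (l : E) ^ j * X)) := by
    rw [injective_iff_map_eq_zero]
    intro f hf
    by_contra hf0
    refine eval₂_comp_ne_zero i₀ θ i htr (pow_ne_zero j hl0) hf0 ?_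
    rw [map_pow, hlE]
    exact hf
  let σ (j : ℕ) : RatFunc k →+* E := IsFractionRing.lift (hinj j)
  have hσ (j : ℕ) (f : Polynomial k) : σ j (algebraMap _ (RatFunc k) f) =
      f.eval₂ (i.comp i₀) (i θ + (l : E) ^ j * X) := IsFractionRing.lift_algebraMap (hinj j) f
  refine ⟨fun j => v.comap (σ j), ?_, fun f hf => ?_, fun j c => ?_⟩
  · have h1 (c : κ) : ∀ᶠ j in Filter.atTop,
        ∃ x : RatFunc k, ∃ y : v.integer, v (σ j x - y) < 1 ∧ ρ y = RatFunc.C c := by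
      obtain ⟨r, rfl⟩ := hπ c
      obtain ⟨x, hx, hxr⟩ := hconst r
      obtain ⟨f, hf⟩ := hsurj (algebraMap R k' r)
      filter_upwards [eventually_val_eval₂_sub_lt i₀ θ i hvX hvl f one_ne_zero] with j hj
      exact ⟨algebraMap _ _ f, x, by rwa [hσ, hxr, ← hf], hx⟩
    have h2 : ∀ᶠ j in Filter.atTop,
        ∃ x : RatFunc k, ∃ y : v.integer, v (σ j x - y) < 1 ∧ ρ y = RatFunc.X := by
      obtain ⟨M, hM⟩ := exists_val_eval₂_sub_le i₀ θ i hvX hvl.le P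
      filter_upwards [eventually_pow_mul_lt hvl M one_ne_zero] with j hj
      refine ⟨algebraMap _ _ P / (l : RatFunc k) ^ j, X', ?_, hX'⟩
      have hMj := hM j
      rw [hP, hP', map_zero, sub_zero, map_one, one_mul, ← hσ] at hMj
      have hlj : (l : E) ^ j ≠ 0 := pow_ne_zero j hlE0
      have hvlj : 0 < v l ^ j := zero_lt_iff.2 (pow_ne_zero j (by simpa using hlE0))
      have e : σ j (algebraMap _ _ P / (l : RatFunc k) ^ j) - X' =
          (σ j (algebraMap _ _ P) - (l : E) ^ j * X) / (l : E) ^ j := by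
        rw [map_div₀, map_pow, map_natCast, hXX]
        field_simp
      rw [e, map_div₀, map_pow, div_lt_iff₀ hvlj, one_mul]
      refine hMj.trans_lt ?_
      rw [two_mul, pow_add, mul_assoc]
      exact mul_lt_of_lt_one_right hvlj hj
    filter_upwards [Filter.eventually_all.2 h1, h2] with j hj1 hj2
    exact hρ.comap (σ j) hj1 hj2
  · filter_upwards [eventually_val_eval₂_eq i₀ θ i hvX hvl hf] with j hj
    rw [Valuation.comap_apply, hσ, hj, hvi]
  · rw [← RatFunc.algebraMap_C, Valuation.comap_apply, hσ, Polynomial.eval₂_C, RingHom.comp_apply,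
      hvi]

end Approximation

section Primes

open IsDedekindDomain

variable {R : Type*} [CommRing R] [IsDedekindDomain R]

lemma exists_sub_mem_sq {p q : HeightOneSpectrum R} (hpq : p ≠ q) (y z : R) :
    ∃ x, x - y ∈ p.asIdeal ^ 2 ∧ x - z ∈ q.asIdeal ^ 2 := by
  have := p.isMaximal
  have := q.isMaximal
  have h : IsCoprime p.asIdeal q.asIdeal :=
    Ideal.isCoprime_of_isMaximal fun h => hpq (HeightOneSpectrum.ext h)
  obtain ⟨a, ha, b, hb, hab⟩ := Ideal.isCoprime_iff_exists.1 (h.pow (m := 2) (n := 2))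
  refine ⟨y * b + z * a, ?_, ?_⟩
  · rw [show y * b + z * a - y = (z - y) * a by linear_combination y * hab]
    exact Ideal.mul_mem_left _ _ ha
  · rw [show y * b + z * a - z = (y - z) * b by linear_combination z * hab]
    exact Ideal.mul_mem_left _ _ hb

lemma intValuation_eq_of_sub_mem_sq {p : HeightOneSpectrum R} {x y : R}
    (h : x - y ∈ p.asIdeal ^ 2) (hy : p.intValuation y = WithZero.exp (-1 : ℤ)) :
    p.intValuation x = WithZero.exp (-1 : ℤ) := by
  rw [← hy]
  refine Valuation.map_eq_of_sub_lt _ ?_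
  refine ((p.intValuation_le_pow_iff_mem _ _).2 h).trans_lt ?_
  rw [hy, WithZero.exp_lt_exp]
  norm_num

variable {k : Type*} [Field k] [NumberField k]

lemma exists_heightOneSpectrum_natCast_mem {l : ℕ} (hl : l.Prime) :
    ∃ q : HeightOneSpectrum (NumberField.RingOfIntegers k),
      (l : NumberField.RingOfIntegers k) ∈ q.asIdeal := by
  have hp : Prime (l : ℤ) := Nat.prime_iff_prime_int.1 hl
  have : (Ideal.span {(l : ℤ)}).IsMaximal :=
    PrincipalIdealRing.isMaximal_of_irreducible hp.irreducible
  obtain ⟨Q, hQ, hlies⟩ := Ideal.exists_maximal_ideal_liesOver_of_isIntegral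
    (S := NumberField.RingOfIntegers k) (Ideal.span {(l : ℤ)})
  have hmem : (l : NumberField.RingOfIntegers k) ∈ Q := by
    have : (l : ℤ) ∈ Ideal.span {(l : ℤ)} := Ideal.mem_span_singleton_self _
    rw [hlies.over, Ideal.mem_comap] at this
    simpa using this
  refine ⟨⟨Q, hQ.isPrime, ?_⟩, hmem⟩
  rintro rfl
  rw [Ideal.mem_bot, Nat.cast_eq_zero] at hmem
  exact hl.ne_zero hmem

variable (k) in
lemma exists_two_three :
    ∃ p q : HeightOneSpectrum (NumberField.RingOfIntegers k),
      2 ∈ p.asIdeal ∧ 2 ∉ q.asIdeal := by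
  obtain ⟨p, hp⟩ := exists_heightOneSpectrum_natCast_mem (k := k) Nat.prime_two
  obtain ⟨q, hq⟩ := exists_heightOneSpectrum_natCast_mem (k := k) Nat.prime_three
  refine ⟨p, q, by simpa using hp, fun h => q.isPrime.ne_top ?_⟩
  rw [Ideal.eq_top_iff_one]
  convert Ideal.sub_mem _ hq h
  norm_num

lemma not_isSquare_of_valuation {Γ : Type*} [Field Γ]
    {v : Valuation Γ (WithZero (Multiplicative ℤ))} {x : Γ} (h : v x = WithZero.exp (-1 : ℤ)) :
    ¬ IsSquare x := by
  rintro ⟨y, rfl⟩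
  refine not_isSquare_exp_neg_one ⟨v y, ?_⟩
  rw [← h, map_mul]

variable (k) in
lemma exists_nonsquares : ∃ x : k, ¬ IsSquare x ∧ ¬ IsSquare (-x) ∧ ¬ IsSquare (1 - x) ∧
    ¬ IsSquare (-(x * (1 - x))) := by
  obtain ⟨p, q, hp, hq⟩ := exists_two_three k
  have hpq : p ≠ q := by
    rintro rfl
    exact hq hp
  obtain ⟨π, hπ⟩ := p.intValuation_exists_uniformizer
  obtain ⟨ϖ, hϖ⟩ := q.intValuation_exists_uniformizer
  obtain ⟨x, hx, hx'⟩ := exists_sub_mem_sq hpq π (1 - ϖ)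
  have h1 := intValuation_eq_of_sub_mem_sq hx hπ
  have h2 : q.intValuation (1 - x) = WithZero.exp (-1 : ℤ) := by
    refine intValuation_eq_of_sub_mem_sq ?_ hϖ
    rw [← neg_mem_iff]
    convert hx' using 1
    ring
  have hp1 : p.valuation k (algebraMap _ k x) = WithZero.exp (-1 : ℤ) := by
    rw [HeightOneSpectrum.valuation_of_algebraMap, h1]
  have hq1 : q.valuation k (1 - algebraMap _ k x) = WithZero.exp (-1 : ℤ) := by
    rw [← map_one (algebraMap (NumberField.RingOfIntegers k) k), ← map_sub,
      HeightOneSpectrum.valuation_of_algebraMap, h2]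
  refine ⟨algebraMap _ k x, not_isSquare_of_valuation hp1,
    not_isSquare_of_valuation (v := p.valuation k) (by rwa [Valuation.map_neg]),
    not_isSquare_of_valuation hq1, not_isSquare_of_valuation (v := p.valuation k) ?_⟩
  rw [Valuation.map_neg, map_mul, hp1, Valuation.map_one_sub_of_lt, mul_one]
  rw [hp1, ← WithZero.exp_zero, WithZero.exp_lt_exp]
  norm_num

end Primes

namespace QuadData.Realizes

open IsDedekindDomain

variable {G : Type*} [CommGroup G] {S : QuadData G} {k k' : Type*} [Field k]
  {φ : (RatFunc k)ˣ →* G} (hφ : S.Realizes φ) [Field k'] [NumberField k']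

include hφ

/-- Subgroups attached to valuations approximating the composite of evaluation at `θ` with a
prime of `k'`. -/
lemma exists_approx {i₀ : k →+* k'} {θ : k'}
    (hsurj : ∀ x, ∃ f : Polynomial k, f.eval₂ i₀ θ = x) {P : Polynomial k}
    (hP : P.eval₂ i₀ θ = 0) (hP' : P.derivative.eval₂ i₀ θ = 1)
    (q : HeightOneSpectrum (NumberField.RingOfIntegers k')) :
    ∃ v : ℕ → Valuation (RatFunc k) (WithZero (Multiplicative ℤ)),
      (∀ f : Polynomial k, f.eval₂ i₀ θ ≠ 0 → ∀ᶠ j in Filter.atTop,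
        v j (algebraMap (Polynomial k) (RatFunc k) f) = q.valuation k' (f.eval₂ i₀ θ)) ∧
      (∀ j c, v j (RatFunc.C c) = q.valuation k' (i₀ c)) ∧
      (∀ᶠ j in Filter.atTop, S.Admissible (evenSubgroup φ (v j))) ∧
      (2 ∈ q.asIdeal → ∀ᶠ j in Filter.atTop, evenSubgroup φ (v j) ∈ S.EvenType) ∧
      (2 ∉ q.asIdeal → ∀ᶠ j in Filter.atTop, evenSubgroup φ (v j) ∈ S.OddType) := by
  have := q.isMaximal
  let _ : Field (NumberField.RingOfIntegers k' ⧸ q.asIdeal) := Ideal.Quotient.field _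
  have : Finite (NumberField.RingOfIntegers k' ⧸ q.asIdeal) :=
    Ideal.finiteQuotientOfFreeOfNeBot _ q.ne_bot
  obtain ⟨l, hl, hlq⟩ := exists_rat_prime (q.valuation k') (by
    obtain ⟨ϖ, hϖ⟩ := q.valuation_exists_uniformizer k'
    refine ⟨ϖ, fun h => WithZero.exp_ne_zero (by rw [← hϖ, h, map_zero]), ?_⟩
    rw [hϖ, ← WithZero.exp_zero, Ne, WithZero.exp_inj]
    norm_num)
  have hlq' : (l : NumberField.RingOfIntegers k') ∈ q.asIdeal := by
    rw [← q.valuation_lt_one_iff_mem (K := k')]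
    simpa using hlq
  obtain ⟨v, hv, hf, hc⟩ := exists_approx_valuations i₀ θ q (Ideal.Quotient.mk_surjective (I := q.asIdeal))
    (fun x => Ideal.Quotient.eq_zero_iff_mem) hsurj hP hP' hlq' (by exact_mod_cast hl.ne_zero)
  have huni : ∀ᶠ j in Filter.atTop, ∃ ϖ, v j ϖ = WithZero.exp (-1 : ℤ) := by
    obtain ⟨ϖ, hϖ⟩ := q.valuation_exists_uniformizer k'
    obtain ⟨f, rfl⟩ := hsurj ϖ
    filter_upwards [hf f fun h => WithZero.exp_ne_zero (by rw [← hϖ, h, map_zero])] with j hj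
    exact ⟨_, hj.trans hϖ⟩
  have h2 : ((2 : NumberField.RingOfIntegers k' ⧸ q.asIdeal) = 0) ↔ 2 ∈ q.asIdeal := by
    rw [← Ideal.Quotient.eq_zero_iff_mem, map_ofNat]
  refine ⟨v, hf, hc, ?_, fun h => ?_, fun h => ?_⟩ <;>
    filter_upwards [hv, huni] with j ⟨ρ, hρ⟩ ⟨ϖ, hϖ⟩
  · exact hφ.admissible_of_residue hρ hϖ
  · exact hφ.evenType_of_residue hρ hϖ (h2.2 h)
  · exact hφ.oddType_of_residue hρ hϖ fun h' => h (h2.1 h')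

end QuadData.Realizes

section

open IsDedekindDomain

variable {k : Type*} [Field k] (P : HeightOneSpectrum (Polynomial k)) {f : Polynomial k}

lemma valuation_algebraMap_lt_one_iff :
    P.valuation (RatFunc k) (algebraMap (Polynomial k) (RatFunc k) f) < 1 ↔ f ∈ P.asIdeal :=
  P.valuation_lt_one_iff_mem f

lemma valuation_algebraMap_eq_one_iff :
    P.valuation (RatFunc k) (algebraMap (Polynomial k) (RatFunc k) f) = 1 ↔ f ∉ P.asIdeal :=
  P.valuation_eq_one_iff_notMem

end

open IsDedekindDomain in
/-- Elements integral at a prime of `k[t]` as quotients of polynomials. -/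
lemma exists_eq_div_of_valuation_le_one {k : Type*} [Field k]
    (P : HeightOneSpectrum (Polynomial k)) {x : RatFunc k} (hx : P.valuation (RatFunc k) x ≤ 1) :
    ∃ n d : Polynomial k, d ∉ P.asIdeal ∧
      x * algebraMap (Polynomial k) (RatFunc k) d = algebraMap (Polynomial k) (RatFunc k) n := by
  obtain ⟨n, ⟨d, hd⟩, h⟩ := P.exists_primeCompl_mul_eq_of_integer x hx
  exact ⟨n, d, hd, h⟩

namespace QuadData.Realizes

open IsDedekindDomain

variable {G : Type*} [CommGroup G] {S : QuadData G} {k k' : Type*} [Field k] [Field k']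
  {φ : (RatFunc k)ˣ →* G} (hφ : S.Realizes φ) {i₀ : k →+* k'} {θ : k'}
  {P : HeightOneSpectrum (Polynomial k)} (hev : ∀ f, f.eval₂ i₀ θ = 0 ↔ f ∈ P.asIdeal)
  {v : ℕ → Valuation (RatFunc k) (WithZero (Multiplicative ℤ))} {W : k' → WithZero (Multiplicative ℤ)}
  (hv : ∀ f : Polynomial k, f.eval₂ i₀ θ ≠ 0 → ∀ᶠ j in Filter.atTop,
        v j (algebraMap (Polynomial k) (RatFunc k) f) = W (f.eval₂ i₀ θ))

include hφ hev

include hv in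
lemma eventually_mem_evenSubgroup {x : RatFunc k}
    (hx : x ∈ realSet φ (S.core (evenSubgroup φ (P.valuation (RatFunc k))))) :
    ∀ᶠ j in Filter.atTop, x ∈ realSet φ (evenSubgroup φ (v j)) := by
  set w := P.valuation (RatFunc k)
  obtain ⟨ϖ, hϖ⟩ := P.valuation_exists_uniformizer (RatFunc k)
  obtain ⟨m, y, hm, hy, rfl⟩ := hφ.core_subset (hφ.index_evenSubgroup hϖ)
    hφ.neg_mem_evenSubgroup (fun _ => hφ.mem_evenSubgroup_of_eq_one) hx
  obtain ⟨n, d, hd, hnd⟩ := exists_eq_div_of_valuation_le_one P hm.le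
  have hn : n ∈ P.asIdeal := by
    rw [← valuation_algebraMap_lt_one_iff, ← hnd, map_mul,
      (valuation_algebraMap_eq_one_iff P).2 hd, mul_one]
    exact hm
  have hd0 : d.eval₂ i₀ θ ≠ 0 := fun h => hd ((hev d).1 h)
  have hdn : (d - n).eval₂ i₀ θ = d.eval₂ i₀ θ := by
    rw [Polynomial.eval₂_sub, (hev n).2 hn, sub_zero]
  have hda : algebraMap (Polynomial k) (RatFunc k) d ≠ 0 :=
    RatFunc.algebraMap_ne_zero fun h => hd0 (by rw [h, Polynomial.eval₂_zero])
  filter_upwards [hv d hd0, hv (d - n) (by rwa [hdn])] with j h1 h2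
  have h3 : v j (1 - m) = 1 := by
    rw [map_sub, ← hnd, ← one_sub_mul, map_mul, hdn, ← h1] at h2
    exact mul_eq_right₀ ((map_ne_zero _).2 hda) |>.1 h2
  rw [hφ.mem_realSet_evenSubgroup]
  refine ⟨mul_ne_zero (fun h => ?_) (pow_ne_zero 2 hy), v j y, ?_⟩
  · rw [h, map_zero] at h3
    exact zero_ne_one h3
  · rw [map_mul, h3, one_mul, map_pow, sq]

include hv in
lemma approx_evenSubgroup (hsurj : ∀ x, ∃ f : Polynomial k, f.eval₂ i₀ θ = x)
    (hW : ∃ ϖ, ϖ ≠ 0 ∧ W ϖ = WithZero.exp (-1 : ℤ)) {T : Set (Subgroup G)}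
    (hT : ∀ᶠ j in Filter.atTop, evenSubgroup φ (v j) ∈ T) :
    S.Approx (evenSubgroup φ (P.valuation (RatFunc k))) T := by
  obtain ⟨ϖ, hϖ0, hϖ⟩ := hW
  obtain ⟨f, rfl⟩ := hsurj ϖ
  have hf : algebraMap (Polynomial k) (RatFunc k) f ≠ 0 :=
    RatFunc.algebraMap_ne_zero fun h => hϖ0 (by rw [h, Polynomial.eval₂_zero])
  refine ⟨φ (Units.mk0 _ hf), fun E hE => ?_⟩
  have h1 : ∀ x ∈ E, ∀ᶠ j in Filter.atTop, x ∈ evenSubgroup φ (v j) := by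
    intro x hx
    obtain ⟨u, rfl⟩ := hφ.surj x
    filter_upwards [hφ.eventually_mem_evenSubgroup hev hv (coe_mem_realSet.2 (hE _ hx))] with j hj
    exact coe_mem_realSet.1 hj
  obtain ⟨j, hj1, hj2, hj3⟩ :=
    (((Filter.eventually_all_finset E).2 h1).and (hT.and (hv f hϖ0))).exists
  refine ⟨_, hj2, hj1, fun h => ?_⟩
  rw [hφ.mem_evenSubgroup, Units.val_mk0, hj3, hϖ] at h
  exact not_isSquare_exp_neg_one h

omit hφ in
lemma not_val_sub_sq_lt_one {g : Polynomial k} (hg : ¬ IsSquare (g.eval₂ i₀ θ)) {x : RatFunc k}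
    (hg' : algebraMap (Polynomial k) (RatFunc k) g = x)
    {a : RatFunc k} (ha : P.valuation (RatFunc k) a ≤ 1) :
    ¬ P.valuation (RatFunc k) (x - a ^ 2) < 1 := by
  intro h
  obtain ⟨n, d, hd, hnd⟩ := exists_eq_div_of_valuation_le_one P ha
  have h1 : g * d ^ 2 - n ^ 2 ∈ P.asIdeal := by
    rw [← valuation_algebraMap_lt_one_iff, map_sub, map_mul, map_pow, map_pow, ← hnd,
      hg', mul_pow, ← sub_mul, map_mul, map_pow, (valuation_algebraMap_eq_one_iff P).2 hd, one_pow,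
      mul_one]
    exact h
  have hd0 : d.eval₂ i₀ θ ≠ 0 := fun h => hd ((hev d).1 h)
  have h2 := (hev _).2 h1
  simp only [Polynomial.eval₂_sub, Polynomial.eval₂_mul, Polynomial.eval₂_pow] at h2
  refine hg ⟨n.eval₂ i₀ θ / d.eval₂ i₀ θ, ?_⟩
  field_simp
  linear_combination h2

lemma admissible_evenSubgroup_of_eval [NumberField k']
    (hsurj : ∀ x, ∃ f : Polynomial k, f.eval₂ i₀ θ = x) :
    S.Admissible (evenSubgroup φ (P.valuation (RatFunc k))) := by
  obtain ⟨ϖ, hϖ⟩ := P.valuation_exists_uniformizer (RatFunc k)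
  obtain ⟨x, h1, h2, h3, h4⟩ := exists_nonsquares k'
  obtain ⟨f, rfl⟩ := hsurj x
  have key {g : Polynomial k} (hg : ¬ IsSquare (g.eval₂ i₀ θ)) :
      P.valuation (RatFunc k) (algebraMap (Polynomial k) (RatFunc k) g) = 1 := by
    refine (valuation_algebraMap_eq_one_iff P).2 fun h => hg ?_
    rw [(hev g).2 h]
    exact IsSquare.zero
  refine hφ.admissible_evenSubgroup hϖ (x := algebraMap _ _ f) (key h1) ?_ fun a ha =>
    ⟨not_val_sub_sq_lt_one hev h1 rfl ha,
      not_val_sub_sq_lt_one hev (g := -f) ?_ (by simp) ha,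
      not_val_sub_sq_lt_one hev (g := 1 - f) ?_ (by simp) ha,
      not_val_sub_sq_lt_one hev (g := -(f * (1 - f))) ?_ (by simp) ha⟩
  · have := key (g := 1 - f) (by simpa [Polynomial.eval₂_sub] using h3)
    simpa using this
  · simpa using h2
  · simpa [Polynomial.eval₂_sub] using h3
  · simpa [Polynomial.eval₂_sub, Polynomial.eval₂_mul] using h4

lemma mem_horizontal_of_eval [NumberField k']
    (hsurj : ∀ x, ∃ f : Polynomial k, f.eval₂ i₀ θ = x) {P₁ : Polynomial k}
    (hP : P₁.eval₂ i₀ θ = 0) (hP' : P₁.derivative.eval₂ i₀ θ = 1) :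
    evenSubgroup φ (P.valuation (RatFunc k)) ∈ S.Horizontal := by
  obtain ⟨p, q, hp, hq⟩ := exists_two_three k'
  have uni (p : HeightOneSpectrum (NumberField.RingOfIntegers k')) :
      ∃ ϖ, ϖ ≠ 0 ∧ p.valuation k' ϖ = WithZero.exp (-1 : ℤ) := by
    obtain ⟨ϖ, hϖ⟩ := p.valuation_exists_uniformizer k'
    exact ⟨ϖ, fun h => WithZero.exp_ne_zero (by rw [← hϖ, h, map_zero]), hϖ⟩
  obtain ⟨v, hv, -, -, hv', -⟩ := hφ.exists_approx hsurj hP hP' p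
  obtain ⟨w, hw, -, -, -, hw'⟩ := hφ.exists_approx hsurj hP hP' q
  exact ⟨hφ.admissible_evenSubgroup_of_eval hev hsurj,
    hφ.approx_evenSubgroup hev hv hsurj (uni p) (hv' hp),
    hφ.approx_evenSubgroup hev hw hsurj (uni q) (hw' hq)⟩

omit hev

lemma mem_horizontal [NumberField k] (P : HeightOneSpectrum (Polynomial k)) :
    evenSubgroup φ (P.valuation (RatFunc k)) ∈ S.Horizontal := by
  obtain ⟨p, hp⟩ := (IsPrincipalIdealRing.principal P.asIdeal).principal
  have hp' : P.asIdeal = Ideal.span {p} := hp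
  have hp0 : p ≠ 0 := by
    rintro rfl
    exact P.ne_bot (by simpa using hp')
  have hirr : Irreducible p := by
    refine Prime.irreducible ((Ideal.span_singleton_prime hp0).1 ?_)
    rw [← hp']
    exact P.isPrime
  have : Fact (Irreducible p) := ⟨hirr⟩
  have h1 : Module.Finite k (AdjoinRoot p) := (AdjoinRoot.powerBasis hp0).finite
  have h2 : CharZero (AdjoinRoot p) := charZero_of_injective_algebraMap
    (algebraMap k (AdjoinRoot p)).injective
  have h3 : NumberField (AdjoinRoot p) :=
    { to_finiteDimensional := Module.Finite.trans k (AdjoinRoot p) }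
  have ev (f : Polynomial k) : f.eval₂ (AdjoinRoot.of p) (AdjoinRoot.root p) = AdjoinRoot.mk p f := by
    have := AdjoinRoot.aeval_eq (f := p) f
    rwa [Polynomial.aeval_def] at this
  obtain ⟨a, b, hab⟩ := hirr.separable
  refine hφ.mem_horizontal_of_eval (i₀ := AdjoinRoot.of p) (θ := AdjoinRoot.root p)
    (P₁ := p * b) (fun f => ?_) (fun x => ?_) ?_ ?_
  · rw [ev, AdjoinRoot.mk_eq_zero, hp', Ideal.mem_span_singleton]
  · obtain ⟨f, rfl⟩ := AdjoinRoot.mk_surjective x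
    exact ⟨f, ev f⟩
  · rw [ev, map_mul, AdjoinRoot.mk_self, zero_mul]
  · rw [ev, Polynomial.derivative_mul, map_add, map_mul, map_mul, AdjoinRoot.mk_self, zero_mul,
      add_zero, ← map_mul, ← map_one (AdjoinRoot.mk p), ← hab, map_add, map_mul, map_mul,
      map_mul, AdjoinRoot.mk_self, mul_zero, zero_add, mul_comm]

end QuadData.Realizes

open IsDedekindDomain in
lemma exists_C_mul_sq_of_polynomial {k : Type*} [Field k] (n : ℕ) :
    ∀ f : Polynomial k, f.natDegree ≤ n → f ≠ 0 →
      (∀ P : HeightOneSpectrum (Polynomial k), IsSquare (P.intValuation f)) →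
      ∃ (c : k) (g : Polynomial k), f = Polynomial.C c * g ^ 2 := by
  induction n using Nat.strong_induction_on with | _ n ih => ?_
  intro f hfn hf0 hf
  by_cases h0 : f.natDegree = 0
  · refine ⟨f.coeff 0, 1, ?_⟩
    rw [one_pow, mul_one]
    exact Polynomial.eq_C_of_natDegree_eq_zero h0
  obtain ⟨p, hp, hpf⟩ := Polynomial.exists_irreducible_of_natDegree_ne_zero h0
  let P : HeightOneSpectrum (Polynomial k) := ⟨Ideal.span {p},
    (Ideal.span_singleton_prime hp.ne_zero).2 hp.prime, by simpa using hp.ne_zero⟩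
  have hlt : P.intValuation f < 1 := by
    rw [P.intValuation_lt_one_iff_mem]
    exact Ideal.mem_span_singleton.2 hpf
  have h2 : f ∈ P.asIdeal ^ 2 := by
    rw [← P.intValuation_le_pow_iff_mem]
    have hne : P.intValuation f ≠ 0 := P.intValuation_ne_zero f hf0
    have he := (isSquare_iff_even_log hne).1 (hf P)
    rw [← WithZero.exp_log hne, ← WithZero.exp_zero, WithZero.exp_lt_exp] at hlt
    rw [← WithZero.exp_log hne, WithZero.exp_le_exp]
    obtain ⟨r, hr⟩ := he
    push_cast
    lia
  rw [Ideal.span_singleton_pow, Ideal.mem_span_singleton] at h2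
  obtain ⟨g, rfl⟩ := h2
  have hg0 : g ≠ 0 := right_ne_zero_of_mul hf0
  have hdeg := Polynomial.natDegree_mul (pow_ne_zero 2 hp.ne_zero) hg0
  rw [Polynomial.natDegree_pow] at hdeg
  have hpd := hp.natDegree_pos
  obtain ⟨c, h, rfl⟩ := ih g.natDegree (by lia) g le_rfl hg0 fun Q => by
    have hQ := hf Q
    have hQp : Q.intValuation p ≠ 0 := Q.intValuation_ne_zero p hp.ne_zero
    rw [map_mul, map_pow] at hQ
    have := (IsSquare.sq (Q.intValuation p)).inv.mul hQ
    rwa [inv_mul_cancel_left₀ (pow_ne_zero 2 hQp)] at this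
  exact ⟨c, p * h, by ring⟩

open IsDedekindDomain in
lemma exists_C_mul_sq {k : Type*} [Field k] {x : RatFunc k} (hx0 : x ≠ 0)
    (hx : ∀ P : HeightOneSpectrum (Polynomial k), IsSquare (P.valuation (RatFunc k) x)) :
    ∃ (c : k) (y : RatFunc k), x = RatFunc.C c * y ^ 2 := by
  have hd0 : algebraMap (Polynomial k) (RatFunc k) x.denom ≠ 0 :=
    RatFunc.algebraMap_ne_zero x.denom_ne_zero
  have e : algebraMap (Polynomial k) (RatFunc k) (x.num * x.denom) =
      x * algebraMap (Polynomial k) (RatFunc k) x.denom ^ 2 := by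
    nth_rw 3 [← x.num_div_denom]
    rw [map_mul]
    field_simp
  obtain ⟨c, g, hg⟩ := exists_C_mul_sq_of_polynomial _ (x.num * x.denom) le_rfl
    (mul_ne_zero (RatFunc.num_ne_zero hx0) x.denom_ne_zero) fun P => by
      have h := P.valuation_of_algebraMap (K := RatFunc k) (x.num * x.denom)
      rw [← h]
      change IsSquare (P.valuation (RatFunc k) (algebraMap _ (RatFunc k) _))
      rw [e, map_mul, map_pow]
      exact (hx P).mul (IsSquare.sq _)
  refine ⟨c, algebraMap (Polynomial k) (RatFunc k) g / algebraMap (Polynomial k) (RatFunc k) x.denom, ?_⟩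
  rw [hg, map_mul, map_pow, RatFunc.algebraMap_C] at e
  field_simp
  exact e.symm

namespace QuadData.Realizes

variable {G : Type*} [CommGroup G] {S : QuadData G} {k : Type*} [Field k] [NumberField k]
  {φ : (RatFunc k)ˣ →* G} (hφ : S.Realizes φ)

include hφ

/-- The constants of `S` are the classes of the constants of `k(t)`. -/
theorem mem_const_iff {g : G} :
    g ∈ S.const ↔ ∃ c : kˣ, φ (Units.map (RatFunc.C (K := k)).toMonoidHom c) = g := by
  constructor
  · intro hg
    obtain ⟨u, rfl⟩ := hφ.surj g
    obtain ⟨c, y, hcy⟩ := exists_C_mul_sq u.ne_zero fun P =>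
      hφ.mem_evenSubgroup.1 (Subgroup.mem_sInf.1 hg _ (hφ.mem_horizontal P))
    have hc0 : c ≠ 0 := by
      rintro rfl
      exact u.ne_zero (by rw [hcy, map_zero, zero_mul])
    have hy0 : y ≠ 0 := by
      rintro rfl
      exact u.ne_zero (by rw [hcy, sq, mul_zero, mul_zero])
    refine ⟨Units.mk0 c hc0, ?_⟩
    have e : u = Units.map (RatFunc.C (K := k)).toMonoidHom (Units.mk0 c hc0) *
        (Units.mk0 y hy0 * Units.mk0 y hy0) := by
      ext
      simp [hcy, sq]
    rw [e, map_mul, (hφ.ker (Units.mk0 y hy0 * Units.mk0 y hy0)).2 ⟨_, rfl⟩, mul_one]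
  · rintro ⟨c, rfl⟩
    refine Subgroup.mem_sInf.2 fun U hU => ?_
    rw [← coe_mem_realSet]
    exact hφ.const_mem_of_horizontal hU c.ne_zero

end QuadData.Realizes

section ClassGroupModSquares

open IsDedekindDomain UniqueFactorizationMonoid

open scoped nonZeroDivisors

variable {R : Type*} [CommRing R] [IsDedekindDomain R]

open Classical in
/-- The multiplicity of a prime in a nonzero ideal. -/
def idealMult (q : HeightOneSpectrum R) (I : Ideal R) : ℕ := (normalizedFactors I).count q.asIdeal

lemma idealMult_mul (q : HeightOneSpectrum R) {I J : Ideal R} (hI : I ≠ 0) (hJ : J ≠ 0) :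
    idealMult q (I * J) = idealMult q I + idealMult q J := by
  rw [idealMult, normalizedFactors_mul hI hJ, Multiset.count_add]
  rfl

lemma primeProd_ne_zero (f : Multiset (HeightOneSpectrum R)) :
    (f.map HeightOneSpectrum.asIdeal).prod ≠ 0 := by
  refine Multiset.prod_ne_zero fun h => ?_
  obtain ⟨q, -, hq⟩ := Multiset.mem_map.1 h
  exact q.ne_bot hq

open Classical in
lemma idealMult_primeProd (q : HeightOneSpectrum R) (f : Multiset (HeightOneSpectrum R)) :
    idealMult q (f.map HeightOneSpectrum.asIdeal).prod = f.count q := by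
  rw [idealMult, normalizedFactors_prod_of_prime, Multiset.count_map_eq_count' _ _
    (fun a b h => HeightOneSpectrum.ext h)]
  intro p hp
  obtain ⟨q, -, rfl⟩ := Multiset.mem_map.1 hp
  exact q.prime

lemma exists_primeProd {I : Ideal R} (hI : I ≠ 0) :
    ∃ f : Multiset (HeightOneSpectrum R), (f.map HeightOneSpectrum.asIdeal).prod = I := by
  have : CanLift (Ideal R) (HeightOneSpectrum R) HeightOneSpectrum.asIdeal Prime :=
    ⟨fun p hp => ⟨⟨p, Ideal.isPrime_of_prime hp, hp.ne_zero⟩, rfl⟩⟩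
  obtain ⟨f, hf⟩ := CanLift.prf (β := Multiset (HeightOneSpectrum R)) (normalizedFactors I)
    (fun p hp => prime_of_normalized_factor p hp)
  exact ⟨f, by rw [hf, Ideal.prod_normalizedFactors_eq_self hI]⟩

open Classical in
lemma exists_eq_sq_of_even {I : Ideal R} (hI : I ≠ 0) (h : ∀ q, Even (idealMult q I)) :
    ∃ M : Ideal R, M ≠ 0 ∧ I = M ^ 2 := by
  obtain ⟨f, rfl⟩ := exists_primeProd hI
  simp only [idealMult_primeProd] at h
  refine ⟨∏ q ∈ f.toFinset, q.asIdeal ^ (f.count q / 2), ?_, ?_⟩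
  · exact Finset.prod_ne_zero_iff.2 fun q _ => pow_ne_zero _ q.ne_bot
  · rw [Finset.prod_multiset_map_count, ← Finset.prod_pow]
    refine Finset.prod_congr rfl fun q _ => ?_
    rw [← pow_mul, Nat.div_mul_cancel (h q).two_dvd]

/-- The class of a multiset of primes modulo squares. -/
def primeClass (f : Multiset (HeightOneSpectrum R)) :
    ClassGroup R ⧸ MonoidHom.range (powMonoidHom 2 : ClassGroup R →* ClassGroup R) :=
  QuotientGroup.mk (ClassGroup.mk0 ⟨(f.map HeightOneSpectrum.asIdeal).prod,
    mem_nonZeroDivisors_of_ne_zero (primeProd_ne_zero f)⟩)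

lemma primeClass_surjective : Function.Surjective (primeClass (R := R)) := by
  intro x
  obtain ⟨c, rfl⟩ := QuotientGroup.mk_surjective x
  obtain ⟨⟨I, hI⟩, rfl⟩ := ClassGroup.mk0_surjective c
  obtain ⟨f, rfl⟩ := exists_primeProd (nonZeroDivisors.ne_zero hI)
  exact ⟨f, rfl⟩

open Classical in
lemma primeClass_eq_iff_exists {f g : Multiset (HeightOneSpectrum R)} :
    primeClass f = primeClass g ↔
      ∃ z : R, z ≠ 0 ∧ ∀ q, Odd (f.count q + g.count q) ↔ Odd (idealMult q (Ideal.span {z})) := by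
  have hs {z : R} (hz : z ≠ 0) : Ideal.span {z} ≠ 0 := by simpa using hz
  set I := (f.map HeightOneSpectrum.asIdeal).prod with hI
  set J := (g.map HeightOneSpectrum.asIdeal).prod with hJ
  have hI0 : I ≠ 0 := primeProd_ne_zero f
  have hJ0 : J ≠ 0 := primeProd_ne_zero g
  have hm (q) : idealMult q (I * J) = f.count q + g.count q := by
    rw [idealMult_mul q hI0 hJ0, idealMult_primeProd, idealMult_primeProd]
  have h1 : primeClass f = primeClass g ↔ ∃ M : (Ideal R)⁰, ClassGroup.mk0 M ^ 2 =
      ClassGroup.mk0 (⟨I * J, mem_nonZeroDivisors_of_ne_zero (mul_ne_zero hI0 hJ0)⟩) := by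
    have h2 : ClassGroup.mk0 (⟨I * J, mem_nonZeroDivisors_of_ne_zero (mul_ne_zero hI0 hJ0)⟩) =
      ClassGroup.mk0 ⟨I, mem_nonZeroDivisors_of_ne_zero hI0⟩ *
        ClassGroup.mk0 ⟨J, mem_nonZeroDivisors_of_ne_zero hJ0⟩ := by
      rw [← map_mul]
      rfl
    rw [h2, primeClass, primeClass, QuotientGroup.eq]
    change _ ↔ ∃ M, _ = ClassGroup.mk0 ⟨(f.map HeightOneSpectrum.asIdeal).prod, _⟩ *
      ClassGroup.mk0 ⟨(g.map HeightOneSpectrum.asIdeal).prod, _⟩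
    generalize ClassGroup.mk0 ⟨(f.map HeightOneSpectrum.asIdeal).prod, _⟩ = x
    generalize ClassGroup.mk0 ⟨(g.map HeightOneSpectrum.asIdeal).prod, _⟩ = y
    constructor
    · rintro ⟨m, hm⟩
      obtain ⟨M, hM⟩ := ClassGroup.mk0_surjective (m * x)
      refine ⟨M, ?_⟩
      rw [hM, mul_pow, show m ^ 2 = x⁻¹ * y from hm, sq, mul_mul_mul_comm, inv_mul_cancel, one_mul,
        mul_comm]
    · rintro ⟨M, hM⟩
      refine ⟨ClassGroup.mk0 M * x⁻¹, ?_⟩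
      change (ClassGroup.mk0 M * x⁻¹) ^ 2 = _
      rw [mul_pow, hM, sq, mul_mul_mul_comm, mul_inv_cancel, one_mul, mul_comm]
  rw [h1]
  constructor
  · rintro ⟨⟨M, hM⟩, h⟩
    have hM0 := nonZeroDivisors.ne_zero hM
    rw [← map_pow, ClassGroup.mk0_eq_mk0_iff] at h
    obtain ⟨x, y, hx, hy, h⟩ := h
    refine ⟨x * y, mul_ne_zero hx hy, fun q => ?_⟩
    have h3 := congrArg (idealMult q) h
    simp only [SubmonoidClass.mk_pow] at h3
    rw [idealMult_mul q (hs hx) (pow_ne_zero _ hM0), idealMult_mul q (hs hy)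
      (mul_ne_zero hI0 hJ0), sq, idealMult_mul q hM0 hM0, hm] at h3
    rw [← Ideal.span_singleton_mul_span_singleton, idealMult_mul q (hs hx) (hs hy)]
    simp only [Nat.odd_iff]
    lia
  · rintro ⟨z, hz, h⟩
    obtain ⟨M, hM0, hM⟩ := exists_eq_sq_of_even (mul_ne_zero (hs hz) (mul_ne_zero hI0 hJ0))
      fun q => by
        rw [idealMult_mul q (hs hz) (mul_ne_zero hI0 hJ0), hm]
        have := h q
        simp only [Nat.odd_iff, Nat.even_iff] at this ⊢
        lia
    refine ⟨⟨M, mem_nonZeroDivisors_of_ne_zero hM0⟩, ?_⟩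
    rw [← map_pow, ClassGroup.mk0_eq_mk0_iff]
    refine ⟨1, z, one_ne_zero, hz, ?_⟩
    simp [hM]

variable {K : Type*} [Field K] [Algebra R K] [IsFractionRing R K]

lemma isSquare_valuation_iff (q : HeightOneSpectrum R) {z : R} (hz : z ≠ 0) :
    IsSquare (q.valuation K (algebraMap R K z)) ↔ ¬ Odd (idealMult q (Ideal.span {z})) := by
  classical
  have h : q.valuation K (algebraMap R K z) =
      WithZero.exp (-(idealMult q (Ideal.span {z}) : ℤ)) := by
    refine (q.valuation_of_algebraMap z).trans ?_
    rw [q.intValuation_if_neg hz, idealMult, Ideal.count_associates_factors_eq]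
    · simpa using hz
    · exact q.isPrime
    · exact q.ne_bot
  rw [h, isSquare_iff_even_log WithZero.exp_ne_zero, WithZero.log_exp, even_neg, Int.even_coe_nat,
    Nat.not_odd_iff_even]

open Classical in
lemma primeClass_eq_iff (K : Type*) [Field K] [Algebra R K] [IsFractionRing R K]
    {f g : Multiset (HeightOneSpectrum R)} : primeClass f = primeClass g ↔
      ∃ c : K, c ≠ 0 ∧ ∀ q, Odd (f.count q + g.count q) ↔ ¬ IsSquare (q.valuation K c) := by
  rw [primeClass_eq_iff_exists]
  have inj := IsFractionRing.injective R K
  constructor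
  · rintro ⟨z, hz, h⟩
    refine ⟨algebraMap R K z, by simpa using hz, fun q => ?_⟩
    rw [isSquare_valuation_iff q hz, not_not, h]
  · rintro ⟨c, hc, h⟩
    obtain ⟨x, y, hy, rfl⟩ := IsFractionRing.div_surjective (A := R) c
    have hy0 : y ≠ 0 := nonZeroDivisors.ne_zero hy
    have hx0 : x ≠ 0 := by rintro rfl; simp at hc
    refine ⟨x * y, mul_ne_zero hx0 hy0, fun q => ?_⟩
    rw [h, ← not_iff_not, not_not, ← isSquare_valuation_iff (K := K) q (mul_ne_zero hx0 hy0)]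
    have hv : q.valuation K (algebraMap R K y) ≠ 0 := (map_ne_zero _).2 (by simpa using hy0)
    have e : q.valuation K (algebraMap R K (x * y)) =
        q.valuation K (algebraMap R K x / algebraMap R K y) *
          (q.valuation K (algebraMap R K y) * q.valuation K (algebraMap R K y)) := by
      rw [map_mul, map_mul, map_div₀, ← mul_assoc, div_mul_cancel₀ _ hv]
    rw [e]
    refine ⟨fun h => h.mul ⟨_, rfl⟩, fun h => ?_⟩
    have := h.div (⟨q.valuation K (algebraMap R K y), rfl⟩ : IsSquare
      (q.valuation K (algebraMap R K y) * q.valuation K (algebraMap R K y)))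
    rwa [mul_div_cancel_right₀ _ (mul_ne_zero hv hv)] at this

end ClassGroupModSquares

namespace QuadData.Realizes

open IsDedekindDomain

variable {G : Type*} [CommGroup G] {S : QuadData G} {k : Type*} [Field k]
  {φ : (RatFunc k)ˣ →* G}

/-- The map induced on the units of the field of constants. -/
def onConst (φ : (RatFunc k)ˣ →* G) : kˣ →* G := φ.comp (Units.map (RatFunc.C (K := k)).toMonoidHom)

variable (hφ : S.Realizes φ)

include hφ

lemma onConst_eq_one_iff {c : kˣ} : onConst φ c = 1 ↔ ∃ y, c = y * y := by
  constructor
  · intro h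
    obtain ⟨y, hy⟩ := (hφ.ker _).1 h
    by_contra! hc
    refine RatFunc.not_isSquare_C (ε := (c : k)) ?_ ⟨y, congrArg Units.val hy⟩
    rintro ⟨z, hz⟩
    exact hc (Units.mk0 z fun h => c.ne_zero (by rw [hz, h, mul_zero])) (Units.ext hz)
  · rintro ⟨y, rfl⟩
    exact (hφ.ker _).2 ⟨Units.map (RatFunc.C (K := k)).toMonoidHom y, map_mul _ _ _⟩

lemma onConst_mem_evenSubgroup {v : Valuation k (WithZero (Multiplicative ℤ))} {c : kˣ} :
    onConst φ c ∈ evenSubgroup (onConst φ) v ↔ IsSquare (v c) := by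
  refine ⟨fun ⟨w, hw, h⟩ => ?_, fun h => ⟨c, rfl, h⟩⟩
  obtain ⟨y, hy⟩ := (hφ.onConst_eq_one_iff (c := c / w)).1 (by rw [map_div, hw, div_self'])
  obtain rfl : c = w * (y * y) := by rw [← hy, mul_div_cancel]
  simpa using h.mul ⟨v y, rfl⟩

variable [NumberField k]

omit hφ in
lemma exists_units_valuation_eq (q : HeightOneSpectrum (NumberField.RingOfIntegers k))
    {y : WithZero (Multiplicative ℤ)} (hy : y ≠ 0) : ∃ t : kˣ, q.valuation k t = y := by
  obtain ⟨ϖ, hϖ⟩ := q.valuation_exists_uniformizer k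
  have h0 : ϖ ≠ 0 := fun h => WithZero.exp_ne_zero (by rw [← hϖ, h, map_zero])
  refine ⟨Units.mk0 ϖ h0 ^ (-WithZero.log y), ?_⟩
  rw [Units.val_zpow_eq_zpow_val, map_zpow₀, Units.val_mk0, hϖ, ← WithZero.exp_zsmul]
  simp [WithZero.exp_log hy]

lemma mem_const_iff_onConst {g : G} : g ∈ S.const ↔ ∃ c, onConst φ c = g := hφ.mem_const_iff

lemma inf_const_eq {U : Subgroup G} {v : Valuation k (WithZero (Multiplicative ℤ))}
    (h : ∀ c, onConst φ c ∈ U ↔ IsSquare (v c)) : U ⊓ S.const = evenSubgroup (onConst φ) v := by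
  ext g
  rw [Subgroup.mem_inf, hφ.mem_const_iff_onConst]
  constructor
  · rintro ⟨hg, c, rfl⟩
    rwa [hφ.onConst_mem_evenSubgroup, ← h]
  · rintro ⟨c, rfl, hc⟩
    exact ⟨(h c).2 hc, c, rfl⟩

lemma exists_prime_of_admissible {U : Subgroup G} (hU : S.Admissible U) (hc : ¬ S.const ≤ U) :
    ∃ q : HeightOneSpectrum (NumberField.RingOfIntegers k),
      ∀ c, onConst φ c ∈ U ↔ IsSquare (q.valuation k c) := by
  obtain ⟨_, hgc, hg⟩ := SetLike.not_le_iff_exists.1 hc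
  obtain ⟨c, rfl⟩ := hφ.mem_const_iff_onConst.1 hgc
  obtain ⟨O, hO, -⟩ := hφ.exists_valuationSubring hU
  have hunit {u : kˣ} (hu : O.valuation.comap RatFunc.C (u : k) = 1) : onConst φ u ∈ U :=
    (coe_mem_realSet (u := Units.map (RatFunc.C (K := k)).toMonoidHom u)).1 (hO _ hu)
  obtain ⟨q, hq⟩ := exists_prime_isEquiv (O.valuation.comap RatFunc.C)
    ⟨c, c.ne_zero, fun h => hg (hunit h)⟩
  have heven {u : kˣ} (hu : IsSquare (q.valuation k u)) : onConst φ u ∈ U := by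
    obtain ⟨y, hy⟩ := hu
    have hy0 : y ≠ 0 := by
      rintro rfl
      exact (map_ne_zero (q.valuation k)).2 u.ne_zero (by rw [hy, mul_zero])
    obtain ⟨t, rfl⟩ := exists_units_valuation_eq q hy0
    rw [← div_mul_cancel u (t * t), map_mul, map_mul]
    refine U.mul_mem (hunit ?_) (Subgroup.mul_self_mem_of_index_two hU.index _)
    rw [hq.eq_one_iff_eq_one, Units.val_div_eq_div_val, map_div₀, hy, Units.val_mul, map_mul]
    exact div_self (mul_ne_zero hy0 hy0)
  obtain ⟨ϖ, hϖ⟩ := exists_units_valuation_eq q (WithZero.exp_ne_zero (a := (-1 : ℤ)))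
  have hodd {u : kˣ} (hu : ¬ IsSquare (q.valuation k u)) : onConst φ u * onConst φ ϖ ∈ U := by
    rw [← map_mul]
    refine heven ?_
    have hu0 : q.valuation k u ≠ 0 := (map_ne_zero _).2 u.ne_zero
    rw [isSquare_iff_even_log hu0] at hu
    rw [Units.val_mul, map_mul, hϖ, isSquare_iff_even_log (mul_ne_zero hu0 WithZero.exp_ne_zero),
      WithZero.log_mul hu0 WithZero.exp_ne_zero, WithZero.log_exp, Int.even_add]
    simp [hu]
  have hϖU : onConst φ ϖ ∉ U := fun h =>
    hg ((Subgroup.mul_mem_cancel_right U h).1 (hodd fun hs => hg (heven hs)))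
  refine ⟨q, fun u => ⟨fun hu => ?_, heven⟩⟩
  by_contra hs
  exact hϖU ((Subgroup.mul_mem_cancel_left U hu).1 (hodd hs))

lemma evenSubgroup_mem_traces (q : HeightOneSpectrum (NumberField.RingOfIntegers k)) :
    evenSubgroup (onConst φ) (q.valuation k) ∈ S.traces := by
  obtain ⟨v, -, hv, hA, -, -⟩ := hφ.exists_approx (i₀ := RingHom.id k) (θ := 0)
    (P := Polynomial.X) (fun x => ⟨Polynomial.C x, by simp⟩) (by simp) (by simp) q
  obtain ⟨j, hj⟩ := hA.exists
  have h (c : kˣ) : onConst φ c ∈ evenSubgroup φ (v j) ↔ IsSquare (q.valuation k c) := by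
    rw [← RingHom.id_apply (c : k), ← hv j]
    exact hφ.mem_evenSubgroup
  refine ⟨_, hj, fun hle => ?_, (hφ.inf_const_eq h).symm⟩
  obtain ⟨ϖ, hϖ⟩ := exists_units_valuation_eq q (WithZero.exp_ne_zero (a := (-1 : ℤ)))
  refine not_isSquare_exp_neg_one ?_
  rw [← hϖ, ← h]
  exact hle (hφ.mem_const_iff_onConst.2 ⟨ϖ, rfl⟩)

/-- The primes of the field of constants are in bijection with the traces. -/
lemma exists_equiv_traces :
    ∃ e : HeightOneSpectrum (NumberField.RingOfIntegers k) ≃ S.traces,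
      ∀ q c, onConst φ c ∈ (e q).1 ↔ IsSquare (q.valuation k c) := by
  refine ⟨Equiv.ofBijective (fun q => ⟨_, hφ.evenSubgroup_mem_traces q⟩) ⟨fun p q h => ?_, ?_⟩,
    fun q c => hφ.onConst_mem_evenSubgroup⟩
  · by_contra hpq
    have h' := congrArg Subtype.val h
    obtain ⟨π, hπ⟩ := p.intValuation_exists_uniformizer
    obtain ⟨x, hx, hx'⟩ := exists_sub_mem_sq hpq π 1
    have hp := (p.valuation_of_algebraMap (K := k) x).trans (intValuation_eq_of_sub_mem_sq hx hπ)
    have hq : q.valuation k (algebraMap _ k x) = 1 := by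
      refine q.valuation_eq_one_iff_notMem.2 fun hxq => q.isPrime.ne_top ?_
      rw [Ideal.eq_top_iff_one]
      have := Ideal.sub_mem _ hxq (Ideal.pow_le_self two_ne_zero hx')
      rwa [sub_sub_cancel] at this
    have hx0 : algebraMap _ k x ≠ 0 := fun h0 => by
      rw [h0, map_zero] at hq
      exact zero_ne_one hq
    have h1 : onConst φ (Units.mk0 _ hx0) ∈ evenSubgroup (onConst φ) (q.valuation k) := by
      rw [hφ.onConst_mem_evenSubgroup, Units.val_mk0, hq]
      exact ⟨1, (mul_one 1).symm⟩
    change evenSubgroup (onConst φ) (p.valuation k) = evenSubgroup (onConst φ) (q.valuation k) at h'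
    rw [← h', hφ.onConst_mem_evenSubgroup, Units.val_mk0] at h1
    refine not_isSquare_exp_neg_one ?_
    rw [← hp]
    exact h1
  · rintro ⟨_, U, hU, hc, rfl⟩
    obtain ⟨q, hq⟩ := hφ.exists_prime_of_admissible hU hc
    exact ⟨q, Subtype.ext (hφ.inf_const_eq hq).symm⟩

lemma classCard_eq : S.classCard = Nat.card (ClassGroup (NumberField.RingOfIntegers k) ⧸
    MonoidHom.range (powMonoidHom 2 : ClassGroup (NumberField.RingOfIntegers k) →*
      ClassGroup (NumberField.RingOfIntegers k))) := by
  classical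
  obtain ⟨e, he⟩ := hφ.exists_equiv_traces
  have key (f g : Multiset S.traces) : primeClass (f.map e.symm) = primeClass (g.map e.symm) ↔
      ∃ c ∈ S.const, ∀ D : S.traces, Odd (f.count D + g.count D) ↔ c ∉ D.1 := by
    have hcount (f : Multiset S.traces) (q) : (f.map e.symm).count q = f.count (e q) := by
      rw [← Multiset.count_map_eq_count' _ f e.symm.injective, e.symm_apply_apply]
    rw [primeClass_eq_iff k]
    constructor
    · rintro ⟨c, hc, h⟩
      refine ⟨onConst φ (Units.mk0 c hc), hφ.mem_const_iff_onConst.2 ⟨_, rfl⟩, fun D => ?_⟩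
      have h1 := h (e.symm D)
      rw [hcount, hcount, e.apply_symm_apply] at h1
      have h2 := he (e.symm D) (Units.mk0 c hc)
      rw [e.apply_symm_apply] at h2
      rw [h1, h2, Units.val_mk0]
    · rintro ⟨_, hc, h⟩
      obtain ⟨c, rfl⟩ := hφ.mem_const_iff_onConst.1 hc
      refine ⟨c, c.ne_zero, fun q => ?_⟩
      rw [hcount, hcount, ← he]
      exact h (e q)
  refine Nat.card_congr (Equiv.ofBijective (Quot.lift (fun f => primeClass (f.map e.symm))
    fun f g h => (key f g).2 (by convert h)) ⟨?_, fun x => ?_⟩)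
  · rintro ⟨f⟩ ⟨g⟩ h
    exact Quot.sound (by convert (key f g).1 h)
  · obtain ⟨f, rfl⟩ := primeClass_surjective x
    refine ⟨Quot.mk _ (f.map e), ?_⟩
    simp

end QuadData.Realizes

lemma sqCl_mul {K : Type*} [Field K] (u v : Kˣ) : sqCl (u * v) = sqCl u * sqCl v := rfl

lemma sqCl_surjective {K : Type*} [Field K] : Function.Surjective (sqCl (K := K)) :=
  QuotientGroup.mk_surjective

lemma sqCl_eq_one_iff {K : Type*} [Field K] {u : Kˣ} : sqCl u = 1 ↔ ∃ y, u = y * y := by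
  refine (QuotientGroup.eq_one_iff u).trans ⟨?_, ?_⟩
  · rintro ⟨y, rfl⟩
    exact ⟨y, sq y⟩
  · rintro ⟨y, rfl⟩
    exact ⟨y, sq y⟩

/-- The quadratic data of the square class group of a field. -/
def sqClData (K : Type*) [Field K] : QuadData (SqClass K) where
  neg := sqCl (-1)
  rep g h := ∃ u y : Kˣ, sqCl u = g ∧ sqCl y = h ∧ ∃ a b : K, (y : K) = a ^ 2 - u * b ^ 2

/-- Witt equivalences transport realisations. -/
lemma IsWittEquiv.realizes {K L : Type*} [Field K] [Field L] {α : SqClass K ≃* SqClass L}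
    (hα : IsWittEquiv α) :
    (sqClData K).Realizes (α.symm.toMonoidHom.comp (QuotientGroup.mk' (sqSubgroup L))) where
  surj g := by
    obtain ⟨u, hu⟩ := sqCl_surjective (α g)
    exact ⟨u, α.symm_apply_eq.2 hu⟩
  ker x := by
    rw [← sqCl_eq_one_iff]
    exact map_eq_one_iff _ α.symm.injective
  neg := α.symm_apply_eq.2 hα.map_neg_one.symm
  rep u y := by
    have key (u₀ y₀ : Kˣ) (hu : α (sqCl u₀) = sqCl u) (hy : α (sqCl y₀) = sqCl y) :
        (∃ a b : K, (y₀ : K) = a ^ 2 - u₀ * b ^ 2) ↔ ∃ a b : L, (y : L) = a ^ 2 - u * b ^ 2 := by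
      have h := hα.represents 1 (-1 * u₀) y₀ 1 (-1 * u) y (map_one α)
        (by rw [sqCl_mul, map_mul, hα.map_neg_one, hu, sqCl_mul]) hy
      simpa [sub_eq_add_neg] using h
    constructor
    · rintro ⟨u₀, y₀, hu, hy, h⟩
      exact (key u₀ y₀ (α.symm_apply_eq.1 hu.symm).symm (α.symm_apply_eq.1 hy.symm).symm).1 h
    · intro h
      obtain ⟨u₀, hu⟩ := sqCl_surjective (α.symm (sqCl u))
      obtain ⟨y₀, hy⟩ := sqCl_surjective (α.symm (sqCl y))
      exact ⟨u₀, y₀, hu, hy, (key u₀ y₀ (by rw [hu, α.apply_symm_apply])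
        (by rw [hy, α.apply_symm_apply])).2 h⟩

lemma IsWittEquiv.refl (K : Type*) [Field K] : IsWittEquiv (MulEquiv.refl (SqClass K)) where
  map_neg_one := rfl
  represents a b c a' b' c' ha hb hc := by
    have h (u v : Kˣ) (h : MulEquiv.refl (SqClass K) (sqCl u) = sqCl v) :
        ∃ t : Kˣ, (v : K) = u * t ^ 2 := by
      obtain ⟨t, ht⟩ := sqCl_eq_one_iff.1 (show sqCl (v / u) = 1 by
        change sqCl v / sqCl u = 1
        rw [div_eq_one]
        exact h.symm)
      refine ⟨t, ?_⟩
      rw [div_eq_iff_eq_mul] at ht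
      rw [ht]
      push_cast
      ring
    obtain ⟨r, hr⟩ := h a a' ha
    obtain ⟨s, hs⟩ := h b b' hb
    obtain ⟨t, ht⟩ := h c c' hc
    rw [hr, hs, ht]
    have r0 := r.ne_zero
    have s0 := s.ne_zero
    have t0 := t.ne_zero
    constructor
    · rintro ⟨x, y, hxy⟩
      refine ⟨t * x / r, t * y / s, ?_⟩
      rw [hxy]
      field_simp
    · rintro ⟨x, y, hxy⟩
      refine ⟨r * x / t, s * y / t, ?_⟩
      field_simp
      linear_combination hxy

lemma QuadData.Realizes.comp_ringEquiv {G : Type*} [CommGroup G] {S : QuadData G} {F F' : Type*}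
    [Field F] [Field F'] {φ : Fˣ →* G} (hφ : S.Realizes φ) (e : F ≃+* F') :
    S.Realizes (φ.comp (Units.map e.symm.toMonoidHom)) where
  surj g := by
    obtain ⟨u, rfl⟩ := hφ.surj g
    exact ⟨Units.map e.toMonoidHom u, congrArg φ (Units.ext (e.symm_apply_apply _))⟩
  ker x := by
    rw [MonoidHom.comp_apply, hφ.ker]
    constructor
    · rintro ⟨y, hy⟩
      refine ⟨Units.map e.toMonoidHom y, Units.ext ?_⟩
      have h : e.symm (x : F') = y * y := congrArg Units.val hy
      change (x : F') = e y * e y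
      rw [← map_mul, ← h, e.apply_symm_apply]
    · rintro ⟨y, rfl⟩
      exact ⟨_, map_mul _ _ _⟩
  neg := by
    rw [← hφ.neg]
    exact congrArg φ (Units.ext (by simp))
  rep u y := by
    rw [MonoidHom.comp_apply, MonoidHom.comp_apply, hφ.rep]
    constructor
    · rintro ⟨a, b, h⟩
      refine ⟨e a, e b, ?_⟩
      have h' := congrArg e h
      change e (e.symm y) = e (a ^ 2 - e.symm u * b ^ 2) at h'
      simpa using h'
    · rintro ⟨a, b, h⟩
      refine ⟨e.symm a, e.symm b, ?_⟩
      change e.symm y = _ - e.symm u * _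
      rw [h]
      simp

lemma RatFunc.exists_sq_sub_of_C {k : Type*} [Field k] [Infinite k] {u y : k} {f g : RatFunc k}
    (h : RatFunc.C y = f ^ 2 - RatFunc.C u * g ^ 2) : ∃ a b : k, y = a ^ 2 - u * b ^ 2 := by
  have hmul (f : RatFunc k) : f * algebraMap (Polynomial k) (RatFunc k) f.denom =
      algebraMap (Polynomial k) (RatFunc k) f.num :=
    ((div_eq_iff (RatFunc.algebraMap_ne_zero f.denom_ne_zero)).1 f.num_div_denom).symm
  have hf := hmul f
  have hg := hmul g
  have hp : Polynomial.C y * (f.denom * g.denom) ^ 2 =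
      (f.num * g.denom) ^ 2 - Polynomial.C u * (g.num * f.denom) ^ 2 := by
    apply RatFunc.algebraMap_injective k
    simp only [map_mul, map_sub, map_pow, RatFunc.algebraMap_C]
    rw [h, ← hf, ← hg]
    ring
  obtain ⟨t, ht⟩ : ∃ t, (f.denom * g.denom).eval t ≠ 0 := by
    by_contra! hc
    exact mul_ne_zero f.denom_ne_zero g.denom_ne_zero (Polynomial.funext (by simpa using hc))
  have hp' := congrArg (Polynomial.eval t) hp
  simp only [Polynomial.eval_mul, Polynomial.eval_sub, Polynomial.eval_pow,
    Polynomial.eval_C] at hp' ht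
  obtain ⟨h1, h2⟩ := mul_ne_zero_iff.1 ht
  refine ⟨f.num.eval t / f.denom.eval t, g.num.eval t / g.denom.eval t, ?_⟩
  field_simp
  linear_combination hp'

namespace QuadData.Realizes

variable {G : Type*} [CommGroup G] {S : QuadData G} {k l : Type*} [Field k] [Field l]
  {φ : (RatFunc k)ˣ →* G} {φ' : (RatFunc l)ˣ →* G}

/-- Binary value sets over the constants in terms of the quadratic data. -/
lemma exists_eq_add_iff_rep [Infinite k] (hφ : S.Realizes φ) (a b c : kˣ) :
    (∃ x y : k, (c : k) = a * x ^ 2 + b * y ^ 2) ↔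
      S.rep (S.neg * onConst φ b / onConst φ a) (onConst φ c / onConst φ a) := by
  have hneg : S.neg = onConst φ (-1) := by
    rw [← hφ.neg]
    exact congrArg φ (Units.ext (by simp))
  have ha := a.ne_zero
  rw [hneg, ← map_mul, ← map_div, ← map_div]
  refine Iff.trans ?_ (hφ.rep _ _).symm
  change _ ↔ ∃ f g : RatFunc k, RatFunc.C ((c / a : kˣ) : k) =
    f ^ 2 - RatFunc.C ((-1 * b / a : kˣ) : k) * g ^ 2
  constructor
  · rintro ⟨x, y, h⟩
    refine ⟨RatFunc.C x, RatFunc.C y, ?_⟩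
    rw [← map_pow, ← map_pow, ← map_mul, ← map_sub]
    congr 1
    push_cast
    rw [h]
    field_simp
    ring
  · rintro ⟨f, g, h⟩
    obtain ⟨x, y, hxy⟩ := RatFunc.exists_sq_sub_of_C h
    refine ⟨x, y, ?_⟩
    push_cast at hxy
    field_simp at hxy
    rw [hxy]
    ring

/-- Two realisations over rational function fields induce a Witt equivalence of constants. -/
lemma exists_wittEquiv [NumberField k] [NumberField l] (hφ : S.Realizes φ)
    (hφ' : S.Realizes φ') : ∃ β : SqClass k ≃* SqClass l, IsWittEquiv β ∧
      ∀ r s, β (sqCl r) = sqCl s ↔ onConst φ r = onConst φ' s := by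
  have hker : sqSubgroup k = (onConst φ).ker := by
    ext c
    rw [MonoidHom.mem_ker, hφ.onConst_eq_one_iff, ← sqCl_eq_one_iff]
    exact (QuotientGroup.eq_one_iff c).symm
  have hker' : sqSubgroup l = (onConst φ').ker := by
    ext c
    rw [MonoidHom.mem_ker, hφ'.onConst_eq_one_iff, ← sqCl_eq_one_iff]
    exact (QuotientGroup.eq_one_iff c).symm
  have hrange : (onConst φ).range = (onConst φ').range := by
    ext g
    exact hφ.mem_const_iff_onConst.symm.trans hφ'.mem_const_iff_onConst
  let γ := (QuotientGroup.quotientMulEquivOfEq hker).trans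
    (QuotientGroup.quotientKerEquivRange (onConst φ))
  let γ' := (QuotientGroup.quotientMulEquivOfEq hker').trans
    (QuotientGroup.quotientKerEquivRange (onConst φ'))
  let β : SqClass k ≃* SqClass l := (γ.trans (MulEquiv.subgroupCongr hrange)).trans γ'.symm
  have hβ (r : kˣ) (s : lˣ) : β (sqCl r) = sqCl s ↔ onConst φ r = onConst φ' s := by
    change γ'.symm _ = _ ↔ _
    rw [MulEquiv.symm_apply_eq, Subtype.ext_iff]
    rfl
  refine ⟨β, ⟨?_, fun a b c a' b' c' ha hb hc => ?_⟩, hβ⟩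
  · rw [hβ]
    have h : onConst φ (-1) = S.neg := by
      rw [← hφ.neg]
      exact congrArg φ (Units.ext (by simp))
    have h' : onConst φ' (-1) = S.neg := by
      rw [← hφ'.neg]
      exact congrArg φ' (Units.ext (by simp))
    rw [h, h']
  · rw [hβ] at ha hb hc
    rw [hφ.exists_eq_add_iff_rep, hφ'.exists_eq_add_iff_rep, ha, hb, hc]

end QuadData.Realizes

/-- Let `k, ℓ` be number fields such that `K = k_{a,b}` and `L = ℓ_{c,d}` are both purely
transcendental, and let `α` be a Witt equivalence from `K` to `L`.  Then `α` restricts to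
a Witt equivalence `β` from `k` to `ℓ`, and the `2`-ranks of the ideal class groups of
`k` and `ℓ` agree: `|Cl(k)/Cl(k)²| = |Cl(ℓ)/Cl(ℓ)²|`. -/
theorem wittEquiv_conic_purelyTranscendental_induced
    (k : Type*) [Field k] [NumberField k] (l : Type*) [Field l] [NumberField l]
    (a b : k) (ha : a ≠ 0) (hb : b ≠ 0) (c d : l) (hc : c ≠ 0) (hd : d ≠ 0)
    (K : Type*) [Field K] (ι : k →+* K) (hK : IsConicFunctionField k a b K ι)
    (L : Type*) [Field L] (ι' : l →+* L) (hL : IsConicFunctionField l c d L ι')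
    (hKt : ∃ e : K ≃+* RatFunc k, ∀ r : k, e (ι r) = RatFunc.C r)
    (hLt : ∃ e' : L ≃+* RatFunc l, ∀ r : l, e' (ι' r) = RatFunc.C r)
    (α : SqClass K ≃* SqClass L) (hα : IsWittEquiv α) :
    (∃ β : SqClass k ≃* SqClass l, IsWittEquiv β ∧
        ∀ (r : kˣ) (s : lˣ),
          (β (sqCl r) = sqCl s ↔
            α (sqCl (Units.map ι.toMonoidHom r)) = sqCl (Units.map ι'.toMonoidHom s))) ∧
      Nat.card (ClassGroup (NumberField.RingOfIntegers k) ⧸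
          MonoidHom.range (powMonoidHom 2 :
            ClassGroup (NumberField.RingOfIntegers k) →* ClassGroup (NumberField.RingOfIntegers k))) =
        Nat.card (ClassGroup (NumberField.RingOfIntegers l) ⧸
          MonoidHom.range (powMonoidHom 2 :
            ClassGroup (NumberField.RingOfIntegers l) →* ClassGroup (NumberField.RingOfIntegers l))) := by
  obtain ⟨e, he⟩ := hKt
  obtain ⟨e', he'⟩ := hLt
  have h := (IsWittEquiv.refl K).realizes.comp_ringEquiv e
  have h' := hα.realizes.comp_ringEquiv e'
  refine ⟨?_, h.classCard_eq.symm.trans h'.classCard_eq⟩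
  obtain ⟨β, hβ, hrs⟩ := h.exists_wittEquiv h'
  refine ⟨β, hβ, fun r s => (hrs r s).trans ?_⟩
  have hr : Units.map e.symm.toMonoidHom (Units.map (RatFunc.C (K := k)).toMonoidHom r) =
      Units.map ι.toMonoidHom r := Units.ext (e.symm_apply_eq.2 (he r).symm)
  have hs : Units.map e'.symm.toMonoidHom (Units.map (RatFunc.C (K := l)).toMonoidHom s) =
      Units.map ι'.toMonoidHom s := Units.ext (e'.symm_apply_eq.2 (he' s).symm)
  rw [← hr, ← hs, ← α.eq_symm_apply]
  rfl

end
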